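/- Let n ≥ 2, s > -1, and let m ≥ 0 be an integer. Then there exist constants 0 < c < C < ∞ depending only on n, s, m such that for every M-harmonic function f on B_n one has (in the extended reals) c·‖f‖²_s ≤ Σ_{j₁,…,j_m=1}^{2n²} ‖X_{j₁}⋯X_{j_m} f‖²_{s+m} + |f(0)|² ≤ C·‖f‖²_s; in particular the middle quantity is finite if and only if f ∈ L²(B_n, dμ_s). -/

import Mathlib

open MeasureTheory ENNReal NNReal

/-- Pochhammer symbol `(a)_k = Γ(a+k)/Γ(a)`. -/
noncomputable def poch (a : ℝ) (k : ℕ) : ℝ := Real.Gamma (a + k) / Real.Gamma a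

/-- Gauss hypergeometric function `₂F₁(a,b;c;t)`, as a sum of its series. -/
noncomputable def hyp2F1 (a b c t : ℝ) : ℝ :=
  ∑' k : ℕ, (poch a k * poch b k) / (poch c k * (Nat.factorial k)) * t ^ k

/-- `S_pq(t)`. -/
noncomputable def Spq (n p q : ℕ) (t : ℝ) : ℝ :=
  (Real.Gamma (n + p) * Real.Gamma (n + q)) / (Real.Gamma n * Real.Gamma ((n : ℝ) + p + q)) *
    hyp2F1 p q ((p : ℝ) + q + n) t

/-- `c_pq(s)`. -/
noncomputable def cpq (n p q : ℕ) (s : ℝ) : ℝ :=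
  poch (s + 1) n / Real.Gamma n *
    ∫ t in Set.Ioo (0:ℝ) 1, t ^ ((p : ℝ) + q + n - 1) * (1 - t) ^ s * (Spq n p q t) ^ 2
noncomputable instance (n : ℕ) : MeasurableSpace (EuclideanSpace ℂ (Fin n)) := borel _
instance (n : ℕ) : BorelSpace (EuclideanSpace ℂ (Fin n)) := ⟨rfl⟩
/-- Lebesgue measure on `ℂⁿ`. -/
noncomputable instance (n : ℕ) : MeasureSpace (EuclideanSpace ℂ (Fin n)) :=
  ⟨Measure.map (⇑(PiLp.continuousLinearEquiv 2 ℝ (fun _ : Fin n => ℂ)).symm) volume⟩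

abbrev En (n : ℕ) := EuclideanSpace ℂ (Fin n)

/-- Wirtinger derivative `∂f/∂z_j`. -/
noncomputable def wd (n : ℕ) (j : Fin n) (f : En n → ℂ) (z : En n) : ℂ :=
  (1/2 : ℂ) * (fderiv ℝ f z (EuclideanSpace.single j 1) -
    Complex.I * fderiv ℝ f z (EuclideanSpace.single j Complex.I))

/-- Wirtinger derivative `∂f/∂z̄_j`. -/
noncomputable def wdb (n : ℕ) (j : Fin n) (f : En n → ℂ) (z : En n) : ℂ :=
  (1/2 : ℂ) * (fderiv ℝ f z (EuclideanSpace.single j 1) +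
    Complex.I * fderiv ℝ f z (EuclideanSpace.single j Complex.I))

/-- The complex-tangential field `L_{jk} = z̄_j ∂/∂z_k − z̄_k ∂/∂z_j`. -/
noncomputable def Lop (n : ℕ) (j k : Fin n) (f : En n → ℂ) : En n → ℂ :=
  fun z => (starRingEnd ℂ) (z j) * wd n k f z - (starRingEnd ℂ) (z k) * wd n j f z

/-- The complex-tangential field `L̄_{jk} = z_j ∂/∂z̄_k − z_k ∂/∂z̄_j`. -/
noncomputable def Lbarop (n : ℕ) (j k : Fin n) (f : En n → ℂ) : En n → ℂ :=
  fun z => z j * wdb n k f z - z k * wdb n j f z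

/-- `□ = −Σ_{j,k} (L_{jk}L̄_{jk} + L̄_{jk}L_{jk})`. -/
noncomputable def BoxOp (n : ℕ) (f : En n → ℂ) : En n → ℂ :=
  fun z => -∑ j : Fin n, ∑ k : Fin n, (Lop n j k (Lbarop n j k f) z + Lbarop n j k (Lop n j k f) z)

/-- `f` is `M`-harmonic on the unit ball (of smoothness class `m`):
`Δ̃f = 4(1-|z|²) Σ_{j,k}(δ_{jk} - z_j z̄_k) ∂²f/∂z_j∂z̄_k = 0` on the ball. -/
def MHarm (n : ℕ) (m : ℕ∞) (f : En n → ℂ) : Prop :=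
  ContDiffOn ℝ m f (Metric.ball 0 1) ∧
  ∀ z ∈ Metric.ball (0 : En n) 1,
    (4 : ℂ) * (1 - (‖z‖ : ℂ) ^ 2) *
      ∑ j : Fin n, ∑ k : Fin n,
        ((if j = k then 1 else 0) - z j * (starRingEnd ℂ) (z k)) * wd n j (wdb n k f) z = 0

/-- `‖f‖²_s = ∫_{B_n} |f|² dμ_s` as an extended real. -/
noncomputable def nsqE (n : ℕ) (s : ℝ) (f : En n → ℂ) : ℝ≥0∞ :=
  ∫⁻ z in Metric.ball (0 : En n) 1,
    ENNReal.ofReal (poch (s + 1) n / Real.pi ^ n * (1 - ‖z‖ ^ 2) ^ s * ‖f z‖ ^ 2)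

/-- `‖f‖²_s = ∫_{B_n} |f|² dμ_s` as a real number. -/
noncomputable def normSqS (n : ℕ) (s : ℝ) (f : En n → ℂ) : ℝ :=
  ∫ z in Metric.ball (0 : En n) 1,
    poch (s + 1) n / Real.pi ^ n * (1 - ‖z‖ ^ 2) ^ s * ‖f z‖ ^ 2

/-- The normalized surface measure `σ` on the unit sphere `∂B_n`. -/
noncomputable def sphMeas (n : ℕ) : Measure (Metric.sphere (0 : En n) 1) :=
  ((volume : Measure (En n)).toSphere Set.univ)⁻¹ • (volume : Measure (En n)).toSphere

/-- `‖g‖²_{∂B_n} = ∫_{∂B_n} |g|² dσ`. -/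
noncomputable def normSqSphere (n : ℕ) (g : En n → ℂ) : ℝ :=
  ∫ ζ : Metric.sphere (0 : En n) 1, ‖g (ζ : En n)‖ ^ 2 ∂ sphMeas n

/-- Membership in `H̃^{pq}`: `P` is a polynomial in `z, z̄`, homogeneous of bidegree `(p,q)`,
and harmonic for the Euclidean Laplacian `Δ = 4 Σ_j ∂²/∂z_j∂z̄_j` on `ℝ^{2n}`. -/
def InHtilde (n : ℕ) (p q : ℕ) (P : En n → ℂ) : Prop :=
  (∃ Q : MvPolynomial (Fin n ⊕ Fin n) ℂ,
    (∀ z : En n,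
      P z = MvPolynomial.eval (Sum.elim (fun j => z j) (fun j => (starRingEnd ℂ) (z j))) Q) ∧
    ∀ d ∈ Q.support,
      (∑ j : Fin n, d (Sum.inl j)) = p ∧ (∑ j : Fin n, d (Sum.inr j)) = q) ∧
  ∀ z : En n, ∑ j : Fin n, wd n j (wdb n j P) z = 0

/-- Index type for the `2n²` tangential operators `L_{jk}`, `L̄_{jk}`. -/
abbrev iotaX (n : ℕ) := (Fin n × Fin n) ⊕ (Fin n × Fin n)

/-- The enumeration `X_1, …, X_{2n²}` of the operators `L_{jk}`, `L̄_{jk}`. -/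
noncomputable def Xop (n : ℕ) : iotaX n → (En n → ℂ) → En n → ℂ :=
  Sum.elim (fun jk => Lop n jk.1 jk.2) (fun jk => Lbarop n jk.1 jk.2)

/-- Iterated operator `X_{j₁} ⋯ X_{j_m} f`. -/
noncomputable def iterX (n : ℕ) {m : ℕ} (js : Fin m → iotaX n) (f : En n → ℂ) : En n → ℂ :=
  (List.ofFn js).foldr (fun j g => Xop n j g) f

open scoped ContDiff

/-- A commutative algebra with the formal calculus of the Wirtinger derivatives `d j`, `db j`
in the coordinates `Z j`, `Zb j`. -/
structure WirtAlg (n : ℕ) (A : Type) [CommRing A] [Algebra ℂ A] where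
  d : Fin n → Derivation ℂ A A
  db : Fin n → Derivation ℂ A A
  Z : Fin n → A
  Zb : Fin n → A
  d_d : ∀ j k a, d j (d k a) = d k (d j a)
  db_d : ∀ j k a, db j (d k a) = d k (db j a)
  db_db : ∀ j k a, db j (db k a) = db k (db j a)
  d_Z : ∀ j k, d j (Z k) = if j = k then 1 else 0
  d_Zb : ∀ j k, d j (Zb k) = 0
  db_Z : ∀ j k, db j (Z k) = 0
  db_Zb : ∀ j k, db j (Zb k) = if j = k then 1 else 0

namespace WirtAlg

variable {n : ℕ} {A : Type} [CommRing A] [Algebra ℂ A] (S : WirtAlg n A)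

/-- Exchange of the holomorphic and antiholomorphic variables. -/
def swap : WirtAlg n A where
  d := S.db
  db := S.d
  Z := S.Zb
  Zb := S.Z
  d_d := S.db_db
  db_d := fun j k a => (S.db_d k j a).symm
  db_db := S.d_d
  d_Z := S.db_Zb
  d_Zb := S.db_Z
  db_Z := S.d_Zb
  db_Zb := S.d_Z

/-- `R = Σ z_j ∂_j`. -/
def R : Derivation ℂ A A := ∑ j, S.Z j • S.d j
/-- `R̄ = Σ z̄_j ∂̄_j`. -/
def Rb : Derivation ℂ A A := S.swap.R
/-- The Euler field `R + R̄`. -/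
def E : Derivation ℂ A A := S.R + S.Rb
/-- The field `R - R̄`. -/
def T : Derivation ℂ A A := S.R - S.Rb
/-- The field `L_{jk}`. -/
def L (j k : Fin n) : Derivation ℂ A A := S.Zb j • S.d k - S.Zb k • S.d j
/-- The field `L̄_{jk}`. -/
def Lb (j k : Fin n) : Derivation ℂ A A := S.swap.L j k
/-- `|z|²`. -/
def t : A := ∑ j, S.Z j * S.Zb j
/-- The operator `Σ ∂_j ∂̄_j - R R̄`. -/
def Q (a : A) : A := ∑ j, S.d j (S.db j a) - S.R (S.Rb a)
/-- The complex tangential fields. -/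
def X : iotaX n → Derivation ℂ A A := Sum.elim (fun jk => S.L jk.1 jk.2) (fun jk => S.Lb jk.1 jk.2)

theorem R_apply (a : A) : S.R a = ∑ j, S.Z j * S.d j a := by
  have h : (∑ j, S.Z j • S.d j : Derivation ℂ A A) a = ∑ j, (S.Z j • S.d j) a :=
    map_sum (Derivation.coeFnAddMonoidHom.comp (AddMonoidHom.id _) |> fun φ =>
      (Pi.evalAddMonoidHom (fun _ : A => A) a).comp φ) _ _
  simpa [R] using h

theorem Rb_apply (a : A) : S.Rb a = ∑ j, S.Zb j * S.db j a := S.swap.R_apply a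

theorem E_apply (a : A) : S.E a = S.R a + S.Rb a := rfl
theorem T_apply (a : A) : S.T a = S.R a - S.Rb a := rfl
theorem L_apply (j k : Fin n) (a : A) : S.L j k a = S.Zb j * S.d k a - S.Zb k * S.d j a := rfl
theorem Lb_apply (j k : Fin n) (a : A) : S.Lb j k a = S.Z j * S.db k a - S.Z k * S.db j a := rfl

theorem R_Z (j : Fin n) : S.R (S.Z j) = S.Z j := by simp [R_apply, S.d_Z]
theorem R_Zb (j : Fin n) : S.R (S.Zb j) = 0 := by simp [R_apply, S.d_Zb]
theorem Rb_Zb (j : Fin n) : S.Rb (S.Zb j) = S.Zb j := S.swap.R_Z j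
theorem Rb_Z (j : Fin n) : S.Rb (S.Z j) = 0 := S.swap.R_Zb j

theorem R_d (k : Fin n) (a : A) : S.R (S.d k a) = S.d k (S.R a) - S.d k a := by
  simp [R_apply, S.d_Z, S.d_d k, Finset.sum_add_distrib]

theorem R_db (k : Fin n) (a : A) : S.R (S.db k a) = S.db k (S.R a) := by
  simp [R_apply, S.db_Z, S.db_d k]

theorem Rb_db (k : Fin n) (a : A) : S.Rb (S.db k a) = S.db k (S.Rb a) - S.db k a := S.swap.R_d k a
theorem Rb_d (k : Fin n) (a : A) : S.Rb (S.d k a) = S.d k (S.Rb a) := S.swap.R_db k a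

theorem Rb_R (a : A) : S.Rb (S.R a) = S.R (S.Rb a) := by
  simp only [R_apply S, map_sum, Derivation.leibniz, smul_eq_mul, Rb_d, Rb_Z, mul_zero, add_zero]

theorem E_T (a : A) : S.E (S.T a) = S.T (S.E a) := by
  simp only [E_apply, T_apply, map_add, map_sub, Rb_R]; ring

theorem R_L (j k : Fin n) (a : A) : S.R (S.L j k a) = S.L j k (S.R a) - S.L j k a := by
  simp only [L_apply, map_sub, Derivation.leibniz, smul_eq_mul, R_d, R_Zb]; ring

theorem Rb_L (j k : Fin n) (a : A) : S.Rb (S.L j k a) = S.L j k (S.Rb a) + S.L j k a := by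
  simp only [L_apply, map_sub, Derivation.leibniz, smul_eq_mul, Rb_d, Rb_Zb]; ring

theorem Rb_Lb (j k : Fin n) (a : A) : S.Rb (S.Lb j k a) = S.Lb j k (S.Rb a) - S.Lb j k a :=
  S.swap.R_L j k a

theorem R_Lb (j k : Fin n) (a : A) : S.R (S.Lb j k a) = S.Lb j k (S.R a) + S.Lb j k a :=
  S.swap.Rb_L j k a

/-- The weight of a tangential field under rotation. -/
def sg {n : ℕ} : iotaX n → ℤ := Sum.elim (fun _ => 1) (fun _ => -1)

theorem E_X (i : iotaX n) (a : A) : S.E (S.X i a) = S.X i (S.E a) := by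
  rcases i with ⟨j, k⟩ | ⟨j, k⟩ <;>
  simp only [X, Sum.elim_inl, Sum.elim_inr, E_apply, R_L, Rb_L, R_Lb, Rb_Lb, map_add] <;> ring

theorem T_X (i : iotaX n) (a : A) : S.T (S.X i a) = S.X i (S.T a) - 2 * (sg i : A) * S.X i a := by
  rcases i with ⟨j, k⟩ | ⟨j, k⟩ <;>
  simp only [X, Sum.elim_inl, Sum.elim_inr, T_apply, R_L, Rb_L, R_Lb, Rb_Lb, map_sub, sg,
    Int.cast_one, Int.cast_neg] <;> ring

theorem swap_Q (a : A) : S.swap.Q a = S.Q a := by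
  simp only [Q]
  congr 1
  · exact Finset.sum_congr rfl fun j _ => S.db_d j j a
  · exact S.Rb_R a

theorem Q_L (j k : Fin n) (a : A) :
    S.Q (S.L j k a) = S.L j k (S.Q a) - S.T (S.L j k a) - S.L j k a := by
  have h : ∀ l, S.d l (S.db l (S.L j k a)) = S.L j k (S.d l (S.db l a))
      + ((if l = j then S.d k (S.d l a) else 0) - if l = k then S.d j (S.d l a) else 0) := by
    intro l
    simp only [L_apply, map_sub, Derivation.leibniz, smul_eq_mul, S.db_d, S.db_Zb, S.d_Zb, map_add,
      S.d_d l]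
    split_ifs <;> simp <;> ring
  simp only [Q, h, Finset.sum_add_distrib, Finset.sum_sub_distrib, Finset.sum_ite_eq',
    Finset.mem_univ, if_true, map_sub, map_sum, T_apply, R_L, Rb_L, map_add, S.d_d j k]
  ring

theorem Q_X (i : iotaX n) (a : A) :
    S.Q (S.X i a) = S.X i (S.Q a) - (sg i : A) * S.T (S.X i a) - S.X i a := by
  rcases i with ⟨j, k⟩ | ⟨j, k⟩
  · simpa [X, sg] using S.Q_L j k a
  · have h := S.swap.Q_L j k a
    simp only [swap_Q] at h
    have h2 : S.swap.T (S.Lb j k a) = - S.T (S.Lb j k a) := by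
      simp [T_apply, Rb, show S.swap.swap = S from rfl]
    change S.Q (S.Lb j k a) = S.Lb j k (S.Q a) - S.swap.T (S.Lb j k a) - _ at h
    simp only [X, sg, Sum.elim_inr, h, h2]
    push_cast
    change _ = S.Lb j k (S.Q a) - -1 * S.T (S.Lb j k a) - _
    ring_nf; rfl

theorem sum_L_Lb (a : A) : ∑ j, ∑ k, S.L j k (S.Lb j k a) =
    2 * (S.t * ∑ j, S.d j (S.db j a) - S.R (S.Rb a) - (n - 1) * S.Rb a) := by
  have h : ∀ j k, S.L j k (S.Lb j k a) =
      (S.Z j * S.Zb j) * S.d k (S.db k a) + (S.Z k * S.Zb k) * S.d j (S.db j a)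
      - S.Zb j * (S.Z k * S.d k (S.db j a)) - S.Zb k * (S.Z j * S.d j (S.db k a))
      - S.Zb j * S.db j a - S.Zb k * S.db k a + 2 * if j = k then S.Zb j * S.db j a else 0 := by
    intro j k
    simp only [L_apply, Lb_apply, map_sub, Derivation.leibniz, smul_eq_mul, S.d_Z]
    by_cases hjk : j = k
    · subst hjk; simp; ring
    · simp [hjk, Ne.symm hjk]; ring
  have h2 : ∑ j, S.Zb j * ∑ k, S.Z k * S.d k (S.db j a) = S.R (S.Rb a) := by
    rw [Rb_apply, map_sum]
    refine Finset.sum_congr rfl fun j _ => ?_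
    rw [Derivation.leibniz, R_Zb, R_apply]; simp
  have h3 : ∑ j, ∑ k, S.Zb k * (S.Z j * S.d j (S.db k a)) = S.R (S.Rb a) := by
    rw [← h2, Finset.sum_comm]; simp only [Finset.mul_sum]
  have h4 : ∑ x, S.Zb x * (n * S.db x a) = n * S.Rb a := by
    rw [Rb_apply, Finset.mul_sum]; exact Finset.sum_congr rfl fun _ _ => by ring
  simp only [h, Finset.sum_add_distrib, Finset.sum_sub_distrib, ← Finset.mul_sum, h2, h3,
    ← Finset.sum_mul, Finset.sum_const, Finset.card_univ, Fintype.card_fin, Finset.sum_ite_eq,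
    Finset.mem_univ, if_true, ← Rb_apply, nsmul_eq_mul]
  rw [t]; linear_combination -h4

theorem sum_Lb_L (a : A) : ∑ j, ∑ k, S.Lb j k (S.L j k a) =
    2 * (S.t * ∑ j, S.d j (S.db j a) - S.R (S.Rb a) - (n - 1) * S.R a) := by
  have h := S.swap.sum_L_Lb a
  have h2 : S.swap.t = S.t := Finset.sum_congr rfl fun j _ => mul_comm _ _
  rw [h2] at h
  have h3 : S.swap.R (S.swap.Rb a) = S.R (S.Rb a) := S.Rb_R a
  rw [h3] at h
  simp only [show ∀ j, S.swap.d j (S.swap.db j a) = S.d j (S.db j a) from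
    fun j => S.db_d j j a] at h
  exact h

theorem _root_.sum_iotaX {n : ℕ} {M : Type} [AddCommMonoid M] (F : iotaX n → M) : ∑ i, F i =
    ∑ j, ∑ k, F (Sum.inl (j, k)) + ∑ j, ∑ k, F (Sum.inr (j, k)) := by
  simp [Fintype.sum_sum_type, Fintype.sum_prod_type]

theorem four_t_Q (a : A) : 4 * S.t * S.Q a = ∑ i, S.X i (S.X i.swap a)
    + (1 - S.t) * (S.E (S.E a) - S.T (S.T a)) + 2 * (n - 1) * S.E a := by
  have h1 := S.sum_L_Lb a
  have h2 := S.sum_Lb_L a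
  have h3 : ∑ i, S.X i (S.X i.swap a) = ∑ j, ∑ k, S.L j k (S.Lb j k a) +
    ∑ j, ∑ k, S.Lb j k (S.L j k a) := by rw [sum_iotaX]; rfl
  rw [h3, h1, h2]
  simp only [Q, E_apply, T_apply, map_add, map_sub, Rb_R]
  ring

theorem T_eq (a : A) : 2 * (n - 1) * S.T a =
    ∑ j, ∑ k, (S.L j k (S.Lb j k a) - S.Lb j k (S.L j k a)) := by
  simp only [Finset.sum_sub_distrib, sum_L_Lb, sum_Lb_L, T_apply]; ring

theorem t_d (l : Fin n) (a : A) : S.t * S.d l a = ∑ k, S.Z k * S.L k l a + S.Zb l * S.R a := by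
  have h : ∑ k, S.Z k * S.L k l a = S.t * S.d l a - S.Zb l * S.R a := by
    simp only [L_apply, mul_sub, Finset.sum_sub_distrib, t, R_apply, Finset.sum_mul,
      Finset.mul_sum, mul_assoc, mul_left_comm]
  rw [h]; ring

/-- The field `∂_l - z̄_l R̄`. -/
def Al (l : Fin n) : Derivation ℂ A A := S.d l - S.Zb l • S.Rb

theorem Al_apply (l : Fin n) (a : A) : S.Al l a = S.d l a - S.Zb l * S.Rb a := rfl

theorem Q_Al (l : Fin n) (a : A) : S.Q (S.Al l a) = S.Al l (S.Q a) - S.Zb l * S.Q a := by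
  have h : ∀ j, S.d j (S.db j (S.Al l a)) = S.Al l (S.d j (S.db j a))
      - (S.Zb l * S.d j (S.db j a)) - if j = l then S.d l (S.Rb a) else 0 := by
    intro j
    have := S.Rb_db j a
    have h0 : S.db j (S.Rb a) = S.Rb (S.db j a) + S.db j a := by rw [Rb_db]; ring
    have h1 : S.d j (S.Rb a) = S.Rb (S.d j a) := by rw [Rb_d]
    simp only [Al_apply, map_sub, Derivation.leibniz, smul_eq_mul, S.db_d, S.db_Zb, S.d_Zb, map_add,
      S.d_d j, h0, Rb_d]
    by_cases hj : j = l
    · subst hj; simp [h1]; ring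
    · simp [hj]; ring
  simp only [Q, h, Finset.sum_sub_distrib, Finset.sum_ite_eq', Finset.mem_univ, if_true,
    ← Finset.mul_sum]
  simp only [Al_apply, map_sub, map_sum, Derivation.leibniz, smul_eq_mul, R_d, Rb_d, R_Zb, Rb_Zb,
    Rb_R, map_sub, map_add, mul_zero, add_zero]
  simp only [Finset.sum_sub_distrib, ← Finset.mul_sum]
  ring

theorem sum_Al (a : A) : ∑ l, S.Z l * S.Al l a + ∑ l, S.Zb l * S.swap.Al l a =
    (1 - S.t) * S.E a := by
  have h : ∑ l, S.Z l * S.Al l a = S.R a - S.t * S.Rb a := by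
    simp only [Al_apply, mul_sub, Finset.sum_sub_distrib, ← R_apply, t, Finset.sum_mul, mul_assoc]
  have h' : ∑ l, S.Zb l * S.swap.Al l a = S.Rb a - S.t * S.R a := by
    have h2 : ∀ l, S.Zb l * S.swap.Al l a = S.Zb l * S.db l a - S.Z l * S.Zb l * S.R a := by
      intro l
      change S.Zb l * (S.db l a - S.Z l * S.R a) = _
      ring
    simp only [h2, Finset.sum_sub_distrib, Rb_apply, t, Finset.sum_mul]
  rw [h, h', E_apply]; ring

end WirtAlg

/-- A Wirtinger algebra with a conjugation and an integral. -/
structure WirtInt (n : ℕ) (A : Type) [CommRing A] [Algebra ℂ A] extends WirtAlg n A where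
  cj : A →+* A
  I : A →ₗ[ℂ] ℂ
  cj_cj : ∀ a, cj (cj a) = a
  cj_d : ∀ j a, cj (d j a) = db j (cj a)
  cj_Z : ∀ j, cj (Z j) = Zb j
  I_cj : ∀ a, I (cj a) = starRingEnd ℂ (I a)

namespace WirtInt

variable {n : ℕ} {A : Type} [CommRing A] [Algebra ℂ A] (S : WirtInt n A)

theorem cj_Zb (j : Fin n) : S.cj (S.Zb j) = S.Z j := by rw [← cj_Z, cj_cj]

theorem cj_db (j : Fin n) (a : A) : S.cj (S.db j a) = S.d j (S.cj a) := by
  rw [← S.cj_cj (S.d j (S.cj a)), cj_d, cj_cj]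

theorem cj_R (a : A) : S.cj (S.R a) = S.Rb (S.cj a) := by
  simp [WirtAlg.R_apply, WirtAlg.Rb_apply, cj_Z, cj_d]

theorem cj_Rb (a : A) : S.cj (S.Rb a) = S.R (S.cj a) := by
  simp [WirtAlg.R_apply, WirtAlg.Rb_apply, cj_Zb, cj_db]

theorem cj_E (a : A) : S.cj (S.E a) = S.E (S.cj a) := by
  simp [WirtAlg.E_apply, cj_R, cj_Rb, add_comm]

theorem cj_T (a : A) : S.cj (S.T a) = - S.T (S.cj a) := by
  simp [WirtAlg.T_apply, cj_R, cj_Rb]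

theorem cj_X (i : iotaX n) (a : A) : S.cj (S.X i a) = S.X i.swap (S.cj a) := by
  rcases i with ⟨j, k⟩ | ⟨j, k⟩ <;>
  simp [WirtAlg.X, WirtAlg.L_apply, WirtAlg.Lb_apply, cj_Z, cj_Zb, cj_d, cj_db]

/-- `|a|²` -/
def N2 (a : A) : A := a * S.cj a

/-- The real part of the integral. -/
def J : A →+ ℝ := Complex.reLm.toAddMonoidHom.comp S.I.toAddMonoidHom

theorem J_apply (a : A) : S.J a = (S.I a).re := rfl

theorem J_cj (a : A) : S.J (S.cj a) = S.J a := by simp [J_apply, I_cj]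

theorem J_natCast_mul (k : ℕ) (a : A) : S.J ((k : A) * a) = k * S.J a := by
  rw [← nsmul_eq_mul, map_nsmul, nsmul_eq_mul]

theorem J_intCast_mul (k : ℤ) (a : A) : S.J ((k : A) * a) = k * S.J a := by
  rw [← zsmul_eq_mul, map_zsmul, zsmul_eq_mul]

theorem J_two_mul (a : A) : S.J (2 * a) = 2 * S.J a := by
  simpa using S.J_natCast_mul 2 a

/-- A radial real weight along which one may integrate by parts. -/
structure Wt (W : A) : Prop where
  d : ∀ j u, S.I (S.d j (W * u)) = 0
  db : ∀ j u, S.I (S.db j (W * u)) = 0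
  X : ∀ i, S.X i W = 0
  T : S.T W = 0
  cj : S.cj W = W

/-- The divergence of `W` times the Euler field. -/
def D (W : A) : A := S.E W + 2 * n * W

variable {S} {W : A} (hW : S.Wt W)

include hW

theorem Wt.I_X (i : iotaX n) (u : A) : S.I (W * S.X i u) = 0 := by
  have hX : ∀ i, S.X i (W * u) = W * S.X i u := by
    intro i; rw [Derivation.leibniz, hW.X]; simp
  rw [← hX]
  rcases i with ⟨j, k⟩ | ⟨j, k⟩
  · have : S.X (Sum.inl (j, k)) (W * u) = S.d k (W * (S.Zb j * u)) - S.d j (W * (S.Zb k * u)) := by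
      simp only [WirtAlg.X, Sum.elim_inl, WirtAlg.L_apply, Derivation.leibniz, S.d_Zb, smul_eq_mul]
      ring
    rw [this, map_sub, hW.d, hW.d, sub_zero]
  · have : S.X (Sum.inr (j, k)) (W * u) = S.db k (W * (S.Z j * u)) - S.db j (W * (S.Z k * u)) := by
      simp only [WirtAlg.X, Sum.elim_inr, WirtAlg.Lb_apply, Derivation.leibniz, S.db_Z, smul_eq_mul]
      ring
    rw [this, map_sub, hW.db, hW.db, sub_zero]

theorem Wt.I_R_mul (u : A) : S.I (S.R (W * u)) = - S.I (n * (W * u)) := by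
  have : ∑ j, S.d j (W * (S.Z j * u)) = S.R (W * u) + n * (W * u) := by
    have : ∀ j, S.d j (W * (S.Z j * u)) = S.Z j * S.d j (W * u) + W * u := by
      intro j
      simp only [Derivation.leibniz, S.d_Z, smul_eq_mul, if_true]
      ring
    simp only [this, Finset.sum_add_distrib, WirtAlg.R_apply]
    simp
  have h2 := congrArg S.I this
  rw [map_sum, map_add, Finset.sum_eq_zero fun j _ => hW.d j _] at h2
  linear_combination -h2

theorem Wt.I_Rb_mul (u : A) : S.I (S.Rb (W * u)) = - S.I (n * (W * u)) := by
  have : ∑ j, S.db j (W * (S.Zb j * u)) = S.Rb (W * u) + n * (W * u) := by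
    have : ∀ j, S.db j (W * (S.Zb j * u)) = S.Zb j * S.db j (W * u) + W * u := by
      intro j
      simp only [Derivation.leibniz, S.db_Zb, smul_eq_mul, if_true]
      ring
    simp only [this, Finset.sum_add_distrib, WirtAlg.Rb_apply]
    simp
  have h2 := congrArg S.I this
  rw [map_sum, map_add, Finset.sum_eq_zero fun j _ => hW.db j _] at h2
  linear_combination -h2

theorem Wt.I_E (u : A) : S.I (W * S.E u) = - S.I (S.D W * u) := by
  have h := congrArg₂ (· + ·) (hW.I_R_mul u) (hW.I_Rb_mul u)
  simp only [← map_add, ← WirtAlg.E_apply, ← map_neg] at h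
  rw [Derivation.leibniz] at h
  have h2 : W * S.E u = (W • S.E u + u • S.E W) - S.E W * u := by simp only [smul_eq_mul]; ring
  rw [h2, map_sub, h, ← map_sub, ← map_neg, D]
  congr 1; ring

theorem Wt.I_T (u : A) : S.I (W * S.T u) = 0 := by
  have h := congrArg₂ (· - ·) (hW.I_R_mul u) (hW.I_Rb_mul u)
  simp only [← map_sub, ← WirtAlg.T_apply, ← map_neg] at h
  rw [Derivation.leibniz, hW.T] at h
  simpa using h

theorem Wt.I_X_mul (i : iotaX n) (u v : A) :
    S.I (W * (S.X i u * S.cj v)) = - S.I (W * (u * S.cj (S.X i.swap v))) := by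
  have h := hW.I_X i (u * S.cj v)
  rw [← add_eq_zero_iff_eq_neg, ← map_add, ← h, Derivation.leibniz, cj_X, Sum.swap_swap]
  congr 1; simp only [smul_eq_mul]; ring

theorem Wt.I_T_mul (u v : A) : S.I (W * (S.T u * S.cj v)) = S.I (W * (u * S.cj (S.T v))) := by
  have h := hW.I_T (u * S.cj v)
  rw [← sub_eq_zero, ← map_sub, ← h, Derivation.leibniz, cj_T]
  congr 1; simp only [smul_eq_mul]; ring

theorem Wt.I_E_mul (u v : A) : S.I (W * (S.E u * S.cj v)) =
    - S.I (W * (u * S.cj (S.E v))) - S.I (S.D W * (u * S.cj v)) := by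
  have h := hW.I_E (u * S.cj v)
  rw [sub_eq_add_neg, ← h, ← sub_eq_zero, sub_add_eq_sub_sub, sub_neg_eq_add, ← map_add, ← map_sub,
    Derivation.leibniz, cj_E]
  convert map_zero S.I using 2
  simp only [smul_eq_mul]; ring

theorem Wt.J_X_mul (i : iotaX n) (u v : A) :
    S.J (W * (S.X i u * S.cj v)) = - S.J (W * (u * S.cj (S.X i.swap v))) := by
  simp [J_apply, hW.I_X_mul]

theorem Wt.J_T_mul (u v : A) : S.J (W * (S.T u * S.cj v)) = S.J (W * (u * S.cj (S.T v))) := by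
  simp [J_apply, hW.I_T_mul]

theorem Wt.J_E_mul (u v : A) : S.J (W * (S.E u * S.cj v)) =
    - S.J (W * (u * S.cj (S.E v))) - S.J (S.D W * (u * S.cj v)) := by
  simp [J_apply, hW.I_E_mul]

theorem Wt.J_comm (u v : A) : S.J (W * (u * S.cj v)) = S.J (W * (v * S.cj u)) := by
  rw [← J_cj]; simp only [map_mul, hW.cj, cj_cj]; rw [mul_comm v]

theorem Wt.J_E_self (u : A) : 2 * S.J (W * (S.E u * S.cj u)) = - S.J (S.D W * S.N2 u) := by
  have h := hW.J_E_mul u u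
  rw [hW.J_comm u (S.E u)] at h
  rw [N2]; linarith

/-- The energy identity obtained by pairing `Q g` with `g`. -/
theorem Wt.energy {V U : A} (hV : S.Wt V) (hU : S.Wt U) (hVW : V = (1 - S.t) * W)
    (hUW : U = 2 * (n - 1) * W - S.D V) (g : A) :
    S.J (W * (4 * S.t * S.Q g * S.cj g)) = - ∑ i, S.J (W * S.N2 (S.X i g)) - S.J (V * S.N2 (S.E g))
      - S.J (V * S.N2 (S.T g)) - (1 / 2) * S.J (S.D U * S.N2 g) := by
  have h1 : W * (4 * S.t * S.Q g * S.cj g) = ∑ i, W * (S.X i (S.X i.swap g) * S.cj g) +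
      (V * (S.E (S.E g) * S.cj g) - V * (S.T (S.T g) * S.cj g)) +
      (U * (S.E g * S.cj g) + S.D V * (S.E g * S.cj g)) := by
    rw [WirtAlg.four_t_Q, hUW, ← Finset.mul_sum, ← Finset.sum_mul, hVW]; ring
  have h2 : ∑ i, S.J (W * S.N2 (S.X i g)) = ∑ i, S.J (W * S.N2 (S.X (Sum.swap i) g)) :=
    (Equiv.sum_comp (Equiv.sumComm _ _) fun i => S.J (W * S.N2 (S.X i g))).symm
  rw [h1, map_add, map_add, map_sum, map_sub, map_add, h2, hV.J_E_mul, hV.J_T_mul]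
  have h3 := hU.J_E_self g
  simp only [hW.J_X_mul, N2, Finset.sum_neg_distrib] at h3 ⊢
  linarith

omit hW in
theorem two_mul_T (S : WirtInt n A) (a : A) : 2 * (n - 1) * S.T a =
    ∑ i, (WirtAlg.sg i : A) * S.X i (S.X i.swap a) := by
  rw [WirtAlg.T_eq, sum_iotaX]
  simp [WirtAlg.sg, WirtAlg.X, sub_eq_add_neg, Finset.sum_add_distrib]

theorem Wt.J_T_N2 (u v : A) : 2 * ((n : ℝ) - 1) * S.J (W * (S.T u * S.cj v)) =
    ∑ i, (WirtAlg.sg i : ℝ) * S.J (W * (S.X i u * S.cj (S.X i v))) := by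
  have h1 : (2 * ((n : ℤ) - 1) : ℤ) * (W * (S.T u * S.cj v)) =
      ∑ i, (WirtAlg.sg i : A) * (W * (S.X i (S.X i.swap u) * S.cj v)) := by
    push_cast
    rw [show 2 * ((n : A) - 1) * (W * (S.T u * S.cj v)) = W * S.cj v * (2 * (n - 1) * S.T u) by
      ring, two_mul_T, Finset.mul_sum]
    exact Finset.sum_congr rfl fun _ _ => by ring
  have h2 := congrArg S.J h1
  rw [J_intCast_mul] at h2
  push_cast at h2
  rw [h2, map_sum, ← Equiv.sum_comp (Equiv.sumComm _ _)]
  refine Finset.sum_congr rfl fun i _ => ?_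
  rw [J_intCast_mul, hW.J_X_mul]
  rcases i with ⟨j, k⟩ | ⟨j, k⟩ <;> simp [WirtAlg.sg]

omit hW in
theorem X_T (S : WirtInt n A) (i : iotaX n) (a : A) :
    2 * (WirtAlg.sg i : A) * S.X i a = S.X i (S.T a) - S.T (S.X i a) := by
  rw [WirtAlg.T_X]; ring

/-- The identity expressing `|X_i h|²` through second tangential derivatives. -/
theorem Wt.J_X_N2 (i : iotaX n) (h : A) : 2 * (WirtAlg.sg i : ℝ) * S.J (W * S.N2 (S.X i h)) =
    - S.J (W * (S.T h * S.cj (S.X i.swap (S.X i h)))) -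
      S.J (W * (S.T (S.X i h) * S.cj (S.X i h))) := by
  have h1 : ((2 * WirtAlg.sg i : ℤ) : A) * (W * S.N2 (S.X i h)) =
      W * (S.X i (S.T h) * S.cj (S.X i h)) - W * (S.T (S.X i h) * S.cj (S.X i h)) := by
    push_cast
    rw [N2]
    linear_combination (W * S.cj (S.X i h)) * X_T S i h
  have h2 := congrArg S.J h1
  rw [J_intCast_mul, map_sub, hW.J_X_mul] at h2
  push_cast at h2
  exact h2

/-- The energy identity obtained by pairing `Q g` with `E g`. -/
theorem Wt.energy_E {V : A} (hV : S.Wt V) (hVW : V = (1 - S.t) * W) (g : A) :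
    2 * S.J (W * (4 * S.t * S.Q g * S.cj (S.E g))) = 4 * ((n : ℝ) - 1) * S.J (W * S.N2 (S.E g))
      - S.J (S.D V * S.N2 (S.E g)) + ∑ i, S.J (S.D W * S.N2 (S.X i g)) +
      S.J (S.D V * S.N2 (S.T g)) := by
  have h1 : W * (4 * S.t * S.Q g * S.cj (S.E g)) =
      ∑ i, W * (S.X i (S.X i.swap g) * S.cj (S.E g)) +
      (V * (S.E (S.E g) * S.cj (S.E g)) - V * (S.T (S.T g) * S.cj (S.E g))) +
      ((2 * ((n : ℤ) - 1) : ℤ) : A) * (W * S.N2 (S.E g)) := by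
    rw [WirtAlg.four_t_Q, ← Finset.mul_sum, ← Finset.sum_mul, hVW, N2]; push_cast; ring
  have h2 : ∑ i, S.J (S.D W * S.N2 (S.X i g)) = ∑ i, S.J (S.D W * S.N2 (S.X (Sum.swap i) g)) :=
    (Equiv.sum_comp (Equiv.sumComm _ _) fun i => S.J (S.D W * S.N2 (S.X i g))).symm
  rw [h1, map_add, map_add, map_sum, map_sub, J_intCast_mul, hV.J_T_mul, h2, mul_add, mul_add,
    mul_sub, hV.J_E_self, ← WirtAlg.E_T, hV.J_comm, Finset.mul_sum, hV.J_E_self]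
  have h3 : ∀ i : iotaX n, 2 * S.J (W * (S.X i (S.X i.swap g) * S.cj (S.E g))) =
      S.J (S.D W * S.N2 (S.X i.swap g)) := by
    intro i
    rw [hW.J_X_mul, ← WirtAlg.E_X, hW.J_comm]
    linarith [hW.J_E_self (S.X i.swap g)]
  simp only [h3]
  push_cast
  ring

end WirtInt

instance (n : ℕ) : (volume : Measure (En n)).IsAddHaarMeasure :=
  ContinuousLinearEquiv.isAddHaarMeasure_map
    (PiLp.continuousLinearEquiv 2 ℝ (fun _ : Fin n => ℂ)).symm volume

/-- The algebra of smooth complex functions on `ℂⁿ`. -/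
def Sm (n : ℕ) : Subalgebra ℂ (En n → ℂ) where
  carrier := {f | ContDiff ℝ ∞ f}
  mul_mem' := fun {f g} (ha : ContDiff ℝ ∞ f) (hb : ContDiff ℝ ∞ g) =>
    (ha.mul hb : ContDiff ℝ ∞ (f * g))
  add_mem' := fun {f g} (ha : ContDiff ℝ ∞ f) (hb : ContDiff ℝ ∞ g) =>
    (ha.add hb : ContDiff ℝ ∞ (f + g))
  algebraMap_mem' := fun c => (contDiff_const : ContDiff ℝ ∞ fun _ : En n => c)

namespace Sm

variable {n : ℕ}

instance : CoeFun (Sm n) (fun _ => En n → ℂ) := ⟨fun a => a.1⟩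

theorem mem_iff {f : En n → ℂ} : f ∈ Sm n ↔ ContDiff ℝ ∞ f := Iff.rfl
theorem smooth (a : Sm n) : ContDiff ℝ ∞ a.1 := mem_iff.1 a.2
theorem cont (a : Sm n) : Continuous a.1 := (smooth a).continuous
theorem diff (a : Sm n) : Differentiable ℝ a.1 := (smooth a).differentiable (by simp)

@[ext] theorem ext {a b : Sm n} (h : ∀ z, a z = b z) : a = b := Subtype.ext (funext h)

@[simp] theorem add_val (a b : Sm n) (z : En n) : (a + b) z = a z + b z := rfl
@[simp] theorem sub_val (a b : Sm n) (z : En n) : (a - b) z = a z - b z := rfl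
@[simp] theorem neg_val (a : Sm n) (z : En n) : (-a) z = - a z := rfl
@[simp] theorem mul_val (a b : Sm n) (z : En n) : (a * b) z = a z * b z := rfl
@[simp] theorem smul_val (c : ℂ) (b : Sm n) (z : En n) : (c • b) z = c * b z := rfl
@[simp] theorem one_val (z : En n) : (1 : Sm n) z = 1 := rfl
@[simp] theorem zero_val (z : En n) : (0 : Sm n) z = 0 := rfl
/-- Evaluation at a point. -/
def ev (z : En n) : Sm n →+* ℂ := (Pi.evalRingHom (fun _ : En n => ℂ) z).comp (Sm n).val.toRingHom
theorem ev_val (z : En n) (a : Sm n) : ev z a = a z := rfl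
@[simp] theorem natCast_val (k : ℕ) (z : En n) : (k : Sm n) z = k := map_natCast (ev z) k
@[simp] theorem intCast_val (k : ℤ) (z : En n) : (k : Sm n) z = k := map_intCast (ev z) k
@[simp] theorem ofNat_val (k : ℕ) [k.AtLeastTwo] (z : En n) :
    (OfNat.ofNat k : Sm n) z = OfNat.ofNat k := map_ofNat (ev z) k
@[simp] theorem sum_val {ι : Type*} (s : Finset ι) (a : ι → Sm n) (z : En n) :
    (∑ i ∈ s, a i) z = ∑ i ∈ s, a i z := map_sum (ev z) a s

/-- The derivative in a fixed direction. -/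
noncomputable def dirD (v : En n) : Derivation ℂ (Sm n) (Sm n) :=
  Derivation.mk'
    { toFun := fun a => ⟨fun z => fderiv ℝ a.1 z v, mem_iff.2 <|
        ((smooth a).fderiv_right (m := ∞) (by simp)).clm_apply contDiff_const⟩
      map_add' := fun a b => by
        ext z
        change fderiv ℝ (a.1 + b.1) z v = _
        rw [fderiv_add (diff a z) (diff b z)]; rfl
      map_smul' := fun c a => by
        ext z
        change fderiv ℝ (c • a.1) z v = c * _
        rw [fderiv_const_smul (diff a z)]; rfl }
    (fun a b => by
      ext z
      change fderiv ℝ (a.1 * b.1) z v = a z * fderiv ℝ b.1 z v + b z * fderiv ℝ a.1 z v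
      rw [fderiv_mul (diff a z) (diff b z)]; rfl)

theorem dirD_val (v : En n) (a : Sm n) (z : En n) : dirD v a z = fderiv ℝ a.1 z v := rfl

theorem dirD_comm (v w : En n) (a : Sm n) : dirD v (dirD w a) = dirD w (dirD v a) := by
  ext z
  have hd : DifferentiableAt ℝ (fderiv ℝ a.1) z :=
    ((smooth a).fderiv_right (m := 1) (by norm_cast)).differentiable (by simp) z
  have h : ∀ v w : En n, dirD v (dirD w a) z = fderiv ℝ (fderiv ℝ a.1) z v w := by
    intro v w
    change fderiv ℝ (fun z => fderiv ℝ a.1 z w) z v = _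
    rw [fderiv_clm_apply hd (differentiableAt_const _)]
    simp
  rw [h, h]
  exact ((smooth a).contDiffAt.isSymmSndFDerivAt (by simp; norm_cast)) v w

/-- A coordinate function. -/
noncomputable def coord (j : Fin n) : Sm n :=
  ⟨fun z => z j, mem_iff.2 <| (EuclideanSpace.proj (𝕜 := ℂ) j).contDiff.restrict_scalars ℝ⟩

/-- Complex conjugation. -/
noncomputable def conj : Sm n →+* Sm n where
  toFun a := ⟨fun z => starRingEnd ℂ (a z), mem_iff.2 <| Complex.conjCLE.contDiff.comp (smooth a)⟩
  map_one' := by ext z; simp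
  map_mul' a b := by ext z; simp
  map_zero' := by ext z; simp
  map_add' a b := by ext z; simp

@[simp] theorem conj_val (a : Sm n) (z : En n) : conj a z = starRingEnd ℂ (a z) := rfl

theorem dirD_conj (v : En n) (a : Sm n) : dirD v (conj a) = conj (dirD v a) := by
  ext z
  change fderiv ℝ (fun z => Complex.conjCLE (a.1 z)) z v = starRingEnd ℂ (fderiv ℝ a.1 z v)
  have : HasFDerivAt (fun z => Complex.conjCLE (a.1 z))
    ((Complex.conjCLE : ℂ →L[ℝ] ℂ).comp (fderiv ℝ a.1 z)) z :=
    (Complex.conjCLE : ℂ →L[ℝ] ℂ).hasFDerivAt.comp z (diff a z).hasFDerivAt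
  rw [this.fderiv]; rfl

theorem dirD_coord (v : En n) (j : Fin n) (z : En n) : dirD v (coord j) z = v j := by
  change fderiv ℝ (fun z : En n => z j) z v = _
  have : HasFDerivAt (fun z : En n => z j)
    ((EuclideanSpace.proj (𝕜 := ℂ) j : En n →L[ℂ] ℂ).restrictScalars ℝ) z :=
    ((EuclideanSpace.proj (𝕜 := ℂ) j : En n →L[ℂ] ℂ).restrictScalars ℝ).hasFDerivAt
  rw [this.fderiv]; rfl

/-- The derivative `∂_j`. -/
noncomputable def dz (j : Fin n) : Derivation ℂ (Sm n) (Sm n) :=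
  (1 / 2 : ℂ) • (dirD (EuclideanSpace.single j 1) -
    Complex.I • dirD (EuclideanSpace.single j Complex.I))

/-- The derivative `∂̄_j`. -/
noncomputable def dzb (j : Fin n) : Derivation ℂ (Sm n) (Sm n) :=
  (1 / 2 : ℂ) • (dirD (EuclideanSpace.single j 1) +
    Complex.I • dirD (EuclideanSpace.single j Complex.I))

theorem dz_val (j : Fin n) (a : Sm n) (z : En n) : dz j a z = wd n j a.1 z := rfl
theorem dzb_val (j : Fin n) (a : Sm n) (z : En n) : dzb j a z = wdb n j a.1 z := rfl

theorem dz_eq (j : Fin n) (a : Sm n) : dz j a = (1 / 2 : ℂ) • (dirD (EuclideanSpace.single j 1) a -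
    Complex.I • dirD (EuclideanSpace.single j Complex.I) a) := rfl
theorem dzb_eq (j : Fin n) (a : Sm n) : dzb j a =
    (1 / 2 : ℂ) • (dirD (EuclideanSpace.single j 1) a +
    Complex.I • dirD (EuclideanSpace.single j Complex.I) a) := rfl

theorem conj_dz (j : Fin n) (a : Sm n) : conj (dz j a) = dzb j (conj a) := by
  rw [dz_eq, dzb_eq, dirD_conj, dirD_conj]
  ext z
  simp only [conj_val, smul_val, sub_val, add_val, map_mul, map_sub, Complex.conj_I, map_div₀,
    map_one, map_ofNat]
  ring

theorem dz_coord (j k : Fin n) : dz j (coord k) = if j = k then 1 else 0 := by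
  ext z
  rw [dz_eq]
  simp only [smul_val, sub_val, dirD_coord, PiLp.single_apply]
  by_cases h : j = k
  · subst h; simp; norm_num
  · simp [h, Ne.symm h]

theorem dzb_coord (j k : Fin n) : dzb j (coord k) = 0 := by
  ext z
  rw [dzb_eq]
  simp only [smul_val, add_val, dirD_coord, PiLp.single_apply]
  by_cases h : j = k
  · subst h; simp
  · simp [Ne.symm h]

theorem conj_conj (a : Sm n) : conj (conj a) = a := by ext z; simp

theorem dz_conj (j : Fin n) (a : Sm n) : dz j (conj a) = conj (dzb j a) := by
  rw [← conj_conj (dz j (conj a)), conj_dz, conj_conj]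

/-- The Wirtinger calculus on smooth functions. -/
noncomputable def WA (n : ℕ) : WirtAlg n (Sm n) where
  d := dz
  db := dzb
  Z := coord
  Zb := fun j => conj (coord j)
  d_d j k a := by
    simp only [dz_eq, Derivation.map_smul, map_sub, dirD_comm (EuclideanSpace.single j _)]
    ext z; simp; ring
  db_d j k a := by
    simp only [dz_eq, dzb_eq, Derivation.map_smul, map_sub, map_add,
      dirD_comm (EuclideanSpace.single j _)]
    ext z; simp; ring
  db_db j k a := by
    simp only [dzb_eq, Derivation.map_smul, map_add, dirD_comm (EuclideanSpace.single j _)]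
    ext z; simp; ring
  d_Z := dz_coord
  d_Zb j k := by rw [dz_conj, dzb_coord, map_zero]
  db_Z := dzb_coord
  db_Zb j k := by
    rw [← conj_dz, dz_coord]; split_ifs <;> simp

/-- The compact ball `1 - |z|² ≥ δ`. -/
def Kset (n : ℕ) (δ : ℝ) : Set (En n) := {z | δ ≤ 1 - ‖z‖ ^ 2}

theorem isClosed_Kset (δ : ℝ) : IsClosed (Kset n δ) :=
  isClosed_le continuous_const (by fun_prop)

theorem isCompact_Kset (δ : ℝ) : IsCompact (Kset n δ) := by
  refine Metric.isCompact_of_isClosed_isBounded (isClosed_Kset δ)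
    (Metric.isBounded_closedBall.subset (s := Kset n δ) (t := Metric.closedBall 0 (1 + |δ|)) ?_)
  intro z hz
  have hz : δ ≤ 1 - ‖z‖ ^ 2 := hz
  rw [mem_closedBall_zero_iff]
  nlinarith [neg_abs_le δ, abs_nonneg δ, norm_nonneg z]

theorem intK (a : Sm n) (δ : ℝ) : IntegrableOn a.1 (Kset n δ) :=
  (cont a).continuousOn.integrableOn_compact (isCompact_Kset δ)

/-- The integral over a compact ball. -/
noncomputable def intI (n : ℕ) (δ : ℝ) : Sm n →ₗ[ℂ] ℂ where
  toFun a := ∫ z in Kset n δ, a z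
  map_add' a b := integral_add (intK a δ) (intK b δ)
  map_smul' c _ := integral_const_mul c _

/-- The integral calculus on smooth functions. -/
noncomputable def WI (n : ℕ) (δ : ℝ) : WirtInt n (Sm n) where
  toWirtAlg := WA n
  cj := conj
  I := intI n δ
  cj_cj := conj_conj
  cj_d := conj_dz
  cj_Z _ := rfl
  I_cj _ := integral_conj

theorem dirD_zero_off (v : En n) (a : Sm n) {O : Set (En n)} (hO : IsOpen O)
    (h : ∀ z ∈ O, a z = 0) : ∀ z ∈ O, dirD v a z = 0 := by
  intro z hz
  have : a.1 =ᶠ[nhds z] fun _ => 0 := Filter.eventually_of_mem (hO.mem_nhds hz) h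
  rw [dirD_val, this.fderiv_eq]; simp

theorem integral_dirD (v : En n) (a : Sm n) {δ : ℝ} (h : ∀ z, z ∉ Kset n δ → a z = 0) :
    intI n δ (dirD v a) = 0 := by
  have h' := dirD_zero_off v a (isClosed_Kset δ).isOpen_compl h
  have hs : ∀ b : Sm n, (∀ z, z ∉ Kset n δ → b z = 0) → Integrable b.1 := fun b hb =>
    (cont b).integrable_of_hasCompactSupport (HasCompactSupport.intro (isCompact_Kset δ) hb)
  change ∫ z in Kset n δ, dirD v a z = 0
  rw [setIntegral_eq_integral_of_forall_compl_eq_zero h']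
  have h1 : Integrable (fun z => (1 : ℂ) * fderiv ℝ a.1 z v) (volume : Measure (En n)) := by
    simp only [one_mul]; exact hs _ h'
  have h2 : Integrable (fun z => (1 : ℂ) * a.1 z) (volume : Measure (En n)) := by
    simp only [one_mul]; exact hs a h
  have := integral_mul_fderiv_eq_neg_fderiv_mul_of_integrable (μ := (volume : Measure (En n)))
    (f := fun _ => (1 : ℂ)) (g := a.1) (v := v) (by simp) h1 h2 (by fun_prop)
    (fun x _ => diff a x)
  simp only [one_mul, fderiv_fun_const, Pi.zero_apply, zero_apply, zero_mul,
    integral_zero, neg_zero] at this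
  exact this

/-- The Wirtinger derivatives of a function vanishing off a compact ball integrate to zero. -/
theorem I_dz (a : Sm n) {δ : ℝ} (h : ∀ z, z ∉ Kset n δ → a z = 0) (j : Fin n) :
    intI n δ (dz j a) = 0 ∧ intI n δ (dzb j a) = 0 := by
  simp [dz_eq, dzb_eq, integral_dirD _ a h]

/-- A radial function. -/
noncomputable def rad (ψ : ℝ → ℝ) (hψ : ContDiff ℝ ∞ ψ) : Sm n :=
  ⟨fun z => (ψ (‖z‖ ^ 2) : ℂ), mem_iff.2 <|
    Complex.ofRealCLM.contDiff.comp (hψ.comp (contDiff_norm_sq ℝ))⟩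

theorem rad_val (ψ : ℝ → ℝ) (hψ : ContDiff ℝ ∞ ψ) (z : En n) :
    (rad ψ hψ : Sm n) z = (ψ (‖z‖ ^ 2) : ℂ) := rfl

theorem conj_rad (ψ : ℝ → ℝ) (hψ : ContDiff ℝ ∞ ψ) : conj (rad ψ hψ : Sm n) = rad ψ hψ := by
  ext z; simp [rad_val]

theorem contDiff_deriv {ψ : ℝ → ℝ} (hψ : ContDiff ℝ ∞ ψ) : ContDiff ℝ ∞ (deriv ψ) :=
  ((contDiff_infty_iff_deriv (𝕜 := ℝ)).1 hψ).2

theorem dirD_rad (ψ : ℝ → ℝ) (hψ : ContDiff ℝ ∞ ψ) (v z : En n) :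
    dirD v (rad ψ hψ : Sm n) z = (deriv ψ (‖z‖ ^ 2) * (2 * (inner ℂ z v).re) : ℝ) := by
  have h1 : HasFDerivAt (fun z : En n => ‖z‖ ^ 2) (2 • innerSL ℝ z) z := by
    simpa using (hasStrictFDerivAt_norm_sq z).hasFDerivAt
  have h2 : HasDerivAt ψ (deriv ψ (‖z‖ ^ 2)) (‖z‖ ^ 2) :=
    (hψ.differentiable (by simp) _).hasDerivAt
  have h3 := Complex.ofRealCLM.hasFDerivAt.comp z (h2.comp_hasFDerivAt z h1)
  change fderiv ℝ (Complex.ofRealCLM ∘ (ψ ∘ fun z : En n => ‖z‖ ^ 2)) z v = _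
  rw [h3.fderiv]
  have h4 : inner ℝ z v = (inner ℂ z v).re := by
    simp [PiLp.inner_apply, Complex.inner]
  simp [h4]

theorem dz_rad (ψ : ℝ → ℝ) (hψ : ContDiff ℝ ∞ ψ) (j : Fin n) :
    dz j (rad ψ hψ : Sm n) = conj (coord j) * rad (deriv ψ) (contDiff_deriv hψ) := by
  ext z
  rw [dz_eq]
  simp only [smul_val, sub_val, dirD_rad, EuclideanSpace.inner_single_right, mul_val, rad_val,
    conj_val]
  change _ = starRingEnd ℂ (z j) * _
  apply Complex.ext <;> simp <;> ring

theorem dzb_rad (ψ : ℝ → ℝ) (hψ : ContDiff ℝ ∞ ψ) (j : Fin n) :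
    dzb j (rad ψ hψ : Sm n) = coord j * rad (deriv ψ) (contDiff_deriv hψ) := by
  rw [← conj_rad, ← conj_dz, dz_rad, map_mul, conj_conj, conj_rad]

theorem t_val (z : En n) : (WA n).t z = ((‖z‖ ^ 2 : ℝ) : ℂ) := by
  simp only [WirtAlg.t, sum_val, mul_val]
  change ∑ i, z i * starRingEnd ℂ (z i) = _
  simp [EuclideanSpace.norm_sq_eq, Complex.mul_conj, Complex.normSq_eq_norm_sq]

theorem X_rad (ψ : ℝ → ℝ) (hψ : ContDiff ℝ ∞ ψ) (i : iotaX n) : (WA n).X i (rad ψ hψ) = 0 := by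
  rcases i with ⟨j, k⟩ | ⟨j, k⟩
  · change conj (coord j) * dz k (rad ψ hψ) - conj (coord k) * dz j (rad ψ hψ) = 0
    rw [dz_rad, dz_rad]; ring
  · change (coord j) * dzb k (rad ψ hψ) - (coord k) * dzb j (rad ψ hψ) = 0
    rw [dzb_rad, dzb_rad]; ring

theorem R_rad (ψ : ℝ → ℝ) (hψ : ContDiff ℝ ∞ ψ) :
    (WA n).R (rad ψ hψ) = (WA n).t * rad (deriv ψ) (contDiff_deriv hψ) := by
  rw [WirtAlg.R_apply, WirtAlg.t, Finset.sum_mul]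
  refine Finset.sum_congr rfl fun j _ => ?_
  change coord j * dz j (rad ψ hψ) = coord j * conj (coord j) * _
  rw [dz_rad]; ring

theorem Rb_rad (ψ : ℝ → ℝ) (hψ : ContDiff ℝ ∞ ψ) :
    (WA n).Rb (rad ψ hψ) = (WA n).t * rad (deriv ψ) (contDiff_deriv hψ) := by
  rw [WirtAlg.Rb_apply, WirtAlg.t, Finset.sum_mul]
  refine Finset.sum_congr rfl fun j _ => ?_
  change conj (coord j) * dzb j (rad ψ hψ) = coord j * conj (coord j) * _
  rw [dzb_rad]; ring

theorem E_rad (ψ : ℝ → ℝ) (hψ : ContDiff ℝ ∞ ψ) :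
    (WA n).E (rad ψ hψ) = 2 * (WA n).t * rad (deriv ψ) (contDiff_deriv hψ) := by
  rw [WirtAlg.E_apply, R_rad, Rb_rad]; ring

theorem T_rad (ψ : ℝ → ℝ) (hψ : ContDiff ℝ ∞ ψ) : (WA n).T (rad ψ hψ) = 0 := by
  rw [WirtAlg.T_apply, R_rad, Rb_rad]; ring

end Sm

namespace Sm

variable {n : ℕ}

/-- Radial functions supported in a compact ball. -/
def RW (n : ℕ) (δ : ℝ) (W : Sm n) : Prop :=
  ∃ (ψ : ℝ → ℝ) (hψ : ContDiff ℝ ∞ ψ), (∀ τ, 1 - δ < τ → ψ τ = 0) ∧ W = rad ψ hψ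

theorem rad_mul (ψ φ : ℝ → ℝ) (hψ : ContDiff ℝ ∞ ψ) (hφ : ContDiff ℝ ∞ φ) :
    (rad ψ hψ * rad φ hφ : Sm n) = rad (fun x => ψ x * φ x) (hψ.mul hφ) := by
  ext z; simp [rad_val]

theorem t_eq_rad : (WA n).t = rad (fun x => x) contDiff_id := by
  ext z; rw [t_val, rad_val]

theorem natCast_eq_rad (k : ℕ) : (k : Sm n) = rad (fun _ => (k : ℝ)) contDiff_const := by
  ext z; simp [rad_val]

variable {δ : ℝ} {W V : Sm n}

theorem RW.zero_off (h : RW n δ W) : ∀ z, z ∉ Kset n δ → W z = 0 := by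
  obtain ⟨ψ, hψ, h0, rfl⟩ := h
  intro z hz
  have hz : ¬ (δ ≤ 1 - ‖z‖ ^ 2) := hz
  rw [rad_val, h0 _ (by linarith)]; simp

theorem RW.wt (h : RW n δ W) : (WI n δ).Wt W := by
  have h0 : ∀ u : Sm n, ∀ z, z ∉ Kset n δ → (W * u) z = 0 := fun u z hz => by
    simp [h.zero_off z hz]
  obtain ⟨ψ, hψ, -, rfl⟩ := h
  exact ⟨fun j u => (I_dz _ (h0 u) j).1, fun j u => (I_dz _ (h0 u) j).2, X_rad ψ hψ, T_rad ψ hψ,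
    conj_rad ψ hψ⟩

theorem RW.add (h : RW n δ W) (h' : RW n δ V) : RW n δ (W + V) := by
  obtain ⟨ψ, hψ, h0, rfl⟩ := h
  obtain ⟨φ, hφ, h0', rfl⟩ := h'
  exact ⟨fun x => ψ x + φ x, hψ.add hφ, fun τ hτ => by simp [h0 τ hτ, h0' τ hτ],
    by ext z; simp [rad_val]⟩

theorem RW.neg (h : RW n δ W) : RW n δ (-W) := by
  obtain ⟨ψ, hψ, h0, rfl⟩ := h
  exact ⟨fun x => -ψ x, hψ.neg, fun τ hτ => by simp [h0 τ hτ], by ext z; simp [rad_val]⟩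

theorem RW.sub (h : RW n δ W) (h' : RW n δ V) : RW n δ (W - V) := by
  rw [sub_eq_add_neg]; exact h.add h'.neg

theorem RW.rad_mul (h : RW n δ W) (φ : ℝ → ℝ) (hφ : ContDiff ℝ ∞ φ) : RW n δ (rad φ hφ * W) := by
  obtain ⟨ψ, hψ, h0, rfl⟩ := h
  exact ⟨_, hφ.mul hψ, fun τ hτ => by simp [h0 τ hτ], Sm.rad_mul _ _ _ _⟩

theorem RW.t_mul (h : RW n δ W) : RW n δ ((WA n).t * W) := by
  rw [t_eq_rad]; exact h.rad_mul _ _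

theorem RW.natCast_mul (h : RW n δ W) (k : ℕ) : RW n δ ((k : Sm n) * W) := by
  rw [natCast_eq_rad]; exact h.rad_mul _ _

theorem RW.E (h : RW n δ W) : RW n δ ((WA n).E W) := by
  obtain ⟨ψ, hψ, h0, rfl⟩ := h
  rw [E_rad, mul_assoc]
  have : RW n δ (rad (deriv ψ) (contDiff_deriv hψ) : Sm n) := by
    refine ⟨_, _, fun τ hτ => ?_, rfl⟩
    have : ψ =ᶠ[nhds τ] fun _ => 0 := Filter.eventually_of_mem (isOpen_Ioi.mem_nhds hτ) h0
    rw [this.deriv_eq]; simp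
  exact_mod_cast this.t_mul.natCast_mul 2

theorem RW.D (h : RW n δ W) : RW n δ ((WI n δ).D W) := by
  have : (WI n δ).D W = (WA n).E W + (2 : ℕ) * ((n : Sm n) * W) := by
    rw [WirtInt.D]; push_cast; rw [mul_assoc]; rfl
  rw [this]
  exact h.E.add ((h.natCast_mul n).natCast_mul 2)

/-- A smooth profile vanishing below `1` and constant above `2`. -/
structure Cut where
  f : ℝ → ℝ
  smooth : ContDiff ℝ ∞ f
  zero : ∀ x, x < 1 → f x = 0
  const : ∃ c, ∀ x, 2 < x → f x = c

theorem Cut.bdd (Φ : Cut) : ∃ C, 0 ≤ C ∧ ∀ x, |Φ.f x| ≤ C := by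
  obtain ⟨c, hc⟩ := Φ.const
  obtain ⟨C, hC⟩ := isCompact_Icc.exists_bound_of_continuousOn (s := Set.Icc (1 : ℝ) 2)
    Φ.smooth.continuous.continuousOn
  refine ⟨max C |c|, (abs_nonneg c).trans (le_max_right _ _), fun x => ?_⟩
  by_cases h1 : x < 1
  · rw [Φ.zero x h1]; simp
  by_cases h2 : 2 < x
  · rw [hc x h2]; exact le_max_right _ _
  exact (hC x ⟨not_lt.1 h1, not_lt.1 h2⟩).trans (le_max_left _ _)

/-- The profile `b Φ + x Φ'`. -/
noncomputable def Cut.nxt (b : ℝ) (Φ : Cut) : Cut where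
  f := fun x => b * Φ.f x + x * deriv Φ.f x
  smooth := (contDiff_const.mul Φ.smooth).add (contDiff_id.mul (contDiff_deriv Φ.smooth))
  zero := fun x hx => by
    have : Φ.f =ᶠ[nhds x] fun _ => 0 := Filter.eventually_of_mem (isOpen_Iio.mem_nhds hx) Φ.zero
    rw [Φ.zero x hx, this.deriv_eq]; simp
  const := by
    obtain ⟨c, hc⟩ := Φ.const
    refine ⟨b * c, fun x hx => ?_⟩
    have : Φ.f =ᶠ[nhds x] fun _ => c := Filter.eventually_of_mem (isOpen_Ioi.mem_nhds hx) hc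
    rw [hc x hx, this.deriv_eq]; simp

/-- The standard monotone profile. -/
noncomputable def Cut.std : Cut where
  f := fun x => Real.smoothTransition (x - 1)
  smooth := Real.smoothTransition.contDiff.comp (contDiff_id.sub contDiff_const)
  zero := fun _ hx => Real.smoothTransition.zero_of_nonpos (by linarith)
  const := ⟨1, fun _ hx => Real.smoothTransition.one_of_one_le (by linarith)⟩

theorem Cut.std_nonneg (x : ℝ) : 0 ≤ Cut.std.f x := Real.smoothTransition.nonneg _
theorem Cut.std_le_one (x : ℝ) : Cut.std.f x ≤ 1 := Real.smoothTransition.le_one _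
theorem Cut.std_eq_one {x : ℝ} (h : 2 ≤ x) : Cut.std.f x = 1 :=
  Real.smoothTransition.one_of_one_le (by linarith)

theorem Cut.std_nxt (b : ℝ) {x : ℝ} (hx : 0 ≤ x) :
    b * Cut.std.f x ≤ (Cut.std.nxt b).f x := by
  have : 0 ≤ deriv Cut.std.f x := by
    have hm : Monotone Cut.std.f := fun x y h => Real.smoothTransition.monotone (by linarith)
    exact hm.deriv_nonneg
  change _ ≤ b * Cut.std.f x + x * deriv Cut.std.f x
  nlinarith [mul_nonneg hx this]

/-- The profile of a weight. -/
noncomputable def wtf (b : ℝ) (Φ : Cut) (δ : ℝ) (τ : ℝ) : ℝ := (1 - τ) ^ b * Φ.f ((1 - τ) / δ)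

theorem wtf_zero (b : ℝ) (Φ : Cut) (hδ : 0 < δ) {τ : ℝ} (h : 1 - δ < τ) : wtf b Φ δ τ = 0 := by
  rw [wtf, Φ.zero _ (by rw [div_lt_one hδ]; linarith), mul_zero]

theorem wtf_hasDerivAt (b : ℝ) (Φ : Cut) (hδ : 0 < δ) (τ : ℝ) :
    HasDerivAt (wtf b Φ δ) (-wtf (b - 1) (Φ.nxt b) δ τ) τ := by
  by_cases h : 1 - δ < τ
  · have : wtf b Φ δ =ᶠ[nhds τ] fun _ => 0 :=
      Filter.eventually_of_mem (isOpen_Ioi.mem_nhds h) fun x hx => wtf_zero b Φ hδ hx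
    rw [wtf_zero _ _ hδ h, neg_zero]
    exact (hasDerivAt_const τ (0 : ℝ)).congr_of_eventuallyEq this
  · have hτ : 0 < 1 - τ := by linarith
    have h1 : HasDerivAt (fun τ : ℝ => 1 - τ) (-1) τ := by
      simpa using (hasDerivAt_id τ).const_sub 1
    have h2 := h1.rpow_const (p := b) (Or.inl hτ.ne')
    have h3 : HasDerivAt Φ.f (deriv Φ.f ((1 - τ) / δ)) ((1 - τ) / δ) :=
      (Φ.smooth.differentiable (by simp) _).hasDerivAt
    have h4 := h3.comp τ (h1.div_const δ)
    refine (h2.mul h4).congr_deriv ?_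
    have h5 : (1 - τ) ^ b = (1 - τ) ^ (b - 1) * (1 - τ) := by
      rw [← Real.rpow_add_one hτ.ne']; ring_nf
    simp only [wtf, Cut.nxt, Function.comp, h5]
    field_simp
    ring

theorem contDiff_wtf (b : ℝ) (Φ : Cut) (hδ : 0 < δ) : ContDiff ℝ ∞ (wtf b Φ δ) := by
  rw [contDiff_iff_contDiffAt]
  intro τ
  by_cases h : 1 - δ < τ
  · have : wtf b Φ δ =ᶠ[nhds τ] fun _ => 0 :=
      Filter.eventually_of_mem (isOpen_Ioi.mem_nhds h) fun x hx => wtf_zero b Φ hδ hx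
    exact contDiffAt_const.congr_of_eventuallyEq this
  · have hτ : 0 < 1 - τ := by linarith
    have h1 : ContDiffAt ℝ ∞ (fun τ : ℝ => 1 - τ) τ := contDiffAt_const.sub contDiffAt_id
    exact (h1.rpow_const_of_ne hτ.ne').mul (Φ.smooth.contDiffAt.comp τ (h1.div_const δ))

/-- The weight `(1-|z|²)^b Φ((1-|z|²)/δ)`. -/
noncomputable def wt (b : ℝ) (Φ : Cut) (hδ : 0 < δ) : Sm n := rad (wtf b Φ δ) (contDiff_wtf b Φ hδ)

theorem rw_wt (b : ℝ) (Φ : Cut) (hδ : 0 < δ) : RW n δ (wt b Φ hδ) :=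
  ⟨_, _, fun _ hτ => wtf_zero b Φ hδ hτ, rfl⟩

theorem wt_val (b : ℝ) (Φ : Cut) (hδ : 0 < δ) (z : En n) :
    (wt b Φ hδ : Sm n) z = ((1 - ‖z‖ ^ 2) ^ b * Φ.f ((1 - ‖z‖ ^ 2) / δ) : ℝ) := rfl

theorem E_wt (b : ℝ) (Φ : Cut) (hδ : 0 < δ) :
    (WA n).E (wt b Φ hδ) = -(2 * (WA n).t * wt (b - 1) (Φ.nxt b) hδ) := by
  rw [wt, E_rad]
  have : (rad (deriv (wtf b Φ δ)) (contDiff_deriv (contDiff_wtf b Φ hδ)) : Sm n) =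
      - wt (b - 1) (Φ.nxt b) hδ := by
    ext z
    rw [rad_val, (wtf_hasDerivAt b Φ hδ _).deriv]
    simp [wt_val, wtf]
  rw [this]; ring

theorem one_sub_t_mul_wt (b : ℝ) (Φ : Cut) (hδ : 0 < δ) :
    (1 - (WA n).t) * wt b Φ hδ = wt (b + 1) Φ hδ := by
  ext z
  simp only [mul_val, sub_val, one_val, t_val, wt_val]
  norm_cast
  by_cases h : 1 - ‖z‖ ^ 2 < δ
  · rw [Φ.zero _ (by rwa [div_lt_one hδ])]; simp
  · rw [Real.rpow_add_one (by linarith)]; ring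

theorem E_t : (WA n).E (WA n).t = 2 * (WA n).t := by
  rw [t_eq_rad, E_rad, ← t_eq_rad]
  ext z; simp [rad_val]

theorem mem_K {z : En n} : z ∈ Kset n δ ↔ δ ≤ 1 - ‖z‖ ^ 2 := Iff.rfl

/-- A family of weights of order `b`. -/
def Bd (b : ℝ) (W : ∀ δ : ℝ, 0 < δ → Sm n) : Prop :=
  ∃ C, 0 ≤ C ∧ ∀ δ (hδ : 0 < δ), ∀ z ∈ Kset n δ, ‖W δ hδ z‖ ≤ C * (1 - ‖z‖ ^ 2) ^ b

theorem Bd.wt (b : ℝ) (Φ : Cut) : Bd b (fun _ hδ => (Sm.wt b Φ hδ : Sm n)) := by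
  obtain ⟨C, hC, h⟩ := Φ.bdd
  refine ⟨C, hC, fun δ hδ z hz => ?_⟩
  rw [mem_K] at hz
  rw [wt_val, Complex.norm_real, Real.norm_eq_abs, abs_mul, mul_comm,
    abs_of_nonneg (Real.rpow_nonneg (by linarith) b)]
  exact mul_le_mul_of_nonneg_right (h _) (Real.rpow_nonneg (by linarith) b)

theorem Bd.add {b : ℝ} {W V : ∀ δ : ℝ, 0 < δ → Sm n} (h : Bd b W) (h' : Bd b V) :
    Bd b (fun δ hδ => W δ hδ + V δ hδ) := by
  obtain ⟨C, hC, h⟩ := h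
  obtain ⟨C', hC', h'⟩ := h'
  refine ⟨C + C', by positivity, fun δ hδ z hz => ?_⟩
  rw [add_mul]
  exact (norm_add_le _ _).trans (add_le_add (h δ hδ z hz) (h' δ hδ z hz))

theorem Bd.neg {b : ℝ} {W : ∀ δ : ℝ, 0 < δ → Sm n} (h : Bd b W) :
    Bd b (fun δ hδ => - W δ hδ) := by
  obtain ⟨C, hC, h⟩ := h
  exact ⟨C, hC, fun δ hδ z hz => by rw [neg_val, norm_neg]; exact h δ hδ z hz⟩

theorem Bd.natCast_mul {b : ℝ} {W : ∀ δ : ℝ, 0 < δ → Sm n} (h : Bd b W) (k : ℕ) :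
    Bd b (fun δ hδ => (k : Sm n) * W δ hδ) := by
  obtain ⟨C, hC, h⟩ := h
  refine ⟨k * C, by positivity, fun δ hδ z hz => ?_⟩
  rw [mul_val, norm_mul, natCast_val, Complex.norm_natCast, mul_assoc]
  exact mul_le_mul_of_nonneg_left (h δ hδ z hz) (by positivity)

theorem Bd.t_mul {b : ℝ} {W : ∀ δ : ℝ, 0 < δ → Sm n} (h : Bd b W) :
    Bd b (fun δ hδ => (WA n).t * W δ hδ) := by
  obtain ⟨C, hC, h⟩ := h
  refine ⟨C, by positivity, fun δ hδ z hz => ?_⟩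
  rw [mul_val, norm_mul, t_val, Complex.norm_real, Real.norm_eq_abs, abs_of_nonneg (by positivity)]
  rw [mem_K] at hz
  have h2 := h δ hδ z hz
  nlinarith [norm_nonneg (W δ hδ z)]

theorem Bd.mono {b b' : ℝ} {W : ∀ δ : ℝ, 0 < δ → Sm n} (h : Bd b W) (hb : b' ≤ b) : Bd b' W := by
  obtain ⟨C, hC, h⟩ := h
  refine ⟨C, by positivity, fun δ hδ z hz => (h δ hδ z hz).trans ?_⟩
  rw [mem_K] at hz
  exact mul_le_mul_of_nonneg_left (Real.rpow_le_rpow_of_exponent_ge (by linarith)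
    (by nlinarith [sq_nonneg ‖z‖]) hb) hC

theorem N2_val (δ : ℝ) (g : Sm n) (z : En n) : (WI n δ).N2 g z = ((‖g z‖ ^ 2 : ℝ) : ℂ) := by
  change g z * starRingEnd ℂ (g z) = _
  rw [Complex.mul_conj, Complex.normSq_eq_norm_sq]

theorem re_mul_N2 (δ : ℝ) (W g : Sm n) (z : En n) :
    ((W * (WI n δ).N2 g) z).re = (W z).re * ‖g z‖ ^ 2 := by
  rw [mul_val, N2_val, Complex.re_mul_ofReal]

theorem J_val (δ : ℝ) (u : Sm n) : (WI n δ).J u = ∫ z in Kset n δ, (u z).re :=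
  (integral_re (intK u δ)).symm

theorem J_mono {u v : Sm n} (h : ∀ z ∈ Kset n δ, (u z).re ≤ (v z).re) :
    (WI n δ).J u ≤ (WI n δ).J v := by
  rw [J_val, J_val]
  exact setIntegral_mono_on (intK u δ).re (intK v δ).re (isClosed_Kset δ).measurableSet h

theorem J_smul (δ c : ℝ) (u : Sm n) : (WI n δ).J ((c : ℂ) • u) = c * (WI n δ).J u := by
  rw [WirtInt.J_apply, map_smul]; simp [WirtInt.J_apply]

/-- The weight equal to `(1-|z|²)^b` on the compact ball. -/
noncomputable def wA (b : ℝ) (hδ : 0 < δ) : Sm n := wt b Cut.std (half_pos hδ)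

theorem wA_val (b : ℝ) (hδ : 0 < δ) {z : En n} (hz : z ∈ Kset n δ) :
    (wA b hδ : Sm n) z = ((1 - ‖z‖ ^ 2) ^ b : ℝ) := by
  rw [mem_K] at hz
  rw [wA, wt_val, Cut.std_eq_one, mul_one]
  rw [le_div_iff₀ (by positivity)]; linarith

/-- The weighted `L²` norm on the compact ball. -/
noncomputable def Ai (b : ℝ) (hδ : 0 < δ) (g : Sm n) : ℝ := (WI n δ).J (wA b hδ * (WI n δ).N2 g)

end Sm

namespace Sm

variable {n : ℕ} {δ : ℝ}

theorem sg_sq (i : iotaX n) : WirtAlg.sg i ^ 2 = 1 := by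
  rcases i with ⟨j, k⟩ | ⟨j, k⟩ <;> simp [WirtAlg.sg]

theorem abs_sg (i : iotaX n) : |WirtAlg.sg i| = 1 := by
  rcases i with ⟨j, k⟩ | ⟨j, k⟩ <;> simp [WirtAlg.sg]

/-- The open ball `1 - |z|² > δ`. -/
def Oset (n : ℕ) (δ : ℝ) : Set (En n) := {z | δ < 1 - ‖z‖ ^ 2}

theorem isOpen_Oset (δ : ℝ) : IsOpen (Oset n δ) :=
  isOpen_lt continuous_const (by fun_prop)

theorem dz_zero_on (j : Fin n) {a : Sm n} {O : Set (En n)} (hO : IsOpen O)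
    (h : ∀ z ∈ O, a z = 0) : ∀ z ∈ O, dz j a z = 0 ∧ dzb j a z = 0 := by
  intro z hz
  simp [dz_eq, dzb_eq, dirD_zero_off _ a hO h z hz]

theorem X_zero_on (i : iotaX n) {a : Sm n} {O : Set (En n)} (hO : IsOpen O)
    (h : ∀ z ∈ O, a z = 0) : ∀ z ∈ O, (WA n).X i a z = 0 := by
  intro z hz
  rcases i with ⟨j, k⟩ | ⟨j, k⟩
  · change conj (coord j) z * dz k a z - conj (coord k) z * dz j a z = 0
    rw [(dz_zero_on k hO h z hz).1, (dz_zero_on j hO h z hz).1]; ring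
  · change coord j z * dzb k a z - coord k z * dzb j a z = 0
    rw [(dz_zero_on k hO h z hz).2, (dz_zero_on j hO h z hz).2]; ring

/-- The equation satisfied by tangential derivatives of an `M`-harmonic function. -/
def Eig (δ : ℝ) (k : ℤ) (g : Sm n) : Prop :=
  ∀ z ∈ Oset n (δ / 2), (WA n).Q g z = -(k * ((WA n).T g z + k * g z))

theorem Eig.X {k : ℤ} {g : Sm n} (h : Eig δ k g) (i : iotaX n) :
    Eig δ (k + WirtAlg.sg i) ((WA n).X i g) := by
  intro z hz
  have h0 : ∀ z ∈ Oset n (δ / 2),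
      ((WA n).Q g + ((k : ℤ) : Sm n) * ((WA n).T g + ((k : ℤ) : Sm n) * g)) z = 0 := by
    intro z hz
    simp [h z hz]
  have h1 := X_zero_on i (isOpen_Oset _) h0 z hz
  have hk : ∀ u : Sm n, (WA n).X i (((k : ℤ) : Sm n) * u) = ((k : ℤ) : Sm n) * (WA n).X i u := by
    intro u; rw [← zsmul_eq_mul, map_zsmul, zsmul_eq_mul]
  have h2 : 2 * (WirtAlg.sg i : Sm n) * (WA n).X i g =
      (WA n).X i ((WA n).T g) - (WA n).T ((WA n).X i g) := WirtInt.X_T (WI n δ) i g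
  have h3 : (WA n).X i ((WA n).T g) =
      (WA n).T ((WA n).X i g) + 2 * (WirtAlg.sg i : Sm n) * (WA n).X i g := by
    linear_combination -h2
  rw [map_add, hk, map_add, hk, h3] at h1
  rw [WirtAlg.Q_X]
  have h2v : (2 : Sm n) z = 2 := ofNat_val 2 z
  simp only [add_val, sub_val, mul_val, intCast_val, h2v] at h1 ⊢
  have h4 : ((WirtAlg.sg i : ℤ) : ℂ) ^ 2 = 1 := by
    exact_mod_cast congrArg (Int.cast : ℤ → ℂ) (sg_sq i)
  push_cast
  linear_combination h1 + (WA n).X i g z * h4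

theorem Bd.exists_le {b : ℝ} {W : ∀ δ : ℝ, 0 < δ → Sm n} (h : Bd b W) :
    ∃ C, 0 ≤ C ∧ ∀ δ (hδ : 0 < δ) (g : Sm n),
      |(WI n δ).J (W δ hδ * (WI n δ).N2 g)| ≤ C * Ai b hδ g := by
  obtain ⟨C, hC, h⟩ := h
  refine ⟨C, hC, fun δ hδ g => ?_⟩
  have key : ∀ z ∈ Kset n δ, |((W δ hδ * (WI n δ).N2 g) z).re| ≤
      (((C : ℂ) • (wA b hδ * (WI n δ).N2 g) : Sm n) z).re := by
    intro z hz
    rw [re_mul_N2, smul_val, Complex.re_ofReal_mul, re_mul_N2, wA_val b hδ hz, Complex.ofReal_re,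
      abs_mul, abs_of_nonneg (sq_nonneg ‖g z‖), ← mul_assoc]
    exact mul_le_mul_of_nonneg_right ((Complex.abs_re_le_norm _).trans (h δ hδ z hz)) (sq_nonneg _)
  rw [Ai, ← J_smul, abs_le, ← map_neg]
  exact ⟨J_mono fun z hz => by have := (abs_le.1 (key z hz)).1; rw [neg_val, Complex.neg_re]; exact this,
    J_mono fun z hz => (abs_le.1 (key z hz)).2⟩

theorem Ai_nonneg (b : ℝ) (hδ : 0 < δ) (g : Sm n) : 0 ≤ Ai b hδ g := by
  have : (WI n δ).J 0 ≤ Ai b hδ g := J_mono fun z hz => by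
    rw [re_mul_N2, wA_val b hδ hz, Complex.ofReal_re, zero_val, Complex.zero_re]
    rw [mem_K] at hz
    have : 0 ≤ 1 - ‖z‖ ^ 2 := by linarith
    positivity
  simpa using this

theorem wt_re (b : ℝ) (Φ : Cut) (hδ : 0 < δ) (z : En n) : ((wt b Φ hδ : Sm n) z).re =
    (1 - ‖z‖ ^ 2) ^ b * Φ.f ((1 - ‖z‖ ^ 2) / δ) := by
  rw [wt_val, Complex.ofReal_re]

theorem wt_nonneg (b : ℝ) {Φ : Cut} (hΦ : ∀ x, 0 ≤ x → 0 ≤ Φ.f x) (hδ : 0 < δ) {z : En n}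
    (hz : z ∈ Kset n δ) : 0 ≤ (1 - ‖z‖ ^ 2) ^ b * Φ.f ((1 - ‖z‖ ^ 2) / δ) := by
  rw [mem_K] at hz
  have : 0 ≤ 1 - ‖z‖ ^ 2 := by linarith
  have := hΦ _ (div_nonneg this hδ.le)
  positivity

theorem abs_re_mul_le (u v : ℂ) (w : ℝ) (hw : 0 ≤ w) :
    |((w : ℂ) * (u * starRingEnd ℂ v)).re| ≤ w * (‖u‖ * ‖v‖) := by
  refine (Complex.abs_re_le_norm _).trans ?_
  simp [abs_of_nonneg hw]

theorem D_wt (b : ℝ) (Φ : Cut) (hδ : 0 < δ) : (WI n δ).D (wt b Φ hδ) =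
    2 * ((n : Sm n) * wt b Φ hδ) - 2 * ((WA n).t * wt (b - 1) (Φ.nxt b) hδ) := by
  have : (WI n δ).D (wt b Φ hδ) = (WA n).E (wt b Φ hδ) + 2 * (n : Sm n) * wt b Φ hδ := rfl
  rw [this, E_wt]; ring

/-- The subprincipal weight in the energy identity. -/
theorem Bd_DU (b : ℝ) (Φ : Cut) : Bd (n := n) (b - 1) fun δ hδ => (WI n δ).D
    (2 * ((n : Sm n) - 1) * wt b Φ hδ - (WI n δ).D (wt (b + 1) Φ hδ)) := by
  have h : ∀ δ (hδ : 0 < δ), (WI n δ).D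
      (2 * ((n : Sm n) - 1) * wt b Φ hδ - (WI n δ).D (wt (b + 1) Φ hδ)) =
      -(((4 * n : ℕ) : Sm n) * ((WA n).t * wt (b - 1) (Φ.nxt b) hδ)) +
      ((4 : ℕ) : Sm n) * ((WA n).t * wt (b - 1) (Φ.nxt b) hδ) +
      ((8 * n : ℕ) : Sm n) * ((WA n).t * wt b (Φ.nxt (b + 1)) hδ) +
      ((4 : ℕ) : Sm n) * ((WA n).t * wt b (Φ.nxt (b + 1)) hδ) +
      -(((4 : ℕ) : Sm n) * ((WA n).t * ((WA n).t * wt (b - 1) ((Φ.nxt (b + 1)).nxt b) hδ))) +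
      ((4 * n ^ 2 : ℕ) : Sm n) * wt b Φ hδ + -(((4 * n : ℕ) : Sm n) * wt b Φ hδ) +
      -(((4 * n ^ 2 : ℕ) : Sm n) * wt (b + 1) Φ hδ) := by
    intro δ hδ
    have hD : ∀ u : Sm n, (WI n δ).D u = (WA n).E u + 2 * (n : Sm n) * u := fun _ => rfl
    rw [D_wt, hD]
    have hn : ∀ u, (WA n).E ((n : Sm n) * u) = n * (WA n).E u := fun u => by
      rw [← nsmul_eq_mul, map_nsmul, nsmul_eq_mul]
    have h2 : ∀ u, (WA n).E (2 * u) = 2 * (WA n).E u := fun u => by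
      rw [two_mul, map_add, two_mul]
    have : 2 * ((n : Sm n) - 1) * wt b Φ hδ =
        2 * ((n : Sm n) * wt b Φ hδ) - 2 * wt b Φ hδ := by ring
    rw [this]
    simp only [map_sub, h2, hn, Derivation.leibniz, E_t, E_wt, smul_eq_mul, add_sub_cancel_right]
    push_cast
    ring
  have h0 : b - 1 ≤ b := by linarith
  have h1 : b - 1 ≤ b + 1 := by linarith
  simp only [h]
  exact ((((((((((Bd.wt _ _).t_mul.natCast_mul _).neg.add ((Bd.wt _ _).t_mul.natCast_mul _))).add
    (((Bd.wt _ _).mono h0).t_mul.natCast_mul _)).add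
    (((Bd.wt _ _).mono h0).t_mul.natCast_mul _)).add
    ((Bd.wt _ _).t_mul.t_mul.natCast_mul _).neg).add
    (((Bd.wt _ _).mono h0).natCast_mul _))).add
    (((Bd.wt _ _).mono h0).natCast_mul _).neg).add
    (((Bd.wt _ _).mono h1).natCast_mul _).neg

/-- The integral of `W |g|²` over the compact ball. -/
noncomputable def jn (δ : ℝ) (W g : Sm n) : ℝ := (WI n δ).J (W * (WI n δ).N2 g)

theorem Ai_eq (b : ℝ) (hδ : 0 < δ) (g : Sm n) : Ai b hδ g = jn δ (wA b hδ) g := rfl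

theorem wA_re (b : ℝ) (hδ : 0 < δ) {z : En n} (hz : z ∈ Kset n δ) :
    ((wA b hδ : Sm n) z).re = (1 - ‖z‖ ^ 2) ^ b := by
  rw [wA_val b hδ hz, Complex.ofReal_re]

/-- Linear comparison of integrals from a pointwise comparison. -/
theorem J_le_sum {ι : Type*} (s : Finset ι) (u : Sm n) (c : ι → ℝ) (W v : ι → Sm n)
    (h : ∀ z ∈ Kset n δ, (u z).re ≤ ∑ i ∈ s, c i * ((W i z).re * ‖v i z‖ ^ 2)) :
    (WI n δ).J u ≤ ∑ i ∈ s, c i * jn δ (W i) (v i) := by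
  have : ∑ i ∈ s, c i * jn δ (W i) (v i) =
      (WI n δ).J (∑ i ∈ s, (c i : ℂ) • (W i * (WI n δ).N2 (v i))) := by
    rw [map_sum]; simp only [J_smul]; rfl
  rw [this]
  refine J_mono fun z hz => (h z hz).trans (le_of_eq ?_)
  rw [sum_val, Complex.re_sum]
  refine Finset.sum_congr rfl fun i _ => ?_
  rw [smul_val, Complex.re_ofReal_mul, re_mul_N2]

theorem J_le_two (u : Sm n) (c₁ c₂ : ℝ) (W₁ W₂ v₁ v₂ : Sm n)
    (h : ∀ z ∈ Kset n δ, (u z).re ≤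
      c₁ * ((W₁ z).re * ‖v₁ z‖ ^ 2) + c₂ * ((W₂ z).re * ‖v₂ z‖ ^ 2)) :
    (WI n δ).J u ≤ c₁ * jn δ W₁ v₁ + c₂ * jn δ W₂ v₂ := by
  have := J_le_sum (δ := δ) Finset.univ u ![c₁, c₂] ![W₁, W₂] ![v₁, v₂] (by simpa using h)
  simpa using this

theorem J_le_three (u : Sm n) (c₁ c₂ c₃ : ℝ) (W₁ W₂ W₃ v₁ v₂ v₃ : Sm n)
    (h : ∀ z ∈ Kset n δ, (u z).re ≤
      c₁ * ((W₁ z).re * ‖v₁ z‖ ^ 2) + c₂ * ((W₂ z).re * ‖v₂ z‖ ^ 2) +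
        c₃ * ((W₃ z).re * ‖v₃ z‖ ^ 2)) :
    (WI n δ).J u ≤ c₁ * jn δ W₁ v₁ + c₂ * jn δ W₂ v₂ + c₃ * jn δ W₃ v₃ := by
  have := J_le_sum (δ := δ) Finset.univ u ![c₁, c₂, c₃] ![W₁, W₂, W₃] ![v₁, v₂, v₃]
    (by simpa [Fin.sum_univ_three] using h)
  simpa [Fin.sum_univ_three] using this

theorem rpow_sub_one_mul {b ρ : ℝ} (h : 0 < ρ) : ρ ^ (b - 1) * ρ = ρ ^ b := by
  rw [← Real.rpow_add_one h.ne']; ring_nf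

theorem re_err_le (w τ : ℝ) (k : ℤ) (T g : ℂ) (M : ℝ) (hw : 0 ≤ w) (hτ : 0 ≤ τ) (hτ1 : τ ≤ 1)
    (hk : ((|k| : ℤ) : ℝ) ≤ M) :
    (-((w : ℂ) * (4 * (τ : ℂ) * -(k * (T + k * g)) * starRingEnd ℂ g))).re ≤
      4 * (w * (M * ‖T‖ + M ^ 2 * ‖g‖) * ‖g‖) := by
  refine (Complex.re_le_norm _).trans ?_
  have hk2 : ‖(k : ℂ)‖ ≤ M := by rw [Complex.norm_intCast]; exact_mod_cast hk
  have h1 : ‖T + k * g‖ ≤ ‖T‖ + M * ‖g‖ :=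
    (norm_add_le _ _).trans (by rw [norm_mul]; gcongr)
  have h2 : ‖(k : ℂ)‖ * ‖T + k * g‖ ≤ M * (‖T‖ + M * ‖g‖) :=
    mul_le_mul hk2 h1 (norm_nonneg _) ((norm_nonneg _).trans hk2)
  simp only [norm_neg, norm_mul, Complex.norm_real, Real.norm_eq_abs, abs_of_nonneg hw,
    abs_of_nonneg hτ, RCLike.norm_conj, Complex.norm_ofNat]
  have h3 : τ * (‖(k : ℂ)‖ * ‖T + k * g‖) ≤ 1 * (M * (‖T‖ + M * ‖g‖)) :=
    mul_le_mul hτ1 h2 (by positivity) (by norm_num)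
  calc w * (4 * τ * (‖(k : ℂ)‖ * ‖T + k * g‖) * ‖g‖)
      = 4 * (w * (τ * (‖(k : ℂ)‖ * ‖T + k * g‖)) * ‖g‖) := by ring
    _ ≤ 4 * (w * (1 * (M * (‖T‖ + M * ‖g‖))) * ‖g‖) := by gcongr
    _ = _ := by ring

/-- The energy estimate for tangential derivatives. -/
theorem energy_le (b : ℝ) (Φ : Cut) (hΦ : ∀ x, 0 ≤ x → 0 ≤ Φ.f x) (M : ℕ) :
    ∃ C, 0 ≤ C ∧ ∀ δ (hδ : 0 < δ) (k : ℤ) (g : Sm n), |k| ≤ M → Eig δ k g →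
      ∑ i, jn δ (wt b Φ hδ) ((WA n).X i g) + jn δ (wt (b + 1) Φ hδ) ((WA n).E g) +
        (1 / 2) * jn δ (wt (b + 1) Φ hδ) ((WA n).T g) ≤ C * Ai (b - 1) hδ g := by
  obtain ⟨C₁, hC₁, h₁⟩ := (Bd_DU (n := n) b Φ).exists_le
  obtain ⟨C₂, hC₂, h₂⟩ := (Bd.wt (n := n) (b - 1) Φ).exists_le
  refine ⟨(1 / 2) * C₁ + 12 * M ^ 2 * C₂, by positivity, fun δ hδ k g hk hg => ?_⟩
  have he := (rw_wt b Φ hδ).wt.energy (rw_wt (b + 1) Φ hδ).wt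
    (U := 2 * ((n : Sm n) - 1) * wt b Φ hδ - (WI n δ).D (wt (b + 1) Φ hδ))
    (RW.wt (by
      have h2 := (((rw_wt (n := n) b Φ hδ).natCast_mul n).natCast_mul 2).sub
        ((rw_wt b Φ hδ).natCast_mul 2)
      convert h2.sub (rw_wt (b + 1) Φ hδ).D using 2
      push_cast; ring)) (one_sub_t_mul_wt b Φ hδ).symm rfl g
  have hU := (abs_le.1 (h₁ δ hδ g)).1
  have hQ : (WI n δ).J (-(wt b Φ hδ * (4 * (WI n δ).t * (WI n δ).Q g * (WI n δ).cj g))) ≤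
      (1 / 2) * jn δ (wt (b + 1) Φ hδ) ((WA n).T g) +
        12 * M ^ 2 * jn δ (wt (b - 1) Φ hδ) g := by
    refine J_le_two _ _ _ _ _ _ _ fun z hz => ?_
    have hw := wt_nonneg b hΦ hδ hz
    have hz' : 0 < 1 - ‖z‖ ^ 2 := lt_of_lt_of_le hδ hz
    have hq := hg z (show δ / 2 < 1 - ‖z‖ ^ 2 by rw [mem_K] at hz; linarith)
    have hw1 := wt_nonneg (b - 1) hΦ hδ hz
    have ew : (1 - ‖z‖ ^ 2) ^ b * Φ.f ((1 - ‖z‖ ^ 2) / δ) =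
        (1 - ‖z‖ ^ 2) ^ (b - 1) * Φ.f ((1 - ‖z‖ ^ 2) / δ) * (1 - ‖z‖ ^ 2) := by
      rw [← rpow_sub_one_mul hz']; ring
    have ew2 : (1 - ‖z‖ ^ 2) ^ (b + 1) * Φ.f ((1 - ‖z‖ ^ 2) / δ) =
        (1 - ‖z‖ ^ 2) ^ (b - 1) * Φ.f ((1 - ‖z‖ ^ 2) / δ) * (1 - ‖z‖ ^ 2) ^ 2 := by
      rw [Real.rpow_add_one hz'.ne', ← rpow_sub_one_mul hz']; ring
    have hval : (-(wt b Φ hδ * (4 * (WI n δ).t * (WI n δ).Q g * (WI n δ).cj g)) : Sm n) z =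
        -(((wt b Φ hδ : Sm n) z) * (4 * (WA n).t z * (WA n).Q g z * starRingEnd ℂ (g z))) := by
      have h4 : (4 : Sm n) z = 4 := ofNat_val 4 z
      rw [← h4]; rfl
    simp only [wt_re]
    rw [hval, wt_val, hq, t_val, ew, ew2]
    have hρ1 : 1 - ‖z‖ ^ 2 ≤ 1 := by linarith [sq_nonneg ‖z‖]
    have hk' : ((|k| : ℤ) : ℝ) ≤ M := by exact_mod_cast hk
    refine (re_err_le _ _ _ _ _ (M : ℝ) (by positivity) (sq_nonneg _) (by linarith) hk').trans ?_
    generalize (1 - ‖z‖ ^ 2) ^ (b - 1) * Φ.f ((1 - ‖z‖ ^ 2) / δ) = w at *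
    generalize 1 - ‖z‖ ^ 2 = ρ at *
    have a1 : 0 ≤ w * (ρ * ‖(WA n).T g z‖ - 4 * M * ‖g z‖) ^ 2 := by positivity
    have a2 : w * ρ * (M ^ 2 * ‖g z‖ ^ 2) ≤ w * (M ^ 2 * ‖g z‖ ^ 2) :=
      mul_le_mul_of_nonneg_right (mul_le_of_le_one_right hw1 hρ1) (by positivity)
    nlinarith [a1, a2]
  rw [map_neg] at hQ
  have h2 := (abs_le.1 (h₂ δ hδ g)).2
  have h3 : 12 * (M : ℝ) ^ 2 * jn δ (wt (b - 1) Φ hδ) g ≤ 12 * M ^ 2 * (C₂ * Ai (b - 1) hδ g) :=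
    mul_le_mul_of_nonneg_left h2 (by positivity)
  change _ = - ∑ i, jn δ (wt b Φ hδ) ((WA n).X i g) - jn δ (wt (b + 1) Φ hδ) ((WA n).E g) -
    jn δ (wt (b + 1) Φ hδ) ((WA n).T g) - _ at he
  linarith

theorem jn_nonneg {W : Sm n} (h : ∀ z ∈ Kset n δ, 0 ≤ (W z).re) (g : Sm n) : 0 ≤ jn δ W g := by
  have : (WI n δ).J 0 ≤ jn δ W g := J_mono fun z hz => by
    rw [re_mul_N2, zero_val, Complex.zero_re]
    exact mul_nonneg (h z hz) (sq_nonneg _)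
  simpa using this

theorem jn_wt_nonneg (b : ℝ) {Φ : Cut} (hΦ : ∀ x, 0 ≤ x → 0 ≤ Φ.f x) (hδ : 0 < δ) (g : Sm n) :
    0 ≤ jn δ (wt b Φ hδ) g :=
  jn_nonneg (fun z hz => by rw [wt_re]; exact wt_nonneg b hΦ hδ hz) g

theorem two_mul_pred_pos (hn : 2 ≤ n) : (2 : ℝ) ≤ 2 * ((n : ℝ) - 1) := by
  have : (2 : ℝ) ≤ n := by exact_mod_cast hn
  linarith

/-- The estimate for the field `T` through tangential derivatives. -/
theorem T_le (hn : 2 ≤ n) (b : ℝ) (Φ : Cut) (hΦ : ∀ x, 0 ≤ x → 0 ≤ Φ.f x) (M : ℕ) :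
    ∃ C, 0 ≤ C ∧ ∀ δ (hδ : 0 < δ) (k : ℤ) (g : Sm n), |k| ≤ M → Eig δ k g →
      jn δ (wt b Φ hδ) ((WA n).T g) ≤ C * ∑ i, Ai (b - 1) hδ ((WA n).X i g) := by
  obtain ⟨C₁, hC₁, h₁⟩ := energy_le (n := n) b Φ hΦ (M + 1)
  obtain ⟨C₂, hC₂, h₂⟩ := (Bd.wt (n := n) (b - 1) Φ).exists_le
  refine ⟨C₁ + 3 * C₂, by positivity, fun δ hδ k g hk hg => ?_⟩
  have h := (rw_wt b Φ hδ).wt.J_T_N2 g ((WA n).T g)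
  have hi : ∀ i : iotaX n, (WirtAlg.sg i : ℝ) *
      (WI n δ).J (wt b Φ hδ * ((WI n δ).X i g * (WI n δ).cj ((WI n δ).X i ((WA n).T g)))) ≤
      (C₁ + 3 * C₂) * Ai (b - 1) hδ ((WA n).X i g) := by
    intro i
    have h3 : (WA n).X i ((WA n).T g) =
        (WA n).T ((WA n).X i g) + 2 * (WirtAlg.sg i : Sm n) * (WA n).X i g := by
      rw [WirtAlg.T_X]; ring
    have hE := h₁ δ hδ (k + WirtAlg.sg i) ((WA n).X i g)
      ((abs_add_le _ _).trans (by rw [abs_sg]; push_cast; linarith)) (hg.X i)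
    have hp : (WI n δ).J ((WirtAlg.sg i : Sm n) *
        (wt b Φ hδ * ((WI n δ).X i g * (WI n δ).cj ((WI n δ).X i ((WA n).T g))))) ≤
        (1 / 2) * jn δ (wt (b + 1) Φ hδ) ((WA n).T ((WA n).X i g)) +
          3 * jn δ (wt (b - 1) Φ hδ) ((WA n).X i g) := by
      refine J_le_two _ _ _ _ _ _ _ fun z hz => ?_
      have hz' : 0 < 1 - ‖z‖ ^ 2 := lt_of_lt_of_le hδ hz
      have hw1 := wt_nonneg (b - 1) hΦ hδ hz
      have ew : (1 - ‖z‖ ^ 2) ^ b * Φ.f ((1 - ‖z‖ ^ 2) / δ) =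
          (1 - ‖z‖ ^ 2) ^ (b - 1) * Φ.f ((1 - ‖z‖ ^ 2) / δ) * (1 - ‖z‖ ^ 2) := by
        rw [← rpow_sub_one_mul hz']; ring
      have ew2 : (1 - ‖z‖ ^ 2) ^ (b + 1) * Φ.f ((1 - ‖z‖ ^ 2) / δ) =
          (1 - ‖z‖ ^ 2) ^ (b - 1) * Φ.f ((1 - ‖z‖ ^ 2) / δ) * (1 - ‖z‖ ^ 2) ^ 2 := by
        rw [Real.rpow_add_one hz'.ne', ← rpow_sub_one_mul hz']; ring
      have hρ1 : 1 - ‖z‖ ^ 2 ≤ 1 := by linarith [sq_nonneg ‖z‖]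
      have hsg : ‖((WirtAlg.sg i : ℤ) : ℂ)‖ = 1 := by
        rw [Complex.norm_intCast]; exact_mod_cast abs_sg i
      have h2v : (2 : Sm n) z = 2 := ofNat_val 2 z
      refine (Complex.re_le_norm _).trans ?_
      change ‖((WirtAlg.sg i : Sm n) *
        (wt b Φ hδ * ((WA n).X i g * conj ((WA n).X i ((WA n).T g)))) : Sm n) z‖ ≤ _
      rw [h3]
      have hw : ‖(wt b Φ hδ : Sm n) z‖ = (1 - ‖z‖ ^ 2) ^ b * Φ.f ((1 - ‖z‖ ^ 2) / δ) := by
        rw [wt_val, Complex.norm_real, Real.norm_of_nonneg (wt_nonneg b hΦ hδ hz)]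
      simp only [mul_val, intCast_val, norm_mul, hsg, one_mul, hw, conj_val, RCLike.norm_conj,
        wt_re]
      have hs : ‖((WA n).T ((WA n).X i g) + 2 * (WirtAlg.sg i : Sm n) * (WA n).X i g) z‖ ≤
          ‖(WA n).T ((WA n).X i g) z‖ + 2 * ‖(WA n).X i g z‖ := by
        refine (norm_add_le _ _).trans ?_
        simp only [mul_val, intCast_val, norm_mul, h2v, hsg, mul_one, Complex.norm_ofNat, le_refl]
      rw [ew, ew2]
      refine (mul_le_mul_of_nonneg_left (mul_le_mul_of_nonneg_left hs (norm_nonneg _))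
        (mul_nonneg hw1 hz'.le)).trans ?_
      generalize (1 - ‖z‖ ^ 2) ^ (b - 1) * Φ.f ((1 - ‖z‖ ^ 2) / δ) = w at *
      generalize 1 - ‖z‖ ^ 2 = ρ at *
      have a1 : 0 ≤ w * (ρ * ‖(WA n).T ((WA n).X i g) z‖ - ‖(WA n).X i g z‖) ^ 2 := by positivity
      have a2 : w * ρ * (‖(WA n).X i g z‖ ^ 2) ≤ w * (‖(WA n).X i g z‖ ^ 2) :=
        mul_le_mul_of_nonneg_right (mul_le_of_le_one_right hw1 hρ1) (by positivity)
      nlinarith [a1, a2, mul_nonneg hw1 (sq_nonneg ‖(WA n).X i g z‖)]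
    rw [WirtInt.J_intCast_mul] at hp
    have h4 := (abs_le.1 (h₂ δ hδ ((WA n).X i g))).2
    have n1 := jn_wt_nonneg (b + 1) hΦ hδ ((WA n).E ((WA n).X i g))
    have n2 : 0 ≤ ∑ j, jn δ (wt b Φ hδ) ((WA n).X j ((WA n).X i g)) :=
      Finset.sum_nonneg fun j _ => jn_wt_nonneg b hΦ hδ _
    change jn _ _ _ ≤ _ at h4
    linarith
  have hsum := Finset.sum_le_sum fun i (_ : i ∈ Finset.univ) => hi i
  rw [← h, ← Finset.mul_sum] at hsum
  refine le_trans ?_ hsum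
  change jn δ (wt b Φ hδ) ((WA n).T g) ≤ 2 * ((n : ℝ) - 1) * jn δ (wt b Φ hδ) ((WA n).T g)
  have := jn_wt_nonneg b hΦ hδ ((WA n).T g)
  nlinarith [two_mul_pred_pos hn]

/-- A Poincaré inequality for tangential derivatives. -/
theorem poincare (hn : 2 ≤ n) {W : Sm n} (hW : RW n δ W) (hW0 : ∀ z ∈ Kset n δ, 0 ≤ (W z).re)
    (h : Sm n) (i : iotaX n) : jn δ W ((WA n).X i h) ≤
      (n ^ 2 + 1) * ∑ j, ∑ l, jn δ W ((WA n).X l ((WA n).X j h)) := by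
  set S := ∑ j, ∑ l, jn δ W ((WA n).X l ((WA n).X j h)) with hS
  have hj : ∀ j, ∑ l, jn δ W ((WA n).X l ((WA n).X j h)) ≤ S := fun j =>
    Finset.single_le_sum (f := fun j => ∑ l, jn δ W ((WA n).X l ((WA n).X j h)))
      (fun j _ => Finset.sum_nonneg fun l _ => jn_nonneg hW0 _) (Finset.mem_univ j)
  have hjl : ∀ j l, jn δ W ((WA n).X l ((WA n).X j h)) ≤ S := fun j l =>
    (Finset.single_le_sum (f := fun l => jn δ W ((WA n).X l ((WA n).X j h)))
      (fun l _ => jn_nonneg hW0 _) (Finset.mem_univ l)).trans (hj j)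
  have hS0 : 0 ≤ S := (jn_nonneg hW0 _).trans (hjl i i)
  have hdiag : ∑ j : iotaX n, jn δ W ((WA n).X j ((WA n).X j.swap h)) ≤ S := by
    have : ∑ j : iotaX n, jn δ W ((WA n).X j ((WA n).X j.swap h)) =
        ∑ j : iotaX n, jn δ W ((WA n).X j.swap ((WA n).X j h)) := by
      rw [← Equiv.sum_comp (Equiv.sumComm (Fin n × Fin n) (Fin n × Fin n))]
      simp
    rw [this]
    exact Finset.sum_le_sum fun j _ => Finset.single_le_sum
      (f := fun l => jn δ W ((WA n).X l ((WA n).X j h))) (fun l _ => jn_nonneg hW0 _)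
      (Finset.mem_univ _)
  have hT : jn δ W ((WA n).T h) ≤ n ^ 2 * S := by
    have h1 : jn δ W ((WA n).T h) ≤
        ∑ j : iotaX n, (n ^ 2 : ℝ) * jn δ W ((WA n).X j ((WA n).X j.swap h)) := by
      refine J_le_sum _ _ _ _ _ fun z hz => ?_
      rw [re_mul_N2]
      have h2 : 2 * ((n : Sm n) - 1) * (WA n).T h =
          ∑ j, (WirtAlg.sg j : Sm n) * (WA n).X j ((WA n).X j.swap h) :=
        WirtInt.two_mul_T (WI n δ) h
      have h3 := congrArg (fun u : Sm n => ‖u z‖) h2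
      have h2v : (2 : Sm n) z = 2 := ofNat_val 2 z
      simp only [mul_val, sub_val, sum_val, h2v, natCast_val, one_val, norm_mul] at h3
      have h4 : ‖(2 : ℂ)‖ * ‖(n : ℂ) - 1‖ = 2 * ((n : ℝ) - 1) := by
        have : (n : ℂ) - 1 = (((n : ℝ) - 1 : ℝ) : ℂ) := by push_cast; rfl
        have hn' := two_mul_pred_pos hn
        rw [this, Complex.norm_real, Real.norm_of_nonneg (by linarith)]; simp
      have hsg : ∀ i : iotaX n, ‖((WirtAlg.sg i : ℤ) : ℂ)‖ = 1 := fun i => by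
        rw [Complex.norm_intCast]; exact_mod_cast abs_sg i
      have h5 : 2 * ‖(WA n).T h z‖ ≤ ∑ j : iotaX n, ‖(WA n).X j ((WA n).X j.swap h) z‖ := by
        refine (mul_le_mul_of_nonneg_right (two_mul_pred_pos hn) (norm_nonneg _)).trans ?_
        rw [← h4, h3]
        refine (norm_sum_le _ _).trans (le_of_eq (Finset.sum_congr rfl fun j _ => ?_))
        rw [norm_mul, intCast_val, hsg, one_mul]
      have h6 := sq_sum_le_card_mul_sum_sq (s := Finset.univ)
        (f := fun j : iotaX n => ‖(WA n).X j ((WA n).X j.swap h) z‖)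
      have hc : ((Finset.univ : Finset (iotaX n)).card : ℝ) = 2 * n ^ 2 := by
        simp; ring
      rw [hc] at h6
      have h7 : ‖(WA n).T h z‖ ^ 2 ≤
          n ^ 2 * ∑ j : iotaX n, ‖(WA n).X j ((WA n).X j.swap h) z‖ ^ 2 := by
        have h8 : (2 * ‖(WA n).T h z‖) ^ 2 ≤ _ := pow_le_pow_left₀ (by positivity) h5 2
        have h9 : 0 ≤ (n : ℝ) ^ 2 * ∑ j : iotaX n, ‖(WA n).X j ((WA n).X j.swap h) z‖ ^ 2 := by
          positivity
        nlinarith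
      calc (W z).re * ‖(WA n).T h z‖ ^ 2 ≤ (W z).re * _ := mul_le_mul_of_nonneg_left h7 (hW0 z hz)
        _ = _ := by rw [Finset.mul_sum, Finset.mul_sum]; exact Finset.sum_congr rfl fun j _ => by ring
    rw [← Finset.mul_sum] at h1
    exact h1.trans (mul_le_mul_of_nonneg_left hdiag (by positivity))
  have hab : ∀ u v : Sm n, |(WI n δ).J (W * (u * (WI n δ).cj v))| ≤
      (1 / 2) * jn δ W u + (1 / 2) * jn δ W v := by
    intro u v
    have key : ∀ z ∈ Kset n δ, |((W * (u * conj v) : Sm n) z).re| ≤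
        (1 / 2) * ((W z).re * ‖u z‖ ^ 2) + (1 / 2) * ((W z).re * ‖v z‖ ^ 2) := by
      intro z hz
      have hWz : W z = ((W z).re : ℂ) := by
        obtain ⟨ψ, hψ, -, rfl⟩ := hW
        simp [rad_val]
      have h1 := abs_re_mul_le (u z) (v z) _ (hW0 z hz)
      rw [← hWz] at h1
      refine h1.trans ?_
      nlinarith [mul_nonneg (hW0 z hz) (sq_nonneg (‖u z‖ - ‖v z‖))]
    refine abs_le'.2 ⟨J_le_two _ _ _ _ _ _ _ fun z hz => (abs_le'.1 (key z hz)).1, ?_⟩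
    rw [← map_neg]
    exact J_le_two _ _ _ _ _ _ _ fun z hz => (abs_le'.1 (key z hz)).2
  have h1 := hW.wt.J_X_N2 i h
  have h2 := hW.wt.J_T_N2 ((WA n).X i h) ((WA n).X i h)
  have h3 : |2 * ((n : ℝ) - 1) * (WI n δ).J (W * ((WI n δ).T ((WA n).X i h) *
      (WI n δ).cj ((WA n).X i h)))| ≤ S := by
    rw [h2]
    refine (Finset.abs_sum_le_sum_abs _ _).trans (le_trans (Finset.sum_le_sum fun j _ => ?_) (hj i))
    rw [abs_mul]
    have e1 : |(WirtAlg.sg j : ℝ)| = 1 := by exact_mod_cast abs_sg j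
    rw [e1, one_mul]
    exact le_of_eq (abs_of_nonneg (jn_nonneg hW0 _))
  have h4 : |(WI n δ).J (W * ((WI n δ).T ((WA n).X i h) * (WI n δ).cj ((WA n).X i h)))| ≤ S := by
    rw [abs_mul, abs_of_nonneg (by linarith [two_mul_pred_pos hn])] at h3
    nlinarith [two_mul_pred_pos hn, abs_nonneg ((WI n δ).J (W * ((WI n δ).T ((WA n).X i h) *
      (WI n δ).cj ((WA n).X i h))))]
  have h5 := hab ((WA n).T h) ((WA n).X i.swap ((WA n).X i h))
  have h5 := abs_le.1 h5
  have h6 := hjl i i.swap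
  have h7 := abs_le.1 h4
  change 2 * (WirtAlg.sg i : ℝ) * jn δ W ((WA n).X i h) =
    - (WI n δ).J (W * ((WA n).T h * (WI n δ).cj ((WA n).X i.swap ((WA n).X i h)))) -
    (WI n δ).J (W * ((WI n δ).T ((WA n).X i h) * (WI n δ).cj ((WA n).X i h))) at h1
  have h8 : (WirtAlg.sg i : ℝ) = 1 ∨ (WirtAlg.sg i : ℝ) = -1 := by
    rcases i with ⟨j, k⟩ | ⟨j, k⟩ <;> simp [WirtAlg.sg]
  rcases h8 with h8 | h8 <;> rw [h8] at h1 <;>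
    linarith [h5.1, h5.2, h7.1, h7.2, mul_nonneg (sq_nonneg (n : ℝ)) hS0]

theorem J_le_one (u : Sm n) (c : ℝ) (W v : Sm n)
    (h : ∀ z ∈ Kset n δ, (u z).re ≤ c * ((W z).re * ‖v z‖ ^ 2)) :
    (WI n δ).J u ≤ c * jn δ W v := by
  have := J_le_sum (δ := δ) Finset.univ u ![c] ![W] ![v] (by simpa using h)
  simpa using this

theorem std_nonneg' : ∀ x, 0 ≤ x → 0 ≤ Cut.std.f x := fun x _ => Cut.std_nonneg x

theorem nxt_nonneg {b : ℝ} (hb : 0 ≤ b) : ∀ x, 0 ≤ x → 0 ≤ (Cut.std.nxt b).f x := fun x hx =>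
  (mul_nonneg hb (Cut.std_nonneg x)).trans (Cut.std_nxt b hx)

theorem Bd_D (b : ℝ) (Φ : Cut) : Bd (n := n) (b - 1) fun δ hδ => (WI n δ).D (wt b Φ hδ) := by
  have h : ∀ δ (hδ : 0 < δ), (WI n δ).D (wt b Φ hδ) = ((2 * n : ℕ) : Sm n) * wt b Φ hδ +
      -(((2 : ℕ) : Sm n) * ((WA n).t * wt (b - 1) (Φ.nxt b) hδ)) := by
    intro δ hδ
    rw [D_wt]; push_cast; ring
  simp only [h]
  exact (((Bd.wt _ _).mono (by linarith)).natCast_mul _).add ((Bd.wt _ _).t_mul.natCast_mul _).neg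

/-- The estimate for the Euler field through tangential derivatives. -/
theorem E_le (hn : 2 ≤ n) {b : ℝ} (hb : 0 ≤ b) (M : ℕ) :
    ∃ C, 0 ≤ C ∧ ∀ δ (hδ : 0 < δ) (k : ℤ) (g : Sm n), |k| ≤ M → Eig δ k g →
      jn δ ((WA n).t * wt b Cut.std hδ) ((WA n).E g) ≤
        C * (∑ i, Ai (b - 1) hδ ((WA n).X i g) + (k : ℝ) ^ 2 * jn δ (wt b Cut.std hδ) g) := by
  obtain ⟨C₁, hC₁, h₁⟩ := (Bd_D (n := n) b Cut.std).exists_le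
  obtain ⟨C₂, hC₂, h₂⟩ := T_le hn b Cut.std std_nonneg' M
  obtain ⟨C₃, hC₃, h₃⟩ := T_le hn b (Cut.std.nxt (b + 1)) (nxt_nonneg (by linarith)) M
  refine ⟨C₁ + 16 * M ^ 2 * C₂ + 16 * M ^ 2 + 2 * C₃, by positivity, fun δ hδ k g hk hg => ?_⟩
  have he := (rw_wt (n := n) b Cut.std hδ).wt.energy_E (rw_wt (b + 1) Cut.std hδ).wt
    (one_sub_t_mul_wt b Cut.std hδ).symm g
  have hDV : ∀ z ∈ Kset n δ, ((WI n δ).D (wt (b + 1) Cut.std hδ) z).re =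
      2 * n * ((1 - ‖z‖ ^ 2) * ((1 - ‖z‖ ^ 2) ^ b * Cut.std.f ((1 - ‖z‖ ^ 2) / δ))) -
      2 * (‖z‖ ^ 2 * ((1 - ‖z‖ ^ 2) ^ b * (Cut.std.nxt (b + 1)).f ((1 - ‖z‖ ^ 2) / δ))) := by
    intro z hz
    have hz' : 0 < 1 - ‖z‖ ^ 2 := lt_of_lt_of_le hδ hz
    have h2v : (2 : Sm n) z = 2 := ofNat_val 2 z
    rw [D_wt, sub_val, mul_val, mul_val, mul_val, mul_val, natCast_val, t_val, h2v, wt_val, wt_val,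
      add_sub_cancel_right, Real.rpow_add_one hz'.ne']
    norm_cast
    push_cast
    ring
  have hA : (WI n δ).J ((WI n δ).D (wt (b + 1) Cut.std hδ) * (WI n δ).N2 ((WA n).E g)) ≤
      (4 * ((n : ℝ) - 1)) * jn δ (wt b Cut.std hδ) ((WA n).E g) +
        (-4) * jn δ ((WA n).t * wt b Cut.std hδ) ((WA n).E g) := by
    refine J_le_two _ _ _ _ _ _ _ fun z hz => ?_
    have hz' : 0 < 1 - ‖z‖ ^ 2 := lt_of_lt_of_le hδ hz
    have hw := wt_nonneg b std_nonneg' hδ hz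
    have hx := Cut.std_nxt (b + 1) (div_nonneg hz'.le hδ.le)
    have hx2 := mul_le_mul_of_nonneg_left hx (Real.rpow_nonneg hz'.le b)
    rw [re_mul_N2, hDV z hz, mul_val, t_val, Complex.re_ofReal_mul, wt_re]
    have hv := sq_nonneg ‖(WA n).E g z‖
    generalize ‖(WA n).E g z‖ ^ 2 = v at *
    have ht : 0 ≤ ‖z‖ ^ 2 := sq_nonneg _
    have hn' : (2 : ℝ) ≤ n := by exact_mod_cast hn
    generalize (1 - ‖z‖ ^ 2) ^ b = r at *
    generalize Cut.std.f ((1 - ‖z‖ ^ 2) / δ) = φ at *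
    generalize (Cut.std.nxt (b + 1)).f ((1 - ‖z‖ ^ 2) / δ) = φ' at *
    generalize ‖z‖ ^ 2 = τ at *
    have a1 := mul_le_mul_of_nonneg_left hx2 ht
    have a2 : 0 ≤ (n - 2) * (r * φ) := mul_nonneg (by linarith) hw
    have a3 : 0 ≤ (n - 2) * (τ * (r * φ)) := mul_nonneg (by linarith) (mul_nonneg ht hw)
    have a4 : 0 ≤ b * (τ * (r * φ)) := mul_nonneg hb (mul_nonneg ht hw)
    have a5 : 2 * n * ((1 - τ) * (r * φ)) - 2 * (τ * (r * φ')) ≤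
        4 * (n - 1) * (r * φ) - 4 * (τ * (r * φ)) := by nlinarith
    have a6 := mul_le_mul_of_nonneg_right a5 hv
    linarith
  have hk' : ((|k| : ℤ) : ℝ) ≤ M := by exact_mod_cast hk
  have hB : (WI n δ).J (wt b Cut.std hδ * (4 * (WI n δ).t * (WI n δ).Q g * (WI n δ).cj ((WA n).E g))) ≤
      1 * jn δ ((WA n).t * wt b Cut.std hδ) ((WA n).E g) +
      (8 * M ^ 2) * jn δ (wt b Cut.std hδ) ((WA n).T g) +
      (8 * M ^ 2 * k ^ 2) * jn δ (wt b Cut.std hδ) g := by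
    refine J_le_three _ _ _ _ _ _ _ _ _ _ fun z hz => ?_
    have hw := wt_nonneg b std_nonneg' hδ hz
    have hz' : 0 < 1 - ‖z‖ ^ 2 := lt_of_lt_of_le hδ hz
    have hq := hg z (show δ / 2 < 1 - ‖z‖ ^ 2 by rw [mem_K] at hz; linarith)
    have hval : (wt b Cut.std hδ * (4 * (WI n δ).t * (WI n δ).Q g * (WI n δ).cj ((WA n).E g)) : Sm n) z =
        ((wt b Cut.std hδ : Sm n) z) * (4 * (WA n).t z * (WA n).Q g z *
          starRingEnd ℂ ((WA n).E g z)) := by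
      have h4 : (4 : Sm n) z = 4 := ofNat_val 4 z
      rw [← h4]; rfl
    refine (Complex.re_le_norm _).trans ?_
    rw [hval, hq, mul_val, t_val, Complex.re_ofReal_mul, wt_re, wt_val]
    simp only [norm_neg, norm_mul, Complex.norm_real, Real.norm_of_nonneg hw, RCLike.norm_conj,
      Complex.norm_ofNat, Real.norm_of_nonneg (sq_nonneg ‖z‖), Complex.norm_intCast]
    have h1 : ‖(WA n).T g z + k * g z‖ ≤ ‖(WA n).T g z‖ + |(k : ℝ)| * ‖g z‖ :=
      (norm_add_le _ _).trans (by rw [norm_mul, Complex.norm_intCast])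
    have ht : 0 ≤ ‖z‖ ^ 2 := sq_nonneg _
    have ht1 : ‖z‖ ^ 2 ≤ 1 := by linarith
    have hκ : |(k : ℝ)| ≤ M := by exact_mod_cast hk'
    have hk2 : (k : ℝ) ^ 2 = |(k : ℝ)| ^ 2 := (sq_abs _).symm
    rw [hk2]
    generalize (1 - ‖z‖ ^ 2) ^ b * Cut.std.f ((1 - ‖z‖ ^ 2) / δ) = w at *
    have hκ0 : 0 ≤ |(k : ℝ)| := abs_nonneg _
    generalize |(k : ℝ)| = κ at *
    have hx0 : 0 ≤ ‖(WA n).T g z + k * g z‖ := norm_nonneg _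
    generalize ‖(WA n).T g z + k * g z‖ = x at *
    have hT0 := norm_nonneg ((WA n).T g z)
    generalize ‖(WA n).T g z‖ = T at *
    have hg0 := norm_nonneg (g z)
    generalize ‖g z‖ = γ at *
    have hE0 := norm_nonneg ((WA n).E g z)
    generalize ‖(WA n).E g z‖ = ε at *
    generalize ‖z‖ ^ 2 = τ at *
    have a1 : 4 * (κ * x) * ε ≤ ε ^ 2 + 8 * (M ^ 2 * T ^ 2) + 8 * (M ^ 2 * κ ^ 2 * γ ^ 2) := by
      have b1 : κ * x ≤ M * (T + κ * γ) := mul_le_mul hκ h1 hx0 (hκ0.trans hκ)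
      have b2 : κ * x * ε ≤ M * (T + κ * γ) * ε := mul_le_mul_of_nonneg_right b1 hE0
      nlinarith [sq_nonneg (ε - 2 * (M * (T + κ * γ))), sq_nonneg (M * (T - κ * γ))]
    have hwτ : 0 ≤ w * τ := mul_nonneg hw ht
    have a2 := mul_le_mul_of_nonneg_left a1 hwτ
    have a3 : τ * (w * (8 * (M ^ 2 * T ^ 2) + 8 * (M ^ 2 * κ ^ 2 * γ ^ 2))) ≤
        1 * (w * (8 * (M ^ 2 * T ^ 2) + 8 * (M ^ 2 * κ ^ 2 * γ ^ 2))) :=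
      mul_le_mul_of_nonneg_right ht1 (by positivity)
    nlinarith
  have hC : -∑ i, (WI n δ).J ((WI n δ).D (wt b Cut.std hδ) * (WI n δ).N2 ((WI n δ).X i g)) ≤
      C₁ * ∑ i, Ai (b - 1) hδ ((WA n).X i g) := by
    rw [← Finset.sum_neg_distrib, Finset.mul_sum]
    exact Finset.sum_le_sum fun i _ => (neg_le_abs _).trans (h₁ δ hδ _)
  have hD : (WI n δ).J (-((WI n δ).D (wt (b + 1) Cut.std hδ) * (WI n δ).N2 ((WI n δ).T g))) ≤
      2 * jn δ (wt b (Cut.std.nxt (b + 1)) hδ) ((WA n).T g) := by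
    refine J_le_one _ _ _ _ fun z hz => ?_
    have hz' : 0 < 1 - ‖z‖ ^ 2 := lt_of_lt_of_le hδ hz
    have hw := wt_nonneg b std_nonneg' hδ hz
    have hw' := wt_nonneg b (nxt_nonneg (b := b + 1) (by linarith)) hδ hz
    change _ ≤ 2 * (((wt b (Cut.std.nxt (b + 1)) hδ : Sm n) z).re * ‖(WI n δ).T g z‖ ^ 2)
    rw [neg_val, Complex.neg_re, re_mul_N2, hDV z hz, wt_re]
    have hv := sq_nonneg ‖(WI n δ).T g z‖
    generalize ‖(WI n δ).T g z‖ ^ 2 = v at *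
    have ht1 : ‖z‖ ^ 2 ≤ 1 := by linarith
    have h1 := mul_nonneg (Nat.cast_nonneg (α := ℝ) n) (mul_nonneg hz'.le hw)
    have h2 := mul_le_of_le_one_left hw' ht1
    have h3 := mul_le_mul_of_nonneg_right h2 hv
    have h4 := mul_nonneg h1 hv
    linarith
  rw [map_neg] at hD
  have hT1 := h₂ δ hδ k g hk hg
  have hT2 := h₃ δ hδ k g hk hg
  have hT1' := mul_le_mul_of_nonneg_left hT1 (show (0 : ℝ) ≤ 16 * M ^ 2 by positivity)
  have hg0 := jn_wt_nonneg b std_nonneg' hδ g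
  have hS0 : 0 ≤ ∑ i, Ai (b - 1) hδ ((WA n).X i g) := Finset.sum_nonneg fun i _ => Ai_nonneg _ _ _
  have hE0 : 0 ≤ jn δ ((WA n).t * wt b Cut.std hδ) ((WA n).E g) := jn_nonneg (fun z hz => by
    rw [mul_val, t_val, Complex.re_ofReal_mul, wt_re]
    exact mul_nonneg (sq_nonneg _) (wt_nonneg b std_nonneg' hδ hz)) _
  change _ = 4 * ((n : ℝ) - 1) * jn δ (wt b Cut.std hδ) ((WA n).E g) - _ + _ + _ at he
  change 2 * (WI n δ).J (wt b Cut.std hδ *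
    (4 * (WI n δ).t * (WI n δ).Q g * (WI n δ).cj ((WA n).E g))) = _ - 
    (WI n δ).J ((WI n δ).D (wt (b + 1) Cut.std hδ) * (WI n δ).N2 ((WA n).E g)) + _ + _ at he
  generalize ∑ i, Ai (b - 1) hδ ((WA n).X i g) = S at *
  generalize jn δ (wt b Cut.std hδ) g = G at *
  have p1 : 0 ≤ (C₁ + 16 * M ^ 2 * C₂ + 2 * C₃) * ((k : ℝ) ^ 2 * G) := by positivity
  have p2 : 0 ≤ 16 * (M : ℝ) ^ 2 * S := by positivity
  nlinarith

/-- A Hardy inequality: the weight improves by one power at the cost of an Euler derivative. -/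
theorem hardy {b : ℝ} (hb : 0 < b) (hδ : 0 < δ) (g : Sm n) :
    b * jn δ (wt (b - 1) Cut.std hδ) g ≤ (3 * b + 4 + 2 * n) * jn δ (wt b Cut.std hδ) g +
      (1 / b) * jn δ ((WA n).t * wt (b + 1) Cut.std hδ) ((WA n).E g) := by
  have hW := ((rw_wt (n := n) b Cut.std hδ).t_mul.t_mul)
  have hDW : (WI n δ).D ((WA n).t * ((WA n).t * wt b Cut.std hδ)) =
      (WA n).t * ((WA n).t * (((4 : ℕ) : Sm n) * wt b Cut.std hδ +
        (((2 * n : ℕ) : Sm n) * wt b Cut.std hδ -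
          ((2 : ℕ) : Sm n) * ((WA n).t * wt (b - 1) (Cut.std.nxt b) hδ)))) := by
    have h1 := D_wt (n := n) b Cut.std hδ
    rw [WirtInt.D] at h1 ⊢
    change (WA n).E (wt b Cut.std hδ) + _ = _ at h1
    change (WA n).E ((WA n).t * ((WA n).t * wt b Cut.std hδ)) + _ = _
    simp only [Derivation.leibniz, smul_eq_mul, E_t]
    push_cast
    linear_combination ((WA n).t * (WA n).t) * h1
  have hs := hW.wt.J_E_self g
  have hJ : b * jn δ (wt (b - 1) Cut.std hδ) g = (WI n δ).J (((b : ℝ) : ℂ) •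
      (wt (b - 1) Cut.std hδ * (WI n δ).N2 g) +
      ((WI n δ).D ((WA n).t * ((WA n).t * wt b Cut.std hδ)) * (WI n δ).N2 g +
        2 * ((WA n).t * ((WA n).t * wt b Cut.std hδ) * ((WI n δ).E g * (WI n δ).cj g)))) := by
    rw [map_add, map_add, J_smul, WirtInt.J_two_mul, hs, jn]
    ring
  rw [hJ, hDW]
  refine J_le_two _ _ _ _ _ _ _ fun z hz => ?_
  have hz' : 0 < 1 - ‖z‖ ^ 2 := lt_of_lt_of_le hδ hz
  have hw := wt_nonneg (b - 1) std_nonneg' hδ hz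
  have hx := mul_le_mul_of_nonneg_left (Cut.std_nxt b (div_nonneg hz'.le hδ.le))
    (Real.rpow_nonneg hz'.le (b - 1))
  have hval : ((2 : Sm n) * ((WA n).t * ((WA n).t * wt b Cut.std hδ) *
      ((WI n δ).E g * (WI n δ).cj g)) : Sm n) z =
      2 * ((WA n).t z * ((WA n).t z * wt b Cut.std hδ z) * ((WA n).E g z * starRingEnd ℂ (g z))) := by
    have h2 : (2 : Sm n) z = 2 := ofNat_val 2 z
    rw [← h2]; rfl
  have hval2 : ((WA n).t * ((WA n).t * (((4 : ℕ) : Sm n) * wt b Cut.std hδ +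
        (((2 * n : ℕ) : Sm n) * wt b Cut.std hδ -
          ((2 : ℕ) : Sm n) * ((WA n).t * wt (b - 1) (Cut.std.nxt b) hδ)))) : Sm n) z =
      (((‖z‖ ^ 2 * (‖z‖ ^ 2 * (4 * ((1 - ‖z‖ ^ 2) ^ b * Cut.std.f ((1 - ‖z‖ ^ 2) / δ)) +
        ((2 * n : ℕ) * ((1 - ‖z‖ ^ 2) ^ b * Cut.std.f ((1 - ‖z‖ ^ 2) / δ)) -
          2 * (‖z‖ ^ 2 * ((1 - ‖z‖ ^ 2) ^ (b - 1) * (Cut.std.nxt b).f ((1 - ‖z‖ ^ 2) / δ)))))) : ℝ)) : ℂ) := by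
    simp only [mul_val, add_val, sub_val, natCast_val, t_val, wt_val]
    push_cast
    ring
  rw [add_val, Complex.add_re, add_val, Complex.add_re, smul_val, Complex.re_ofReal_mul, re_mul_N2,
    re_mul_N2, hval, hval2, Complex.ofReal_re, mul_val, t_val, Complex.re_ofReal_mul, wt_re, wt_re,
    wt_re, wt_val]
  have hE : (2 * (((‖z‖ ^ 2 : ℝ) : ℂ) * (((‖z‖ ^ 2 : ℝ) : ℂ) *
      (((1 - ‖z‖ ^ 2) ^ b * Cut.std.f ((1 - ‖z‖ ^ 2) / δ) : ℝ) : ℂ)) *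
      ((WA n).E g z * starRingEnd ℂ (g z)))).re ≤
      2 * (‖z‖ ^ 2 * (‖z‖ ^ 2 * ((1 - ‖z‖ ^ 2) ^ b * Cut.std.f ((1 - ‖z‖ ^ 2) / δ))) *
        (‖(WA n).E g z‖ * ‖g z‖)) := by
    refine (Complex.re_le_norm _).trans (le_of_eq ?_)
    simp only [norm_mul, Complex.norm_real, RCLike.norm_conj, Complex.norm_ofNat,
      Real.norm_of_nonneg (sq_nonneg ‖z‖), Real.norm_of_nonneg (Cut.std_nonneg _),
      Real.norm_of_nonneg (Real.rpow_nonneg hz'.le b)]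
  refine (add_le_add_right (add_le_add_right hE _) _).trans ?_
  rw [Real.rpow_add_one hz'.ne', ← rpow_sub_one_mul (b := b) hz']
  have ht : 0 ≤ ‖z‖ ^ 2 := sq_nonneg _
  push_cast
  generalize (1 - ‖z‖ ^ 2) ^ (b - 1) = r at *
  generalize Cut.std.f ((1 - ‖z‖ ^ 2) / δ) = φ at *
  generalize (Cut.std.nxt b).f ((1 - ‖z‖ ^ 2) / δ) = φ' at *
  generalize ‖z‖ ^ 2 = τ at *
  generalize ‖(WA n).E g z‖ = ε at *
  generalize ‖g z‖ = γ at *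
  have hβ : b * (1 / b) = 1 := by field_simp
  have hβ0 : 0 < 1 / b := by positivity
  generalize 1 / b = β at *
  have e1 : 2 * (τ ^ 2 * (1 - τ) * (ε * γ)) ≤ τ * (1 - τ) ^ 2 * ε ^ 2 * β + b * τ ^ 3 * γ ^ 2 := by
    have h0 := mul_nonneg (mul_nonneg ht hβ0.le) (sq_nonneg ((1 - τ) * ε - b * τ * γ))
    have h1 : τ * β * ((1 - τ) * ε - b * τ * γ) ^ 2 = τ * (1 - τ) ^ 2 * ε ^ 2 * β +
        b * τ ^ 3 * γ ^ 2 - 2 * (τ ^ 2 * (1 - τ) * (ε * γ)) := by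
      linear_combination (-2 * τ ^ 2 * (1 - τ) * ε * γ + b * τ ^ 3 * γ ^ 2) * hβ
    linarith
  have e2 := mul_le_mul_of_nonneg_left e1 hw
  have e3 := mul_le_mul_of_nonneg_right hx (show 0 ≤ τ ^ 3 * γ ^ 2 by positivity)
  have e4 : 0 ≤ (r * φ) * γ ^ 2 * (b * (3 * (1 - τ) - (1 - τ ^ 3))) := by
    refine mul_nonneg (mul_nonneg hw (sq_nonneg _)) (mul_nonneg hb.le ?_)
    nlinarith [mul_nonneg (sq_nonneg (1 - τ)) (show 0 ≤ 2 + τ by linarith)]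
  have e5 : 0 ≤ (4 + 2 * n) * ((r * φ) * (1 - τ) * γ ^ 2) * (1 - τ ^ 2) := by
    refine mul_nonneg (mul_nonneg (by positivity) (mul_nonneg (mul_nonneg hw hz'.le) (sq_nonneg _))) ?_
    nlinarith
  linarith

theorem jn_wt_le_Ai (b : ℝ) (hδ : 0 < δ) (g : Sm n) : jn δ (wt b Cut.std hδ) g ≤ Ai b hδ g := by
  have := J_le_one (wt b Cut.std hδ * (WI n δ).N2 g) 1 (wA b hδ) g (δ := δ) fun z hz => by
    rw [re_mul_N2, wt_re, wA_re b hδ hz, one_mul]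
    exact mul_le_mul_of_nonneg_right (mul_le_of_le_one_right
      (Real.rpow_nonneg (hδ.le.trans hz) b) (Cut.std_le_one _)) (sq_nonneg _)
  rwa [one_mul] at this

theorem jn_wt_add_one_le (b : ℝ) (hδ : 0 < δ) (g : Sm n) :
    jn δ (wt (b + 1) Cut.std hδ) g ≤ jn δ (wt b Cut.std hδ) g := by
  have := J_le_one (wt (b + 1) Cut.std hδ * (WI n δ).N2 g) 1 (wt b Cut.std hδ) g (δ := δ)
    fun z hz => by
      have hz' : 0 < 1 - ‖z‖ ^ 2 := lt_of_lt_of_le hδ hz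
      rw [re_mul_N2, wt_re, wt_re, one_mul, Real.rpow_add_one hz'.ne',
        mul_right_comm ((1 - ‖z‖ ^ 2) ^ b)]
      have hz1 : 1 - ‖z‖ ^ 2 ≤ 1 := by linarith [sq_nonneg ‖z‖]
      exact mul_le_mul_of_nonneg_right (mul_le_of_le_one_right
        (wt_nonneg b std_nonneg' hδ hz) hz1) (sq_nonneg _)
  rwa [one_mul] at this

/-- First-order lower bound for a tangential derivative in terms of second-order ones. -/
theorem lower_X (hn : 2 ≤ n) {b : ℝ} (hb : 0 < b) (M : ℕ) :
    ∃ C, 0 ≤ C ∧ ∀ δ (hδ : 0 < δ) (k : ℤ) (g : Sm n), |k| ≤ M → Eig δ k g → ∀ i,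
      jn δ (wt (b - 1) Cut.std hδ) ((WA n).X i g) ≤
        C * ∑ j, ∑ l, Ai b hδ ((WA n).X l ((WA n).X j g)) := by
  obtain ⟨C, hC, h⟩ := E_le hn (b := b + 1) (by linarith) (M + 1)
  simp only [add_sub_cancel_right] at h
  refine ⟨(1 / b) * ((3 * b + 4 + 2 * n) * (n ^ 2 + 1) +
    (1 / b) * (C * (1 + (M + 1) ^ 2 * (n ^ 2 + 1)))), by positivity, fun δ hδ k g hk hg i => ?_⟩
  have hk' : |k + WirtAlg.sg i| ≤ ((M + 1 : ℕ) : ℤ) := by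
    refine (abs_add_le _ _).trans ?_
    rw [abs_sg]; push_cast; linarith
  have hk2 : ((k + WirtAlg.sg i : ℤ) : ℝ) ^ 2 ≤ (M + 1) ^ 2 := by
    rw [← sq_abs]
    refine pow_le_pow_left₀ (abs_nonneg _) ?_ 2
    exact_mod_cast hk'
  have h1 := hardy hb hδ ((WA n).X i g)
  have h2 := h δ hδ _ _ hk' (hg.X i)
  have h3 := poincare hn (rw_wt (n := n) b Cut.std hδ) (fun z hz => by
    rw [wt_re]; exact wt_nonneg b std_nonneg' hδ hz) g i
  have h4 : ∑ j, ∑ l, jn δ (wt b Cut.std hδ) ((WA n).X l ((WA n).X j g)) ≤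
      ∑ j, ∑ l, Ai b hδ ((WA n).X l ((WA n).X j g)) :=
    Finset.sum_le_sum fun j _ => Finset.sum_le_sum fun l _ => jn_wt_le_Ai _ _ _
  have h5 : ∑ l, Ai b hδ ((WA n).X l ((WA n).X i g)) ≤
      ∑ j, ∑ l, Ai b hδ ((WA n).X l ((WA n).X j g)) :=
    Finset.single_le_sum (f := fun j => ∑ l, Ai b hδ ((WA n).X l ((WA n).X j g)))
      (fun j _ => Finset.sum_nonneg fun l _ => Ai_nonneg _ _ _) (Finset.mem_univ i)
  have h6 := jn_wt_add_one_le b hδ ((WA n).X i g)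
  have h0 := jn_wt_nonneg (b + 1) std_nonneg' hδ ((WA n).X i g)
  have h7 := mul_le_mul_of_nonneg_left h4 (show (0 : ℝ) ≤ n ^ 2 + 1 by positivity)
  generalize ∑ j, ∑ l, Ai b hδ ((WA n).X l ((WA n).X j g)) = S at *
  generalize ∑ j, ∑ l, jn δ (wt b Cut.std hδ) ((WA n).X l ((WA n).X j g)) = S' at *
  have h8 := h3.trans h7
  have h9 : (((k + WirtAlg.sg i : ℤ) : ℝ)) ^ 2 * jn δ (wt (b + 1) Cut.std hδ) ((WA n).X i g) ≤
      (M + 1) ^ 2 * ((n ^ 2 + 1) * S) :=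
    mul_le_mul hk2 (h6.trans h8) h0 (by positivity)
  have h10 := h2.trans (mul_le_mul_of_nonneg_left (add_le_add h5 h9) hC)
  have h11 := h1.trans (add_le_add
    (mul_le_mul_of_nonneg_left h8 (show 0 ≤ 3 * b + 4 + 2 * (n : ℝ) by positivity))
    (mul_le_mul_of_nonneg_left h10 (show 0 ≤ 1 / b by positivity)))
  rw [← le_div_iff₀' hb] at h11
  refine h11.trans (le_of_eq ?_)
  ring

/-- The case of invariantly harmonic functions: the remaining zero-order term carries a better
weight. -/
theorem lower_zero (hn : 2 ≤ n) {b : ℝ} (hb : 0 < b) :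
    ∃ C, 0 ≤ C ∧ ∀ δ (hδ : 0 < δ) (g : Sm n), Eig δ 0 g →
      jn δ (wt (b - 1) Cut.std hδ) g ≤
        C * (jn δ (wt b Cut.std hδ) g + ∑ i, Ai b hδ ((WA n).X i g)) := by
  obtain ⟨C, hC, h⟩ := E_le hn (b := b + 1) (by linarith) 0
  simp only [add_sub_cancel_right] at h
  refine ⟨(1 / b) * (3 * b + 4 + 2 * n + (1 / b) * C), by positivity, fun δ hδ g hg => ?_⟩
  have h1 := hardy hb hδ g
  have h2 := h δ hδ 0 g (by simp) hg
  rw [Int.cast_zero, zero_pow two_ne_zero, zero_mul, add_zero] at h2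
  have h3 := jn_wt_nonneg b std_nonneg' hδ g
  have h4 : 0 ≤ ∑ i, Ai b hδ ((WA n).X i g) := Finset.sum_nonneg fun i _ => Ai_nonneg _ _ _
  have h11 := h1.trans (add_le_add le_rfl
    (mul_le_mul_of_nonneg_left h2 (show 0 ≤ 1 / b by positivity)))
  rw [← le_div_iff₀' hb] at h11
  refine h11.trans ?_
  generalize ∑ i, Ai b hδ ((WA n).X i g) = S at *
  generalize jn δ (wt b Cut.std hδ) g = G at *
  have a1 : 0 ≤ (1 / b) * (3 * b + 4 + 2 * n) * S := by positivity
  have a2 : 0 ≤ (1 / b) * ((1 / b) * C) * G := by positivity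
  rw [div_eq_mul_one_div]
  linarith

theorem integral_mul_dirD (v : En n) {F : En n → ℂ} (hF : ContDiff ℝ 1 F) (G : Sm n)
    (hG : ∀ z, z ∉ Kset n δ → G z = 0) :
    ∫ z, F z * dirD v G z = - ∫ z, fderiv ℝ F z v * G z := by
  have hF' : Continuous fun z => fderiv ℝ F z v :=
    (hF.continuous_fderiv (by simp)).clm_apply continuous_const
  have hc : ∀ (a : En n → ℂ) (b : Sm n), Continuous a → (∀ z, z ∉ Kset n δ → b z = 0) →
      Integrable (fun z => a z * b.1 z) (volume : Measure (En n)) := fun a b ha hb =>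
    (ha.mul (cont b)).integrable_of_hasCompactSupport
      (HasCompactSupport.intro (isCompact_Kset δ) fun z hz => by
        change a z * b z = 0
        rw [hb z hz, mul_zero])
  exact integral_mul_fderiv_eq_neg_fderiv_mul_of_integrable (μ := (volume : Measure (En n)))
    (f := F) (g := G.1) (v := v) (hc _ _ hF' hG)
    (hc _ _ hF.continuous (dirD_zero_off v G (isClosed_Kset δ).isOpen_compl hG))
    (hc _ _ hF.continuous hG) (fun x _ => hF.differentiable (by simp) x) (fun x _ => diff G x)

theorem integrable_mul {F : En n → ℂ} (hF : Continuous F) (G : Sm n)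
    (hG : ∀ z, z ∉ Kset n δ → G z = 0) : Integrable (fun z => F z * G z) (volume : Measure (En n)) :=
  (hF.mul (cont G)).integrable_of_hasCompactSupport
    (HasCompactSupport.intro (isCompact_Kset δ) fun z hz => by
      change F z * G z = 0
      rw [hG z hz, mul_zero])

theorem integral_mul_dz (j : Fin n) {F : En n → ℂ} (hF : ContDiff ℝ 1 F) (G : Sm n)
    (hG : ∀ z, z ∉ Kset n δ → G z = 0) :
    (∫ z, F z * dz j G z = - ∫ z, wd n j F z * G z) ∧
      ∫ z, F z * dzb j G z = - ∫ z, wdb n j F z * G z := by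
  have hF' : ∀ v, Continuous fun z => fderiv ℝ F z v := fun v =>
    (hF.continuous_fderiv (by simp)).clm_apply continuous_const
  have h := fun v => integral_mul_dirD v hF G hG
  have hi := fun v => integrable_mul (δ := δ) hF.continuous (dirD v G)
    (dirD_zero_off v G (isClosed_Kset δ).isOpen_compl hG)
  have hi' := fun v => integrable_mul (δ := δ) (hF' v) G hG
  constructor
  · have e1 : (fun z => F z * dz j G z) = fun z =>
        (1 / 2 : ℂ) * (F z * dirD (EuclideanSpace.single j 1) G z -
          Complex.I * (F z * dirD (EuclideanSpace.single j Complex.I) G z)) := by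
      funext z; rw [dz_eq]; simp only [smul_val, sub_val]; ring
    have e2 : (fun z => wd n j F z * G z) = fun z =>
        (1 / 2 : ℂ) * (fderiv ℝ F z (EuclideanSpace.single j 1) * G z -
          Complex.I * (fderiv ℝ F z (EuclideanSpace.single j Complex.I) * G z)) := by
      funext z; rw [wd]; ring
    rw [e1, e2, integral_const_mul, integral_const_mul, integral_sub (hi _) ((hi _).const_mul _),
      integral_sub (hi' _) ((hi' _).const_mul _), integral_const_mul, integral_const_mul, h, h]
    ring
  · have e1 : (fun z => F z * dzb j G z) = fun z =>
        (1 / 2 : ℂ) * (F z * dirD (EuclideanSpace.single j 1) G z +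
          Complex.I * (F z * dirD (EuclideanSpace.single j Complex.I) G z)) := by
      funext z; rw [dzb_eq]; simp only [smul_val, add_val]; ring
    have e2 : (fun z => wdb n j F z * G z) = fun z =>
        (1 / 2 : ℂ) * (fderiv ℝ F z (EuclideanSpace.single j 1) * G z +
          Complex.I * (fderiv ℝ F z (EuclideanSpace.single j Complex.I) * G z)) := by
      funext z; rw [wdb]; ring
    rw [e1, e2, integral_const_mul, integral_const_mul, integral_add (hi _) ((hi _).const_mul _),
      integral_add (hi' _) ((hi' _).const_mul _), integral_const_mul, integral_const_mul, h, h]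
    ring

theorem contDiff_wdb (k : Fin n) {F : En n → ℂ} (hF : ContDiff ℝ 2 F) :
    ContDiff ℝ 1 (wd n k F) ∧ ContDiff ℝ 1 (wdb n k F) := by
  have h : ∀ v, ContDiff ℝ 1 fun z => fderiv ℝ F z v := fun v =>
    (hF.fderiv_right (m := 1) (by norm_num)).clm_apply contDiff_const
  constructor
  · exact contDiff_const.mul ((h _).sub (contDiff_const.mul (h _)))
  · exact contDiff_const.mul ((h _).add (contDiff_const.mul (h _)))

theorem wd_wdb_comm (j k : Fin n) {F : En n → ℂ} (hF : ContDiff ℝ 2 F) (z : En n) :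
    wdb n k (wd n j F) z = wd n j (wdb n k F) z := by
  have hd : DifferentiableAt ℝ (fderiv ℝ F) z :=
    (hF.fderiv_right (m := 1) (by norm_num)).differentiable (by simp) z
  have h1 : ∀ w, DifferentiableAt ℝ (fun z => fderiv ℝ F z w) z := fun w =>
    hd.clm_apply (differentiableAt_const _)
  have h : ∀ v w : En n, fderiv ℝ (fun z => fderiv ℝ F z w) z v = fderiv ℝ (fderiv ℝ F) z v w := by
    intro v w
    rw [fderiv_clm_apply hd (differentiableAt_const _)]
    simp
  have hs : ∀ v w : En n, fderiv ℝ (fderiv ℝ F) z v w = fderiv ℝ (fderiv ℝ F) z w v :=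
    fun v w => hF.contDiffAt.isSymmSndFDerivAt (by simp) v w
  have e1 : ∀ v, fderiv ℝ (wd n j F) z v = (1 / 2 : ℂ) *
      (fderiv ℝ (fderiv ℝ F) z v (EuclideanSpace.single j 1) -
        Complex.I * fderiv ℝ (fderiv ℝ F) z v (EuclideanSpace.single j Complex.I)) := by
    intro v
    have : HasFDerivAt (wd n j F) _ z :=
      ((h1 (EuclideanSpace.single j 1)).hasFDerivAt.sub
        ((h1 (EuclideanSpace.single j Complex.I)).hasFDerivAt.const_mul Complex.I)).const_mul
          (1 / 2 : ℂ)
    rw [this.fderiv]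
    simp [h]
  have e2 : ∀ v, fderiv ℝ (wdb n k F) z v = (1 / 2 : ℂ) *
      (fderiv ℝ (fderiv ℝ F) z v (EuclideanSpace.single k 1) +
        Complex.I * fderiv ℝ (fderiv ℝ F) z v (EuclideanSpace.single k Complex.I)) := by
    intro v
    have : HasFDerivAt (wdb n k F) _ z :=
      ((h1 (EuclideanSpace.single k 1)).hasFDerivAt.add
        ((h1 (EuclideanSpace.single k Complex.I)).hasFDerivAt.const_mul Complex.I)).const_mul
          (1 / 2 : ℂ)
    rw [this.fderiv]
    simp [h]
    ring
  rw [wdb, wd, e1, e1, e2, e2, hs (EuclideanSpace.single k 1), hs (EuclideanSpace.single k 1),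
    hs (EuclideanSpace.single k Complex.I), hs (EuclideanSpace.single k Complex.I)]
  ring

theorem dz_congr_on (j : Fin n) {a b : Sm n} {O : Set (En n)} (hO : IsOpen O)
    (h : ∀ z ∈ O, a z = b z) : ∀ z ∈ O, dz j a z = dz j b z ∧ dzb j a z = dzb j b z := by
  intro z hz
  have := dz_zero_on j (a := a - b) hO (fun z hz => by rw [sub_val, h z hz, sub_self]) z hz
  rw [map_sub, map_sub, sub_val, sub_val, sub_eq_zero, sub_eq_zero] at this
  exact this

/-- Composition of a real smooth function with the real part. -/
noncomputable def comp (ψ : ℝ → ℝ) (hψ : ContDiff ℝ ∞ ψ) (v : Sm n) : Sm n :=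
  ⟨fun z => (ψ ((v z).re) : ℂ), mem_iff.2 <| Complex.ofRealCLM.contDiff.comp
    (hψ.comp (Complex.reCLM.contDiff.comp (smooth v)))⟩

theorem comp_val (ψ : ℝ → ℝ) (hψ : ContDiff ℝ ∞ ψ) (v : Sm n) (z : En n) :
    comp ψ hψ v z = (ψ ((v z).re) : ℂ) := rfl

theorem dirD_comp (ψ : ℝ → ℝ) (hψ : ContDiff ℝ ∞ ψ) {v : Sm n} (hv : conj v = v) (w z : En n) :
    dirD w (comp ψ hψ v) z = deriv ψ ((v z).re) * dirD w v z := by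
  have h1 : HasFDerivAt (fun z => (v z).re) (Complex.reCLM.comp (fderiv ℝ v.1 z)) z :=
    Complex.reCLM.hasFDerivAt.comp z (diff v z).hasFDerivAt
  have h2 : HasDerivAt ψ (deriv ψ ((v z).re)) ((v z).re) :=
    (hψ.differentiable (by simp) _).hasDerivAt
  have h3 := Complex.ofRealCLM.hasFDerivAt.comp z (h2.comp_hasFDerivAt z h1)
  change fderiv ℝ (Complex.ofRealCLM ∘ (ψ ∘ fun z : En n => (v z).re)) z w = _
  rw [h3.fderiv]
  have h4 : (((dirD w v z).re : ℝ) : ℂ) = dirD w v z := by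
    rw [← Complex.conj_eq_iff_re, ← conj_val, ← dirD_conj, hv]
  rw [← h4]
  simp [dirD_val]

theorem dz_comp (ψ : ℝ → ℝ) (hψ : ContDiff ℝ ∞ ψ) {v : Sm n} (hv : conj v = v) (j : Fin n)
    (z : En n) : dz j (comp ψ hψ v) z = deriv ψ ((v z).re) * dz j v z ∧
      dzb j (comp ψ hψ v) z = deriv ψ ((v z).re) * dzb j v z := by
  rw [dz_eq, dzb_eq, dz_eq, dzb_eq]
  simp only [smul_val, sub_val, add_val, dirD_comp ψ hψ hv]
  constructor <;> ring

/-- The function `1 - ⟨z, p⟩`. -/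
noncomputable def hh (p : En n) : Sm n := 1 - ∑ j, starRingEnd ℂ (p j) • coord j

theorem hh_val (p z : En n) : hh p z = 1 - ∑ j, starRingEnd ℂ (p j) * z j := by
  simp [hh]; rfl

theorem dz_hh (p : En n) (j : Fin n) (z : En n) :
    dz j (hh p) z = -starRingEnd ℂ (p j) ∧ dzb j (hh p) z = 0 := by
  simp [hh, dz_coord, dzb_coord]

theorem dz_conj_hh (p : En n) (j : Fin n) (z : En n) :
    dz j (conj (hh p)) z = 0 ∧ dzb j (conj (hh p)) z = -p j := by
  rw [dz_conj, ← conj_dz, conj_val, conj_val, (dz_hh p j z).1, (dz_hh p j z).2]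
  simp

/-- The function `1 / (1 - |z|²)` away from the boundary. -/
noncomputable def uu (hδ : 0 < δ) : Sm n := wt (-1) Cut.std hδ

theorem uu_val (hδ : 0 < δ) {z : En n} (hz : 2 * δ ≤ 1 - ‖z‖ ^ 2) :
    (uu hδ : Sm n) z = ((1 - ‖z‖ ^ 2 : ℝ) : ℂ)⁻¹ := by
  rw [uu, wt_val, Cut.std_eq_one (by rwa [le_div_iff₀ hδ]), mul_one, Real.rpow_neg_one]
  push_cast
  rfl

theorem conj_uu (hδ : 0 < δ) : conj (uu hδ : Sm n) = uu hδ :=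
  conj_rad _ (contDiff_wtf (-1) Cut.std hδ)

theorem one_sub_t_mul_uu (hδ : 0 < δ) {z : En n} (hz : 2 * δ ≤ 1 - ‖z‖ ^ 2) :
    (1 - (WA n).t z) * (uu hδ : Sm n) z = 1 := by
  rw [uu_val hδ hz, t_val]
  have : ((1 - ‖z‖ ^ 2 : ℝ) : ℂ) ≠ 0 := by
    rw [Complex.ofReal_ne_zero]; linarith
  push_cast at this ⊢
  exact mul_inv_cancel₀ this

theorem dz_uu (hδ : 0 < δ) (j : Fin n) {z : En n} (hz : z ∈ Oset n (2 * δ)) :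
    dz j (uu hδ : Sm n) z = starRingEnd ℂ (z j) * (uu hδ : Sm n) z ^ 2 ∧
      dzb j (uu hδ : Sm n) z = z j * (uu hδ : Sm n) z ^ 2 := by
  have h1 := one_sub_t_mul_uu hδ (z := z) (le_of_lt hz)
  have h := dz_congr_on j (a := (1 - (WA n).t) * uu hδ) (b := 1) (isOpen_Oset (2 * δ))
    (fun z hz => by
      rw [mul_val, sub_val, one_val]; exact one_sub_t_mul_uu hδ (le_of_lt hz)) z hz
  have ht : dz j (WA n).t z = starRingEnd ℂ (z j) := by
    rw [t_eq_rad, dz_rad]; simp [rad_val, coord]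
  have ht' : dzb j (WA n).t z = z j := by
    rw [t_eq_rad, dzb_rad]; simp [rad_val, coord]
  obtain ⟨h2, h3⟩ := h
  rw [Derivation.leibniz, Derivation.map_one_eq_zero] at h2 h3
  simp only [smul_eq_mul, add_val, mul_val, sub_val, one_val, map_sub, Derivation.map_one_eq_zero,
    zero_val, ht, ht'] at h2 h3
  constructor
  · linear_combination (uu hδ : Sm n) z * h2 - (dz j (uu hδ : Sm n) z) * h1
  · linear_combination (uu hδ : Sm n) z * h3 - (dzb j (uu hδ : Sm n) z) * h1

/-- The invariant distance function `|1 - ⟨z, p⟩|² / ((1 - |p|²) (1 - |z|²))`. -/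
noncomputable def vv (p : En n) (hδ : 0 < δ) : Sm n :=
  ((1 - ‖p‖ ^ 2 : ℝ) : ℂ)⁻¹ • (hh p * conj (hh p) * uu hδ)

theorem vv_val (p : En n) (hδ : 0 < δ) (z : En n) : vv p hδ z =
    ((1 - ‖p‖ ^ 2 : ℝ) : ℂ)⁻¹ * (hh p z * starRingEnd ℂ (hh p z) * (uu hδ : Sm n) z) := rfl

theorem conj_vv (p : En n) (hδ : 0 < δ) : conj (vv p hδ) = vv p hδ := by
  ext z
  have := congrArg (fun a : Sm n => a z) (conj_uu (n := n) hδ)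
  simp only [conj_val] at this
  simp only [conj_val, vv_val, map_mul, map_inv₀, Complex.conj_ofReal, Complex.conj_conj, this]
  ring

theorem dz_vv (p : En n) (hδ : 0 < δ) (j : Fin n) {z : En n} (hz : z ∈ Oset n (2 * δ)) :
    dz j (vv p hδ) z = ((1 - ‖p‖ ^ 2 : ℝ) : ℂ)⁻¹ *
      (-(starRingEnd ℂ (hh p z) * starRingEnd ℂ (p j) * (uu hδ : Sm n) z) +
        hh p z * starRingEnd ℂ (hh p z) * (starRingEnd ℂ (z j) * (uu hδ : Sm n) z ^ 2)) ∧
    dzb j (vv p hδ) z = ((1 - ‖p‖ ^ 2 : ℝ) : ℂ)⁻¹ *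
      (-(hh p z * p j * (uu hδ : Sm n) z) +
        hh p z * starRingEnd ℂ (hh p z) * (z j * (uu hδ : Sm n) z ^ 2)) := by
  simp only [vv, Derivation.map_smul, Derivation.leibniz, smul_eq_mul, smul_val, add_val, mul_val,
    (dz_hh p j z).1, (dz_hh p j z).2, (dz_conj_hh p j z).1, (dz_conj_hh p j z).2,
    (dz_uu hδ j hz).1, (dz_uu hδ j hz).2, conj_val]
  constructor <;> ring

theorem sum_conj_mul_sub (p z : En n) : ∑ j, starRingEnd ℂ (p j) * (z j - p j) =
    ((1 - ‖p‖ ^ 2 : ℝ) : ℂ) - hh p z := by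
  have h : ∑ j, starRingEnd ℂ (p j) * p j = ((‖p‖ ^ 2 : ℝ) : ℂ) := by
    rw [← t_val, WirtAlg.t, sum_val]
    exact Finset.sum_congr rfl fun j _ => mul_comm _ _
  simp only [mul_sub, Finset.sum_sub_distrib, h, hh_val]
  push_cast
  ring

theorem sum_conj_mul_sub' (p z : En n) : ∑ j, starRingEnd ℂ (z j) * (z j - p j) =
    (WA n).t z - 1 + starRingEnd ℂ (hh p z) := by
  have h : ∑ j, starRingEnd ℂ (z j) * z j = (WA n).t z := by
    rw [WirtAlg.t, sum_val]
    exact Finset.sum_congr rfl fun j _ => mul_comm _ _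
  have h2 : ∑ j, starRingEnd ℂ (z j) * p j = ∑ j, p j * starRingEnd ℂ (z j) :=
    Finset.sum_congr rfl fun j _ => mul_comm _ _
  simp only [mul_sub, Finset.sum_sub_distrib, h, hh_val, map_sub, map_one, map_sum, map_mul,
    Complex.conj_conj, h2]
  ring

section
variable (p : En n) (hδ : 0 < δ) {g : ℝ → ℝ} (hg : ContDiff ℝ ∞ g)

/-- The function `g ∘ v`, cut off near the boundary. -/
noncomputable def cv : Sm n := comp g hg (vv p hδ) * wt 0 Cut.std (δ := 2 * δ) (by positivity)

variable {V : ℝ} (hV : ∀ z ∈ Oset n (2 * δ), z ∉ Kset n (4 * δ) → V < (vv p hδ z).re)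
  (hgV : ∀ x, V < x → g x = 0)

include hV hgV in
theorem cv_on {z : En n} (hz : z ∈ Oset n (2 * δ)) : cv p hδ hg z = g ((vv p hδ z).re) := by
  rw [cv, mul_val, comp_val]
  by_cases h : z ∈ Kset n (4 * δ)
  · rw [wt_val, Cut.std_eq_one (by
      rw [le_div_iff₀ (by positivity)]; exact (by ring : 2 * (2 * δ) = 4 * δ).trans_le h)]
    simp
  · rw [hgV _ (hV z hz h)]; simp

include hV hgV in
theorem cv_zero {z : En n} (hz : z ∉ Kset n (4 * δ)) : cv p hδ hg z = 0 := by
  by_cases h : z ∈ Oset n (2 * δ)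
  · rw [cv_on p hδ hg hV hgV h, hgV _ (hV z h hz)]; simp
  · have h' : (1 - ‖z‖ ^ 2) / (2 * δ) ≤ 1 := by
      rw [div_le_one (by positivity)]; exact not_lt.1 h
    have : Cut.std.f ((1 - ‖z‖ ^ 2) / (2 * δ)) = 0 :=
      Real.smoothTransition.zero_of_nonpos (by linarith)
    rw [cv, mul_val, wt_val, this]; simp

include hV hgV in
theorem dz_cv (j : Fin n) {z : En n} (hz : z ∈ Oset n (2 * δ)) :
    dz j (cv p hδ hg) z = deriv g ((vv p hδ z).re) * dz j (vv p hδ) z ∧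
      dzb j (cv p hδ hg) z = deriv g ((vv p hδ z).re) * dzb j (vv p hδ) z := by
  have h := dz_congr_on j (a := cv p hδ hg) (b := comp g hg (vv p hδ)) (isOpen_Oset (2 * δ))
    (fun z hz => cv_on p hδ hg hV hgV hz) z hz
  rw [h.1, h.2]
  exact dz_comp g hg (conj_vv p hδ) j z

/-- The `j`-th component of the kernel vector field. -/
noncomputable def GG (j : Fin n) : Sm n :=
  ((1 - ‖p‖ ^ 2 : ℝ) : ℂ)⁻¹ • (cv p hδ hg * uu hδ ^ (n + 1) * hh p * (coord j - p j • 1))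

include hV hgV in
theorem div_GG (hp : ‖p‖ < 1) {z : En n} (hz : z ∈ Oset n (2 * δ)) :
    ∑ j, dz j (GG p hδ hg j) z = (uu hδ : Sm n) z ^ (n + 1) *
      (deriv g ((vv p hδ z).re) * (vv p hδ z * (vv p hδ z - 1)) +
        g ((vv p hδ z).re) * ((n + 1) * vv p hδ z - 1)) := by
  have hα : ((1 - ‖p‖ ^ 2 : ℝ) : ℂ) ≠ 0 := by
    rw [Complex.ofReal_ne_zero]; nlinarith [norm_nonneg p]
  have hu := one_sub_t_mul_uu hδ (z := z) (le_of_lt hz)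
  have hv := vv_val p hδ z
  have s1 := sum_conj_mul_sub p z
  have s2 := sum_conj_mul_sub' p z
  have hα' := mul_inv_cancel₀ hα
  have hterm : ∀ j, dz j (GG p hδ hg j) z =
      (((1 - ‖p‖ ^ 2 : ℝ) : ℂ)⁻¹ * (-(g ((vv p hδ z).re) * (uu hδ : Sm n) z ^ (n + 1)) -
        deriv g ((vv p hδ z).re) * (uu hδ : Sm n) z ^ (n + 1) * hh p z *
          (((1 - ‖p‖ ^ 2 : ℝ) : ℂ)⁻¹ * (starRingEnd ℂ (hh p z) * (uu hδ : Sm n) z)))) *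
        (starRingEnd ℂ (p j) * (z j - p j)) +
      (((1 - ‖p‖ ^ 2 : ℝ) : ℂ)⁻¹ * ((n + 1) * g ((vv p hδ z).re) * (uu hδ : Sm n) z ^ (n + 2) * hh p z +
        deriv g ((vv p hδ z).re) * (uu hδ : Sm n) z ^ (n + 1) * hh p z * (vv p hδ z * (uu hδ : Sm n) z))) *
        (starRingEnd ℂ (z j) * (z j - p j)) +
      ((1 - ‖p‖ ^ 2 : ℝ) : ℂ)⁻¹ * (g ((vv p hδ z).re) * (uu hδ : Sm n) z ^ (n + 1) * hh p z) := by
    intro j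
    have h1 : dz j (coord j - p j • 1 : Sm n) z = 1 := by
      rw [map_sub, dz_coord, Derivation.map_smul, Derivation.map_one_eq_zero]; simp
    have h2 : (coord j - p j • 1 : Sm n) z = z j - p j := by simp; rfl
    have h3 : (uu hδ ^ (n + 1) : Sm n) z = (uu hδ : Sm n) z ^ (n + 1) := map_pow (ev z) _ _
    have h4 : dz j (uu hδ ^ (n + 1) : Sm n) z =
        (n + 1) * (uu hδ : Sm n) z ^ n * (starRingEnd ℂ (z j) * (uu hδ : Sm n) z ^ 2) := by
      rw [Derivation.leibniz_pow, ← (dz_uu hδ j hz).1, nsmul_eq_mul, smul_eq_mul]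
      have : (uu hδ ^ (n + 1 - 1) : Sm n) z = (uu hδ : Sm n) z ^ n := map_pow (ev z) _ _
      rw [mul_val, mul_val, this, natCast_val]
      push_cast; ring
    simp only [GG, Derivation.map_smul, Derivation.leibniz, smul_eq_mul, smul_val, add_val, mul_val,
      h1, h2, h3, h4, (dz_hh p j z).1, (dz_cv p hδ hg hV hgV j hz).1, (dz_vv p hδ j hz).1,
      cv_on p hδ hg hV hgV hz, hv]
    ring
  simp only [hterm, Finset.sum_add_distrib, ← Finset.mul_sum, s1, s2]
  simp only [Finset.sum_const, Finset.card_univ, Fintype.card_fin, nsmul_eq_mul]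
  generalize deriv g ((vv p hδ z).re) = g' at *
  generalize g ((vv p hδ z).re) = g0 at *
  generalize vv p hδ z = v at *
  generalize (((1 - ‖p‖ ^ 2 : ℝ) : ℂ))⁻¹ = αi at *
  generalize (((1 - ‖p‖ ^ 2 : ℝ) : ℂ)) = α at *
  generalize starRingEnd ℂ (hh p z) = hb at *
  generalize hh p z = h at *
  generalize (WA n).t z = τ at *
  generalize (uu hδ : Sm n) z = u at *
  rw [pow_succ u (n + 1)]
  generalize u ^ (n + 1) = U at *
  linear_combination (-(U * g' * αi * h * hb * u) - U * g0) * hα' +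
    (-(U * g' * αi * h * v) - (n + 1) * αi * h * U * g0) * hu +
    (-(U * g' * αi * h) - (v - 1) * U * g' - (n + 1) * U * g0) * hv

end

theorem contDiff_deriv' {Ψ : ℝ → ℝ} (hΨ : ContDiff ℝ ∞ Ψ) : ContDiff ℝ ∞ (deriv Ψ) :=
  (contDiff_infty_iff_deriv.1 hΨ).2

section
variable (p : En n) (hδ : 0 < δ) {Ψ : ℝ → ℝ} (hΨ : ContDiff ℝ ∞ Ψ)

/-- The matrix field whose rows have `∂̄`-divergence `GG`. -/
noncomputable def BB (j k : Fin n) : Sm n :=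
  uu hδ ^ n * cv p hδ hΨ * ((if j = k then 1 else 0) - coord j * conj (coord k))

theorem BB_val (j k : Fin n) (z : En n) : BB p hδ hΨ j k z = (uu hδ : Sm n) z ^ n *
    cv p hδ hΨ z * ((if j = k then 1 else 0) - z j * starRingEnd ℂ (z k)) := by
  have h3 : (uu hδ ^ n : Sm n) z = (uu hδ : Sm n) z ^ n := map_pow (ev z) _ _
  rw [BB, mul_val, mul_val, h3, sub_val, mul_val, conj_val]
  split_ifs <;> rfl

variable {V : ℝ} (hV : ∀ z ∈ Oset n (2 * δ), z ∉ Kset n (4 * δ) → V < (vv p hδ z).re)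
  (hΨV : ∀ x, V < x → Ψ x = 0)

include hΨV in
theorem deriv_eq_zero_of_gt : ∀ x, V < x → deriv Ψ x = 0 := by
  intro x hx
  have : Ψ =ᶠ[nhds x] fun _ => 0 := by
    filter_upwards [lt_mem_nhds hx] with y hy using hΨV y hy
  rw [this.deriv_eq]; simp

include hV hΨV in
theorem GG_zero (j : Fin n) {z : En n} (hz : z ∉ Kset n (4 * δ)) :
    GG p hδ (contDiff_deriv' hΨ) j z = 0 := by
  rw [GG, smul_val, mul_val, mul_val, mul_val,
    cv_zero p hδ (contDiff_deriv' hΨ) hV (deriv_eq_zero_of_gt hΨV) hz]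
  simp

include hV hΨV in
theorem BB_zero (j k : Fin n) {z : En n} (hz : z ∉ Kset n (4 * δ)) : BB p hδ hΨ j k z = 0 := by
  rw [BB_val, cv_zero p hδ hΨ hV hΨV hz]
  simp

include hV hΨV in
theorem sum_dzb_BB (j : Fin n) (z : En n) :
    ∑ k, dzb k (BB p hδ hΨ j k) z = GG p hδ (contDiff_deriv' hΨ) j z := by
  by_cases hK : z ∈ Kset n (4 * δ)
  swap
  · rw [GG_zero p hδ hΨ hV hΨV j hK]
    exact Finset.sum_eq_zero fun k _ => (dz_zero_on k (isClosed_Kset (4 * δ)).isOpen_compl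
      (fun z hz => BB_zero p hδ hΨ hV hΨV j k hz) z hK).2
  have hz : z ∈ Oset n (2 * δ) := by
    have : 4 * δ ≤ 1 - ‖z‖ ^ 2 := hK
    change 2 * δ < 1 - ‖z‖ ^ 2
    linarith
  have hu := one_sub_t_mul_uu hδ (z := z) (le_of_lt hz)
  have s2 := sum_conj_mul_sub' p z
  have s3 : ∑ k, starRingEnd ℂ (z k) * z k = (WA n).t z := by
    rw [WirtAlg.t, sum_val]
    exact Finset.sum_congr rfl fun j _ => mul_comm _ _
  have s4 : ∑ k, starRingEnd ℂ (z k) * p k = 1 - starRingEnd ℂ (hh p z) := by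
    simp only [mul_sub, Finset.sum_sub_distrib, s3] at s2
    linear_combination -s2
  have hterm : ∀ k, dzb k (BB p hδ hΨ j k) z = 
      (if j = k then (n * (uu hδ : Sm n) z ^ (n + 1) * z k * Ψ ((vv p hδ z).re) +
        (uu hδ : Sm n) z ^ n * deriv Ψ ((vv p hδ z).re) * (((1 - ‖p‖ ^ 2 : ℝ) : ℂ)⁻¹ *
      (-(hh p z * p k * (uu hδ : Sm n) z) +
        hh p z * starRingEnd ℂ (hh p z) * (z k * (uu hδ : Sm n) z ^ 2)))) else 0) -
      z j * (n * (uu hδ : Sm n) z ^ (n + 1) * Ψ ((vv p hδ z).re) +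
        (uu hδ : Sm n) z ^ n * deriv Ψ ((vv p hδ z).re) * (((1 - ‖p‖ ^ 2 : ℝ) : ℂ)⁻¹ * 
        hh p z * starRingEnd ℂ (hh p z) * (uu hδ : Sm n) z ^ 2)) * (starRingEnd ℂ (z k) * z k) +
      z j * (uu hδ : Sm n) z ^ n * deriv Ψ ((vv p hδ z).re) * (((1 - ‖p‖ ^ 2 : ℝ) : ℂ)⁻¹ *
      (hh p z * (uu hδ : Sm n) z)) * (starRingEnd ℂ (z k) * p k) -
      (uu hδ : Sm n) z ^ n * Ψ ((vv p hδ z).re) * z j := by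
    intro k
    have h1 : dzb k ((if j = k then 1 else 0) - coord j * conj (coord k) : Sm n) z = -z j := by
      rw [map_sub, Derivation.leibniz, dzb_coord, sub_val, add_val, smul_eq_mul, smul_eq_mul,
        mul_val, mul_val, ← conj_dz, dz_coord]
      have : dzb k (if j = k then 1 else 0 : Sm n) = 0 := by
        split_ifs <;> simp
      rw [this]
      simp [coord]
    have h2 : ((if j = k then 1 else 0) - coord j * conj (coord k) : Sm n) z =
        (if j = k then 1 else 0) - z j * starRingEnd ℂ (z k) := by
      rw [sub_val, mul_val, conj_val]
      split_ifs <;> rfl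
    have h3 : (uu hδ ^ n : Sm n) z = (uu hδ : Sm n) z ^ n := map_pow (ev z) _ _
    have h4 : dzb k (uu hδ ^ n : Sm n) z = n * (uu hδ : Sm n) z ^ (n + 1) * z k := by
      rw [Derivation.leibniz_pow, nsmul_eq_mul, smul_eq_mul]
      have : (uu hδ ^ (n - 1) : Sm n) z = (uu hδ : Sm n) z ^ (n - 1) := map_pow (ev z) _ _
      rw [mul_val, mul_val, this, natCast_val, (dz_uu hδ k hz).2]
      rcases n with _ | m
      · simp
      · rw [Nat.add_sub_cancel]; ring
    rw [BB, Derivation.leibniz, Derivation.leibniz]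
    simp only [smul_eq_mul, add_val, mul_val, h1, h2, h3, h4, (dz_cv p hδ hΨ hV hΨV k hz).2,
      (dz_vv p hδ k hz).2, cv_on p hδ hΨ hV hΨV hz]
    split_ifs <;> ring
  simp only [hterm, Finset.sum_add_distrib, Finset.sum_sub_distrib, ← Finset.mul_sum, s3, s4,
    Finset.sum_ite_eq, Finset.mem_univ, if_true]
  simp only [Finset.sum_const, Finset.card_univ, Fintype.card_fin, nsmul_eq_mul]
  have h2 : (coord j - p j • 1 : Sm n) z = z j - p j := by simp; rfl
  have h3 : (uu hδ ^ (n + 1) : Sm n) z = (uu hδ : Sm n) z ^ (n + 1) := map_pow (ev z) _ _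
  rw [GG, smul_val, mul_val, mul_val, mul_val, h2, h3,
    cv_on p hδ _ hV (deriv_eq_zero_of_gt hΨV) hz]
  generalize deriv Ψ ((vv p hδ z).re) = g' at *
  generalize Ψ ((vv p hδ z).re) = g0 at *
  generalize (((1 - ‖p‖ ^ 2 : ℝ) : ℂ))⁻¹ = αi at *
  generalize starRingEnd ℂ (hh p z) = hb at *
  generalize hh p z = h at *
  generalize (WA n).t z = τ at *
  generalize (uu hδ : Sm n) z = u at *
  rw [pow_succ u n]
  generalize u ^ n = U at *
  linear_combination (n * z j * U * g0 + U * g' * αi * h * u * z j * hb) * hu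

include hV hΨV in
theorem kernel_identity {F : En n → ℂ} (hF : ContDiff ℝ 2 F)
    (hMF : ∀ z ∈ Oset n (2 * δ), ∑ j : Fin n, ∑ k : Fin n,
      ((if j = k then 1 else 0) - z j * (starRingEnd ℂ) (z k)) * wd n j (wdb n k F) z = 0) :
    ∫ z, F z * ∑ j, dz j (GG p hδ (contDiff_deriv' hΨ) j) z = 0 := by
  have hG := GG_zero p hδ hΨ hV hΨV
  have hB := BB_zero p hδ hΨ hV hΨV
  have hO := (isClosed_Kset (n := n) (4 * δ)).isOpen_compl
  have e1 : ∀ j, ∫ z, F z * dz j (GG p hδ (contDiff_deriv' hΨ) j) z =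
      ∑ k, ∫ z, wd n j (wdb n k F) z * BB p hδ hΨ j k z := by
    intro j
    rw [(integral_mul_dz j (hF.of_le (by norm_num)) (GG p hδ (contDiff_deriv' hΨ) j) 
      (fun z hz => hG j hz)).1]
    have : ∀ z, wd n j F z * GG p hδ (contDiff_deriv' hΨ) j z =
        ∑ k, wd n j F z * dzb k (BB p hδ hΨ j k) z := by
      intro z
      rw [← sum_dzb_BB p hδ hΨ hV hΨV, Finset.mul_sum]
    simp_rw [this]
    rw [integral_finsetSum _ fun k _ => integrable_mul (contDiff_wdb j hF).1.continuous
        (dzb k (BB p hδ hΨ j k)) (fun z hz => (dz_zero_on k hO (fun z hz => hB j k hz) z hz).2), 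
      ← Finset.sum_neg_distrib]
    refine Finset.sum_congr rfl fun k _ => ?_
    rw [(integral_mul_dz k (contDiff_wdb j hF).1 (BB p hδ hΨ j k) (fun z hz => hB j k hz)).2,
      neg_neg]
    simp_rw [wd_wdb_comm j k hF]
  have hc : ∀ j k, Continuous fun z => wd n j (wdb n k F) z := by
    intro j k
    have h : ∀ v, Continuous fun z => fderiv ℝ (wdb n k F) z v := fun v =>
      ((contDiff_wdb k hF).2.continuous_fderiv (by simp)).clm_apply continuous_const
    exact continuous_const.mul ((h _).sub (continuous_const.mul (h _)))
  simp_rw [Finset.mul_sum]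
  rw [integral_finsetSum _ fun j _ => integrable_mul hF.continuous
    (dz j (GG p hδ (contDiff_deriv' hΨ) j))
      (fun z hz => (dz_zero_on j hO (fun z hz => hG j hz) z hz).1)]
  simp_rw [e1]
  rw [← Finset.sum_congr rfl fun j _ => integral_finsetSum Finset.univ fun k _ => 
      integrable_mul (hc j k) (BB p hδ hΨ j k) (fun z hz => hB j k hz),
    ← integral_finsetSum _ fun j _ => integrable_finsetSum _ fun k _ => 
      integrable_mul (hc j k) (BB p hδ hΨ j k) (fun z hz => hB j k hz)]
  refine integral_eq_zero_of_ae (Filter.Eventually.of_forall fun z => ?_)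
  by_cases hz : z ∈ Kset n (4 * δ)
  · have hz' : z ∈ Oset n (2 * δ) := by
      have : 4 * δ ≤ 1 - ‖z‖ ^ 2 := hz
      change 2 * δ < 1 - ‖z‖ ^ 2
      linarith
    have := hMF z hz'
    simp_rw [BB_val]
    calc _ = (uu hδ : Sm n) z ^ n * cv p hδ hΨ z * ∑ j : Fin n, ∑ k : Fin n,
      ((if j = k then 1 else 0) - z j * (starRingEnd ℂ) (z k)) * wd n j (wdb n k F) z := by
          simp_rw [Finset.mul_sum]
          exact Finset.sum_congr rfl fun j _ => Finset.sum_congr rfl fun k _ => by ring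
      _ = _ := by rw [this, mul_zero]; rfl
  · exact Finset.sum_eq_zero fun j _ => Finset.sum_eq_zero fun k _ => by
      rw [hB j k hz, mul_zero]

end

end Sm

namespace Sm

/-- A smooth step from `0` on `x ≤ a` to `1` on `b ≤ x`. -/
noncomputable def step (a b x : ℝ) : ℝ := Real.smoothTransition ((x - a) / (b - a))

theorem contDiff_step (a b : ℝ) : ContDiff ℝ ∞ (step a b) :=
  Real.smoothTransition.contDiff.comp ((contDiff_id.sub contDiff_const).div_const _)

theorem step_zero {a b x : ℝ} (h : a < b) (hx : x ≤ a) : step a b x = 0 :=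
  Real.smoothTransition.zero_of_nonpos (div_nonpos_of_nonpos_of_nonneg (by linarith) (by linarith))

theorem step_one {a b x : ℝ} (h : a < b) (hx : b ≤ x) : step a b x = 1 :=
  Real.smoothTransition.one_of_one_le (by rw [le_div_iff₀ (by linarith)]; linarith)

theorem deriv_step_zero {a b x : ℝ} (h : a < b) (hx : x ≤ a ∨ b ≤ x) : deriv (step a b) x = 0 := by
  rcases hx with hx | hx
  · refine IsLocalMin.deriv_eq_zero (Filter.Eventually.of_forall fun y => ?_)
    rw [step_zero h hx]
    exact Real.smoothTransition.nonneg _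
  · refine IsLocalMax.deriv_eq_zero (Filter.Eventually.of_forall fun y => ?_)
    rw [step_one h hx]
    exact Real.smoothTransition.le_one _

theorem deriv_step_nonneg {a b : ℝ} (h : a < b) (x : ℝ) : 0 ≤ deriv (step a b) x := by
  refine Monotone.deriv_nonneg fun x y hxy => ?_
  exact Real.smoothTransition.monotone
    (div_le_div_of_nonneg_right (by linarith) (by linarith))

/-- The radial profile of the mean value kernel. -/
noncomputable def chi (n : ℕ) (a b x : ℝ) : ℝ := deriv (step a b) x / (x - 1) ^ (n - 1)

section
variable {n : ℕ} {a b : ℝ} (ha : 1 < a) (h : a < b)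

include h in
theorem chi_zero {x : ℝ} (hx : x ≤ a ∨ b ≤ x) : chi n a b x = 0 := by
  rw [chi, deriv_step_zero h hx, zero_div]

include ha h in
theorem chi_nonneg (x : ℝ) : 0 ≤ chi n a b x := by
  rcases le_or_gt x a with hx | hx
  · rw [chi_zero h (Or.inl hx)]
  · exact div_nonneg (deriv_step_nonneg h x) (pow_nonneg (by linarith) _)

include ha in
theorem contDiff_div_of_zero {N D : ℝ → ℝ} (hN : ContDiff ℝ ∞ N) (hD : ContDiff ℝ ∞ D)
    (hN0 : ∀ x, x ≤ a → N x = 0) (hD0 : ∀ x, 1 < x → D x ≠ 0) :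
    ContDiff ℝ ∞ fun x => N x / D x := by
  rw [contDiff_iff_contDiffAt]
  intro x
  rcases lt_or_ge x a with hx | hx
  · have : (fun x => N x / D x) =ᶠ[nhds x] fun _ => 0 := by
      filter_upwards [gt_mem_nhds hx] with y hy
      rw [hN0 y hy.le, zero_div]
    exact contDiffAt_const.congr_of_eventuallyEq this
  · exact hN.contDiffAt.div hD.contDiffAt (hD0 x (by linarith))

include ha h in
theorem contDiff_chi : ContDiff ℝ ∞ (chi n a b) :=
  contDiff_div_of_zero ha (contDiff_deriv' (contDiff_step a b))
    ((contDiff_id.sub contDiff_const).pow _) (fun x hx => deriv_step_zero h (Or.inl hx))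
    fun x hx => pow_ne_zero _ (by linarith)

include ha h in
theorem exists_chi_pos : ∃ x, a < x ∧ x < b ∧ 0 < chi n a b x := by
  obtain ⟨x, hx, hx'⟩ := exists_deriv_eq_slope (step a b) h (contDiff_step a b).continuous.continuousOn
    ((contDiff_step a b).differentiable (by simp)).differentiableOn
  rw [step_one h le_rfl, step_zero h le_rfl] at hx'
  refine ⟨x, hx.1, hx.2, div_pos ?_ (pow_pos (by linarith [hx.1]) _)⟩
  rw [hx']
  exact div_pos (by norm_num) (by linarith)

theorem exists_potential (hn : 1 ≤ n) {a' b' : ℝ} (ha : 1 < a) (h : a < b) (ha' : 1 < a')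
    (h' : a' < b') : ∃ Ψ : ℝ → ℝ, ContDiff ℝ ∞ Ψ ∧ (∀ x, max b b' < x → Ψ x = 0) ∧
      ∀ x, deriv (deriv Ψ) x * (x * (x - 1)) + deriv Ψ x * ((n + 1) * x - 1) =
        chi n a b x - chi n a' b' x := by
  obtain ⟨a₀, ha₀, hle, hle'⟩ : ∃ a₀, 1 < a₀ ∧ a₀ ≤ a ∧ a₀ ≤ a' :=
    ⟨min a a', lt_min ha ha', min_le_left _ _, min_le_right _ _⟩
  set H : ℝ → ℝ := fun x => step a b x - step a' b' x with hH
  have hHs : ContDiff ℝ ∞ H := (contDiff_step a b).sub (contDiff_step a' b')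
  have hH0 : ∀ x, x ≤ a₀ → H x = 0 := fun x hx => by
    simp only [hH, step_zero h (hx.trans hle), step_zero h' (hx.trans hle'), sub_self]
  set D : ℝ → ℝ := fun x => (x - 1) ^ n * x with hD
  have hDs : ContDiff ℝ ∞ D := ((contDiff_id.sub contDiff_const).pow _).mul contDiff_id
  have hD0 : ∀ x, 1 < x → D x ≠ 0 := fun x hx =>
    mul_ne_zero (pow_ne_zero _ (by linarith)) (by linarith)
  set g : ℝ → ℝ := fun x => H x / D x with hg
  have hgs : ContDiff ℝ ∞ g := contDiff_div_of_zero ha₀ hHs hDs hH0 hD0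
  have hgV : ∀ x, max b b' ≤ x → g x = 0 := fun x hx => by
    simp only [hg, hH, step_one h ((le_max_left _ _).trans hx),
      step_one h' ((le_max_right _ _).trans hx), sub_self, zero_div]
  set Ψ : ℝ → ℝ := fun x => ∫ t in (max b b')..x, g t with hΨ
  have hdΨ : deriv Ψ = g := funext fun x => hgs.continuous.deriv_integral g _ x
  refine ⟨Ψ, ?_, ?_, ?_⟩
  · rw [contDiff_infty_iff_deriv, hdΨ]
    exact ⟨fun x => (intervalIntegral.integral_hasDerivAt_right
      (hgs.continuous.intervalIntegrable _ _) (hgs.continuous.stronglyMeasurableAtFilter _ _)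
      hgs.continuous.continuousAt).differentiableAt, hgs⟩
  · intro x hx
    refine intervalIntegral.integral_zero_ae (Filter.Eventually.of_forall fun t ht => ?_)
    rw [Set.uIoc_of_le hx.le] at ht
    exact hgV t ht.1.le
  · intro x
    rw [hdΨ]
    have hHd : deriv H x = deriv (step a b) x - deriv (step a' b') x :=
      deriv_fun_sub ((contDiff_step a b).differentiable (by simp) x)
        ((contDiff_step a' b').differentiable (by simp) x)
    rcases lt_or_ge x a₀ with hx | hx
    · have : g =ᶠ[nhds x] fun _ => 0 := by
        filter_upwards [gt_mem_nhds hx] with y hy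
        simp only [hg, hH0 y hy.le, zero_div]
      rw [this.deriv_eq, this.eq_of_nhds, chi_zero h (Or.inl (hx.le.trans hle)),
        chi_zero h' (Or.inl (hx.le.trans hle'))]
      simp
    · have hx1 : x - 1 ≠ 0 := by linarith
      have hx0 : x ≠ 0 := by linarith
      have hDd : HasDerivAt D (n * (x - 1) ^ (n - 1) * x + (x - 1) ^ n) x := by
        have := (((hasDerivAt_id x).sub_const 1).pow n).mul (hasDerivAt_id x)
        simp only [id, mul_one] at this
        exact this
      have hgd := ((hHs.differentiable (by simp) x).hasDerivAt).div hDd (hD0 x (by linarith))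
      change HasDerivAt g _ x at hgd
      rw [hgd.deriv, hHd, chi, chi]
      obtain ⟨m, rfl⟩ := Nat.exists_eq_add_of_le' hn
      simp only [hg, hD, Nat.add_sub_cancel]
      generalize H x = H0
      push_cast
      field_simp
      ring

end

end Sm

namespace Sm

variable {n : ℕ}

theorem hh_eq_inner (p z : En n) : hh p z = 1 - inner ℂ p z := by
  rw [hh_val, PiLp.inner_apply]
  simp [mul_comm]

/-- The real form of the invariant distance function. -/
noncomputable def vR (p z : En n) : ℝ := ‖hh p z‖ ^ 2 / ((1 - ‖p‖ ^ 2) * (1 - ‖z‖ ^ 2))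

theorem vv_eq (p : En n) {δ : ℝ} (hδ : 0 < δ) {z : En n} (hz : 2 * δ ≤ 1 - ‖z‖ ^ 2) :
    vv p hδ z = (vR p z : ℂ) := by
  rw [vv_val, uu_val hδ hz, Complex.mul_conj, Complex.normSq_eq_norm_sq, vR, div_eq_mul_inv,
    mul_inv]
  push_cast
  ring

theorem one_sub_sq_pos {p : En n} (hp : ‖p‖ < 1) : 0 < 1 - ‖p‖ ^ 2 := by
  nlinarith [norm_nonneg p]

theorem norm_hh_ge {p z : En n} {r : ℝ} (hp : ‖p‖ ≤ r) (hz : ‖z‖ < 1) : 1 - r ≤ ‖hh p z‖ := by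
  have h1 : ‖inner ℂ p z‖ ≤ r := (norm_inner_le_norm p z).trans (by
    nlinarith [norm_nonneg p, norm_nonneg z])
  have h2 := norm_sub_norm_le (1 : ℂ) (inner ℂ p z)
  rw [norm_one] at h2
  rw [hh_eq_inner]
  linarith

theorem norm_hh_le {p z : En n} (hp : ‖p‖ ≤ 1) : ‖hh p z‖ ≤ 1 + ‖z‖ := by
  have h1 : ‖inner ℂ p z‖ ≤ ‖z‖ := (norm_inner_le_norm p z).trans (by
    nlinarith [norm_nonneg p, norm_nonneg z])
  have h2 := norm_sub_le (1 : ℂ) (inner ℂ p z)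
  rw [norm_one] at h2
  rw [hh_eq_inner]
  linarith

theorem sq_dist_le_vR {p z : En n} (hp : ‖p‖ < 1) (hz : ‖z‖ < 1) : ‖z - p‖ ^ 2 ≤ vR p z - 1 := by
  have hα := one_sub_sq_pos hp
  have hρ := one_sub_sq_pos hz
  have hz0 := sq_nonneg ‖z‖
  obtain ⟨w, rfl⟩ : ∃ w, z = p + w := ⟨z - p, by abel⟩
  rw [add_sub_cancel_left]
  have h1 : ‖p + w‖ ^ 2 = ‖p‖ ^ 2 + 2 * (inner ℂ p w).re + ‖w‖ ^ 2 := by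
    rw [norm_add_sq (𝕜 := ℂ)]; rfl
  have h2 : ‖hh p (p + w)‖ ^ 2 = (1 - ‖p‖ ^ 2 - (inner ℂ p w).re) ^ 2 + (inner ℂ p w).im ^ 2 := by
    rw [hh_eq_inner, inner_add_right, inner_self_eq_norm_sq_to_K, ← Complex.normSq_eq_norm_sq,
      Complex.normSq_apply]
    have : ((‖p‖ : ℂ) ^ 2) = ((‖p‖ ^ 2 : ℝ) : ℂ) := by push_cast; rfl
    have e : 1 - (((RCLike.ofReal ‖p‖ : ℂ)) ^ 2 + inner ℂ p w) =
      1 - (((‖p‖ ^ 2 : ℝ) : ℂ) + inner ℂ p w) := by rw [← this]; rfl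
    rw [e]
    simp only [Complex.sub_re, Complex.add_re, Complex.one_re, Complex.ofReal_re, Complex.sub_im,
      Complex.add_im, Complex.one_im, Complex.ofReal_im]
    ring
  rw [le_sub_iff_add_le, vR, le_div_iff₀ (mul_pos hα hρ), h2]
  rw [h1] at hρ hz0 ⊢
  have h3 := sq_nonneg (inner ℂ p w).re
  have h4 := sq_nonneg (inner ℂ p w).im
  nlinarith [mul_nonneg (mul_nonneg (sq_nonneg ‖w‖) hα.le) hz0]

theorem vR_nonpos {p z : En n} (hp : ‖p‖ < 1) (hz : 1 - ‖z‖ ^ 2 ≤ 0) : vR p z ≤ 0 :=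
  div_nonpos_of_nonneg_of_nonpos (sq_nonneg _)
    (mul_nonpos_of_nonneg_of_nonpos (one_sub_sq_pos hp).le hz)

theorem norm_lt_one_of {z : En n} (h : 0 < 1 - ‖z‖ ^ 2) : ‖z‖ < 1 := by
  nlinarith [norm_nonneg z]

theorem le_vR {p z : En n} {r b : ℝ} (hp : ‖p‖ ≤ r) (hr : r < 1) (hρ : 0 < 1 - ‖z‖ ^ 2)
    (hb : 0 ≤ b) (hz : (1 - ‖z‖ ^ 2) * b ≤ (1 - r) ^ 2) : b ≤ vR p z := by
  have hα := one_sub_sq_pos (hp.trans_lt hr)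
  have := norm_hh_ge hp (norm_lt_one_of hρ)
  rw [vR, le_div_iff₀ (mul_pos hα hρ)]
  have h1 : (1 - r) ^ 2 ≤ ‖hh p z‖ ^ 2 := by
    gcongr
  have h2 : b * ((1 - ‖p‖ ^ 2) * (1 - ‖z‖ ^ 2)) ≤ b * (1 - ‖z‖ ^ 2) := by
    refine mul_le_mul_of_nonneg_left ?_ hb
    nlinarith [sq_nonneg ‖p‖]
  linarith

/-- The mean value kernel. -/
noncomputable def kk (a b : ℝ) (p z : En n) : ℝ :=
  chi n a b (vR p z) * ((1 - ‖z‖ ^ 2)⁻¹) ^ (n + 1)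

section
variable {a b : ℝ} (ha : 1 < a) (h : a < b)

include ha h

theorem kk_zero_of_nonpos {p z : En n} (hp : ‖p‖ < 1) (hz : 1 - ‖z‖ ^ 2 ≤ 0) : kk a b p z = 0 := by
  rw [kk, chi_zero h (Or.inl ((vR_nonpos hp hz).trans (by linarith))), zero_mul]

theorem kk_zero {p z : En n} {r : ℝ} (hp : ‖p‖ ≤ r) (hr : r < 1)
    (hz : (1 - ‖z‖ ^ 2) * b ≤ (1 - r) ^ 2) : kk a b p z = 0 := by
  rcases le_or_gt (1 - ‖z‖ ^ 2) 0 with hρ | hρ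
  · exact kk_zero_of_nonpos ha h (hp.trans_lt hr) hρ
  · rw [kk, chi_zero h (Or.inr (le_vR hp hr hρ (by linarith) hz)), zero_mul]

theorem kk_nonneg {p z : En n} (hp : ‖p‖ < 1) : 0 ≤ kk a b p z := by
  rcases le_or_gt (1 - ‖z‖ ^ 2) 0 with hρ | hρ
  · rw [kk_zero_of_nonpos ha h hp hρ]
  · exact mul_nonneg (chi_nonneg ha h _) (by positivity)

theorem contDiffOn_kk {r : ℝ} (hr : r < 1) :
    ContDiffOn ℝ ∞ (fun q : En n × En n => kk a b q.1 q.2) (Metric.ball 0 r ×ˢ Set.univ) := by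
  rintro ⟨p, z⟩ ⟨hp, -⟩
  have hp : ‖p‖ < r := by simpa using hp
  refine ContDiffAt.contDiffWithinAt ?_
  rcases lt_or_ge ((1 - ‖z‖ ^ 2) * b) ((1 - r) ^ 2) with hz | hz
  · have h1 : ∀ᶠ q : En n × En n in nhds (p, z), ‖q.1‖ < r :=
      (isOpen_lt (by fun_prop) continuous_const).mem_nhds hp
    have h2 : ∀ᶠ q : En n × En n in nhds (p, z), (1 - ‖q.2‖ ^ 2) * b < (1 - r) ^ 2 :=
      (isOpen_lt (by fun_prop) continuous_const).mem_nhds hz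
    have : (fun q : En n × En n => kk a b q.1 q.2) =ᶠ[nhds (p, z)] fun _ => 0 := by
      filter_upwards [h1, h2] with q hq hq'
      exact kk_zero ha h hq.le hr hq'.le
    exact contDiffAt_const.congr_of_eventuallyEq this
  · have hρ : 0 < 1 - ‖z‖ ^ 2 := by
      have h1 : 0 < (1 - r) ^ 2 := pow_pos (by linarith) 2
      by_contra hc
      nlinarith
    have hn1 : ContDiffAt ℝ ∞ (fun q : En n × En n => ‖q.1‖ ^ 2) (p, z) :=
      contDiffAt_fst.norm_sq ℂ
    have hn2 : ContDiffAt ℝ ∞ (fun q : En n × En n => ‖q.2‖ ^ 2) (p, z) :=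
      contDiffAt_snd.norm_sq ℂ
    have hh1 : ContDiffAt ℝ ∞ (fun q : En n × En n => hh q.1 q.2) (p, z) := by
      simp_rw [hh_eq_inner]
      exact contDiffAt_const.sub (contDiffAt_fst.inner ℂ contDiffAt_snd)
    have hv : ContDiffAt ℝ ∞ (fun q : En n × En n => vR q.1 q.2) (p, z) :=
      (hh1.norm_sq ℂ).div ((contDiffAt_const.sub hn1).mul (contDiffAt_const.sub hn2))
        (mul_pos (one_sub_sq_pos (hp.trans hr)) hρ).ne'
    exact ((contDiff_chi ha h).contDiffAt.comp _ hv).mul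
      (((contDiffAt_const.sub hn2).inv hρ.ne').pow _)

end

end Sm

namespace Sm

variable {n : ℕ} {δ : ℝ}

theorem mem_ball_iff {z : En n} : z ∈ Metric.ball (0 : En n) 1 ↔ 0 < 1 - ‖z‖ ^ 2 := by
  rw [mem_ball_zero_iff]
  exact ⟨one_sub_sq_pos, norm_lt_one_of⟩

/-- A function on the ball, cut off near the boundary. -/
noncomputable def cutoff (hδ : 0 < δ) (f : En n → ℂ) (z : En n) : ℂ :=
  (wt 0 Cut.std hδ : Sm n) z * f z

theorem cutoff_eq (hδ : 0 < δ) (f : En n → ℂ) {z : En n} (hz : 2 * δ ≤ 1 - ‖z‖ ^ 2) :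
    cutoff hδ f z = f z := by
  rw [cutoff, wt_val, Cut.std_eq_one (by rwa [le_div_iff₀ hδ])]
  simp

theorem contDiff_cutoff (hδ : 0 < δ) {k : WithTop ℕ∞} (hk : k ≤ ((⊤ : ℕ∞) : WithTop ℕ∞))
    {f : En n → ℂ}
    (hf : ContDiffOn ℝ k f (Metric.ball 0 1)) : ContDiff ℝ k (cutoff hδ f) := by
  rw [contDiff_iff_contDiffAt]
  intro z
  rcases lt_or_ge (1 - ‖z‖ ^ 2) δ with hz | hz
  · have h1 : ∀ᶠ w : En n in nhds z, 1 - ‖w‖ ^ 2 < δ :=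
      (isOpen_lt (by fun_prop) continuous_const).mem_nhds hz
    have : cutoff hδ f =ᶠ[nhds z] fun _ => 0 := by
      filter_upwards [h1] with w hw
      have h0 : Cut.std.f ((1 - ‖w‖ ^ 2) / δ) = 0 :=
        Real.smoothTransition.zero_of_nonpos (by
          rw [sub_nonpos, div_le_one hδ]; exact hw.le)
      rw [cutoff, wt_val, h0]
      simp
    exact contDiffAt_const.congr_of_eventuallyEq this
  · have hb : z ∈ Metric.ball (0 : En n) 1 := mem_ball_iff.2 (by linarith)
    exact ((smooth (wt 0 Cut.std hδ)).of_le hk).contDiffAt.mul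
      (hf.contDiffAt (Metric.isOpen_ball.mem_nhds hb))

end Sm

section
variable {n : ℕ}

theorem wd_congr {f g : En n → ℂ} (j : Fin n) {O : Set (En n)} (hO : IsOpen O)
    (h : ∀ z ∈ O, f z = g z) : ∀ z ∈ O, wd n j f z = wd n j g z ∧ wdb n j f z = wdb n j g z := by
  intro z hz
  have : f =ᶠ[nhds z] g := by
    filter_upwards [hO.mem_nhds hz] with w hw using h w hw
  simp only [wd, wdb, this.fderiv_eq, and_self]

theorem MHarm.sum_eq {m : ℕ∞} {f : En n → ℂ} (hf : MHarm n m f) {z : En n}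
    (hz : 0 < 1 - ‖z‖ ^ 2) : ∑ j : Fin n, ∑ k : Fin n,
      ((if j = k then 1 else 0) - z j * (starRingEnd ℂ) (z k)) * wd n j (wdb n k f) z = 0 := by
  have h := hf.2 z (Sm.mem_ball_iff.2 hz)
  have h4 : (4 : ℂ) * (1 - (‖z‖ : ℂ) ^ 2) ≠ 0 := by
    refine mul_ne_zero (by norm_num) ?_
    rw [← Complex.ofReal_pow, ← Complex.ofReal_one, ← Complex.ofReal_sub]
    exact Complex.ofReal_ne_zero.2 hz.ne'
  exact (mul_eq_zero.1 h).resolve_left h4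

theorem mharm_const (c : ℂ) {m : ℕ∞} : MHarm n m fun _ => c := by
  refine ⟨contDiffOn_const, fun z _ => ?_⟩
  have h : ∀ k, wdb n k (fun _ => c) = fun _ => 0 := by
    intro k; funext z; simp [wdb]
  simp [h, wd]

end

namespace Sm
variable {n : ℕ} {a b : ℝ}

theorem continuous_kk (ha : 1 < a) (h : a < b) {p : En n} (hp : ‖p‖ < 1) :
    Continuous (kk a b p) := by
  have h1 := contDiffOn_kk (n := n) ha h (r := (1 + ‖p‖) / 2) (by linarith)
  have : ContinuousOn (fun z : En n => kk a b p z) Set.univ :=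
    h1.continuousOn.comp (f := fun z : En n => (p, z)) (by fun_prop) fun z _ =>
      ⟨by rw [mem_ball_zero_iff]; linarith, trivial⟩
  exact continuousOn_univ.1 this

theorem kk_zero_off (ha : 1 < a) (h : a < b) {p : En n} {r : ℝ} (hp : ‖p‖ ≤ r) (hr : r < 1)
    {z : En n} (hz : z ∉ Kset n ((1 - r) ^ 2 / b)) : kk a b p z = 0 := by
  refine kk_zero ha h hp hr ?_
  have hz : ¬ ((1 - r) ^ 2 / b ≤ 1 - ‖z‖ ^ 2) := hz
  rw [not_le, lt_div_iff₀ (by linarith)] at hz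
  exact hz.le

section
variable {E : Type*} [NormedAddCommGroup E] [NormedSpace ℝ E]

theorem continuous_kk_smul (ha : 1 < a) (h : a < b) {p : En n} (hp : ‖p‖ < 1)
    {f : En n → E} (hf : ContinuousOn f (Metric.ball 0 1)) :
    Continuous fun z => kk a b p z • f z := by
  rw [continuous_iff_continuousAt]
  intro z
  rcases lt_or_ge ((1 - ‖z‖ ^ 2) * b) ((1 - ‖p‖) ^ 2) with hz | hz
  · have h1 : ∀ᶠ w : En n in nhds z, (1 - ‖w‖ ^ 2) * b < (1 - ‖p‖) ^ 2 :=
      (isOpen_lt (by fun_prop) continuous_const).mem_nhds hz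
    have : (fun z => kk a b p z • f z) =ᶠ[nhds z] fun _ => 0 := by
      filter_upwards [h1] with w hw
      rw [kk_zero ha h le_rfl hp hw.le, zero_smul]
    exact continuousAt_const.congr this.symm
  · have hρ : 0 < 1 - ‖z‖ ^ 2 := by
      have h1 : 0 < (1 - ‖p‖) ^ 2 := pow_pos (by linarith) 2
      by_contra hc
      nlinarith
    exact (continuous_kk ha h hp).continuousAt.smul
      (hf.continuousAt (Metric.isOpen_ball.mem_nhds (mem_ball_iff.2 hρ)))

theorem integrable_kk_smul (ha : 1 < a) (h : a < b) {p : En n} (hp : ‖p‖ < 1)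
    {f : En n → E} (hf : ContinuousOn f (Metric.ball 0 1)) :
    Integrable (fun z => kk a b p z • f z) (volume : Measure (En n)) :=
  (continuous_kk_smul ha h hp hf).integrable_of_hasCompactSupport
    (HasCompactSupport.intro (isCompact_Kset ((1 - ‖p‖) ^ 2 / b)) fun z hz => by
      rw [kk_zero_off ha h le_rfl hp hz, zero_smul])

end

theorem integral_kk_eq (hn : 1 ≤ n) {a' b' : ℝ} (ha : 1 < a) (h : a < b) (ha' : 1 < a')
    (h' : a' < b') {p : En n} (hp : ‖p‖ < 1) {f : En n → ℂ} (hf : MHarm n 2 f) :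
    ∫ z, kk a b p z • f z = ∫ z, kk a' b' p z • f z := by
  obtain ⟨Ψ, hΨ, hΨV, hΨe⟩ := exists_potential hn ha h ha' h'
  set V := max b b' with hVdef
  have hV1 : 1 < V := (ha.trans h).trans_le (le_max_left _ _)
  obtain ⟨δ, hδ, hδV⟩ : ∃ δ : ℝ, 0 < δ ∧ 4 * δ * (2 * V) = (1 - ‖p‖) ^ 2 := by
    refine ⟨(1 - ‖p‖) ^ 2 / (8 * V), div_pos (pow_pos (by linarith) 2) (by linarith), ?_⟩
    field_simp
    ring
  have hV : ∀ z ∈ Oset n (2 * δ), z ∉ Kset n (4 * δ) → V < (vv p hδ z).re := by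
    intro z hz hz'
    have hz : 2 * δ < 1 - ‖z‖ ^ 2 := hz
    have hz' : ¬ (4 * δ ≤ 1 - ‖z‖ ^ 2) := hz'
    rw [vv_eq p hδ hz.le, Complex.ofReal_re]
    have := le_vR (p := p) (z := z) (b := 2 * V) le_rfl hp (by linarith) (by linarith)
      (by rw [← hδV]; exact mul_le_mul_of_nonneg_right (by linarith) (by linarith))
    linarith
  have hcd := contDiff_cutoff hδ (k := 2)
    (by simpa using WithTop.coe_le_coe.2 (le_top : (2 : ℕ∞) ≤ ⊤)) hf.1
  have hcut : ∀ z ∈ Oset n (2 * δ), cutoff hδ f z = f z := fun z hz =>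
    cutoff_eq hδ f (le_of_lt hz)
  have key := kernel_identity p hδ hΨ hV hΨV hcd fun z hz => by
    rw [← hf.sum_eq (z := z) (by have : 2 * δ < 1 - ‖z‖ ^ 2 := hz; linarith)]
    refine Finset.sum_congr rfl fun j _ => Finset.sum_congr rfl fun k _ => ?_
    rw [(wd_congr j (isOpen_Oset (2 * δ)) (fun z hz => (wd_congr k (isOpen_Oset (2 * δ))
      hcut z hz).2) z hz).1]
  rw [← sub_eq_zero, ← integral_sub (integrable_kk_smul ha h hp hf.1.continuousOn)
    (integrable_kk_smul ha' h' hp hf.1.continuousOn), ← key]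
  refine integral_congr_ae (Filter.Eventually.of_forall fun z => ?_)
  change kk a b p z • f z - kk a' b' p z • f z = cutoff hδ f z *
    ∑ j, dz j (GG p hδ (contDiff_deriv' hΨ) j) z
  by_cases hz : z ∈ Kset n (4 * δ)
  · have hz1 : 4 * δ ≤ 1 - ‖z‖ ^ 2 := hz
    have hz2 : z ∈ Oset n (2 * δ) := by
      change 2 * δ < 1 - ‖z‖ ^ 2
      linarith
    have e := hΨe (vR p z)
    rw [hcut z hz2, div_GG p hδ _ hV (deriv_eq_zero_of_gt hΨV) hp hz2, vv_eq p hδ (by linarith),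
      uu_val hδ (by linarith), Complex.ofReal_re]
    have e' := congrArg (fun x : ℝ => (x : ℂ)) e
    push_cast at e'
    rw [e', kk, kk, Complex.real_smul, Complex.real_smul]
    push_cast
    ring
  · have h0 : ∀ c, 1 < c → c ≤ V → (1 - ‖z‖ ^ 2) * c ≤ (1 - ‖p‖) ^ 2 := by
      intro c hc hcV
      have hz : ¬ (4 * δ ≤ 1 - ‖z‖ ^ 2) := hz
      rw [← hδV]
      calc (1 - ‖z‖ ^ 2) * c ≤ 4 * δ * c := by
            exact mul_le_mul_of_nonneg_right (by linarith) (by linarith)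
        _ ≤ _ := mul_le_mul_of_nonneg_left (by linarith) (by linarith)
    rw [kk_zero ha h le_rfl hp (h0 b (by linarith) (le_max_left _ _)),
      kk_zero ha' h' le_rfl hp (h0 b' (by linarith) (le_max_right _ _)),
      Finset.sum_eq_zero fun j _ => (dz_zero_on j (isClosed_Kset (4 * δ)).isOpen_compl
        (fun z hz => GG_zero p hδ hΨ hV hΨV j hz) z hz).1]
    simp

end Sm

namespace Sm
variable {n : ℕ} {a b : ℝ}

theorem vR_self {p : En n} (hp : ‖p‖ < 1) : vR p p = 1 := by
  have hα := one_sub_sq_pos hp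
  have : hh p p = ((1 - ‖p‖ ^ 2 : ℝ) : ℂ) := by
    rw [hh_eq_inner, inner_self_eq_norm_sq_to_K]; push_cast; rfl
  rw [vR, this, Complex.norm_real, Real.norm_eq_abs, sq_abs, ← sq, div_self (by positivity)]

theorem continuousOn_vR {p : En n} (hp : ‖p‖ < 1) :
    ContinuousOn (vR p) (Metric.ball 0 1) := by
  unfold vR
  refine ContinuousOn.div ?_ (by fun_prop) fun z hz =>
    (mul_pos (one_sub_sq_pos hp) (mem_ball_iff.1 hz)).ne'
  simp_rw [hh_eq_inner]
  fun_prop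

theorem exists_vR_eq (hn : 1 ≤ n) {p : En n} (hp : ‖p‖ < 1) {x : ℝ} (hx : 1 ≤ x) :
    ∃ z ∈ Metric.ball (0 : En n) 1, vR p z = x := by
  have h0 : 0 < (1 - ‖p‖) ^ 2 / x := div_pos (pow_pos (by linarith) 2) (by linarith)
  have h1 : (1 - ‖p‖) ^ 2 / x ≤ 1 := by
    rw [div_le_one (by linarith)]
    have : (1 - ‖p‖) ^ 2 ≤ 1 := pow_le_one₀ (by linarith) (by linarith [norm_nonneg p])
    linarith
  set τ := Real.sqrt (1 - (1 - ‖p‖) ^ 2 / x) with hτ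
  set e : En n := EuclideanSpace.single ⟨0, hn⟩ (τ : ℂ) with he
  have hen : 1 - ‖e‖ ^ 2 = (1 - ‖p‖) ^ 2 / x := by
    rw [he, PiLp.norm_single, Complex.norm_real, Real.norm_eq_abs, sq_abs, hτ,
      Real.sq_sqrt (by linarith)]
    ring
  have heb : e ∈ Metric.ball (0 : En n) 1 := mem_ball_iff.2 (by rw [hen]; exact h0)
  have hle : x ≤ vR p e := le_vR le_rfl hp (by rw [hen]; exact h0) (by linarith)
    (by rw [hen, div_mul_cancel₀ _ (by linarith)])
  have hpre : IsPreconnected (Metric.ball (0 : En n) 1) := (convex_ball 0 1).isPreconnected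
  have := hpre.intermediate_value (mem_ball_zero_iff.2 hp) heb (continuousOn_vR hp)
    ⟨(vR_self hp).trans_le hx, hle⟩
  obtain ⟨z, hz, hzx⟩ := this
  exact ⟨z, hz, hzx⟩

theorem integral_kk_pos (hn : 1 ≤ n) (ha : 1 < a) (h : a < b) {p : En n} (hp : ‖p‖ < 1) :
    0 < ∫ z, kk a b p z := by
  obtain ⟨x, hxa, -, hx⟩ := exists_chi_pos (n := n) ha h
  obtain ⟨z, hz, hzx⟩ := exists_vR_eq hn hp (x := x) (by linarith)
  refine (continuous_kk ha h hp).integral_pos_of_hasCompactSupport_nonneg_nonzero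
    (HasCompactSupport.intro (isCompact_Kset ((1 - ‖p‖) ^ 2 / b)) fun z hz =>
      kk_zero_off ha h le_rfl hp hz) (fun z => kk_nonneg ha h hp) (x := z) ?_
  rw [kk, hzx]
  exact (mul_pos hx (pow_pos (inv_pos.2 (mem_ball_iff.1 hz)) _)).ne'

theorem integrable_kk (ha : 1 < a) (h : a < b) {p : En n} (hp : ‖p‖ < 1) :
    Integrable (kk a b p) (volume : Measure (En n)) := by
  have := integrable_kk_smul (n := n) (E := ℝ) ha h hp (f := fun _ => 1) continuousOn_const
  simp only [smul_eq_mul, mul_one] at this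
  exact this

theorem integral_kk_indep (hn : 1 ≤ n) {a' b' : ℝ} (ha : 1 < a) (h : a < b) (ha' : 1 < a')
    (h' : a' < b') {p : En n} (hp : ‖p‖ < 1) : ∫ z, kk a b p z = ∫ z, kk a' b' p z := by
  have := integral_kk_eq hn ha h ha' h' hp (mharm_const 1)
  rw [integral_smul_const, integral_smul_const] at this
  exact smul_left_injective ℝ (one_ne_zero : (1 : ℂ) ≠ 0) this

theorem mean_value (hn : 1 ≤ n) (ha : 1 < a) (h : a < b) {p : En n} (hp : ‖p‖ < 1) {f : En n → ℂ}
    (hf : MHarm n 2 f) : ∫ z, kk a b p z • f z = (∫ z, kk a b p z) • f p := by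
  have hc := integral_kk_pos hn ha h hp
  set c := ∫ z, kk a b p z with hcdef
  rw [← sub_eq_zero, ← norm_eq_zero]
  refine le_antisymm (le_of_forall_pos_le_add fun ε hε => ?_) (norm_nonneg _)
  have hpb : Metric.ball (0 : En n) 1 ∈ nhds p :=
    Metric.isOpen_ball.mem_nhds (mem_ball_zero_iff.2 hp)
  obtain ⟨η, hη, hηf⟩ := Metric.continuousAt_iff.1 (hf.1.continuousOn.continuousAt hpb) (ε / c)
    (div_pos hε hc)
  have ha' : 1 < 1 + η ^ 2 / 4 := by linarith [pow_pos hη 2]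
  have h' : 1 + η ^ 2 / 4 < 1 + η ^ 2 / 2 := by linarith [pow_pos hη 2]
  have hcc : c = _ := integral_kk_indep hn ha h ha' h' hp
  rw [integral_kk_eq hn ha h ha' h' hp hf, hcc, ← integral_smul_const,
    ← integral_sub (integrable_kk_smul ha' h' hp hf.1.continuousOn)
      (integrable_kk_smul ha' h' hp continuousOn_const), zero_add]
  have hle : ∀ z, ‖kk (1 + η ^ 2 / 4) (1 + η ^ 2 / 2) p z • f z -
      kk (1 + η ^ 2 / 4) (1 + η ^ 2 / 2) p z • f p‖ ≤
      kk (1 + η ^ 2 / 4) (1 + η ^ 2 / 2) p z * (ε / c) := by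
    intro z
    rw [← smul_sub, norm_smul, Real.norm_of_nonneg (kk_nonneg ha' h' hp)]
    by_cases hk : kk (1 + η ^ 2 / 4) (1 + η ^ 2 / 2) p z = 0
    · rw [hk]; simp
    refine mul_le_mul_of_nonneg_left ?_ (kk_nonneg ha' h' hp)
    have hρ : 0 < 1 - ‖z‖ ^ 2 := by
      by_contra hc
      exact hk (kk_zero_of_nonpos ha' h' hp (not_lt.1 hc))
    have hv : vR p z < 1 + η ^ 2 / 2 := by
      by_contra hc
      exact hk (by rw [kk, chi_zero h' (Or.inr (not_lt.1 hc)), zero_mul])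
    have hd := sq_dist_le_vR hp (norm_lt_one_of hρ)
    have : dist z p < η := by
      rw [dist_eq_norm]
      refine lt_of_pow_lt_pow_left₀ 2 hη.le ?_
      linarith [pow_pos hη 2]
    have := hηf this
    rw [dist_eq_norm] at this
    exact this.le
  refine (norm_integral_le_of_norm_le ((integrable_kk ha' h' hp).mul_const (ε / c))
    (Filter.Eventually.of_forall hle)).trans ?_
  rw [integral_mul_const, ← hcc, mul_div_cancel₀ _ hc.ne']

theorem contDiffOn_integral_kk (ha : 1 < a) (h : a < b) {f : En n → ℂ}
    (hf : ContinuousOn f (Metric.ball 0 1)) :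
    ContDiffOn ℝ ∞ (fun p : En n => ∫ z, kk a b p z • f z) (Metric.ball 0 1) := by
  intro p hp
  have hp : ‖p‖ < 1 := mem_ball_zero_iff.1 hp
  set r := (1 + ‖p‖) / 2 with hr
  have hr1 : r < 1 := by linarith
  obtain ⟨δ, hδ, hδr⟩ : ∃ δ : ℝ, 0 < δ ∧ 2 * δ = (1 - r) ^ 2 / b :=
    ⟨(1 - r) ^ 2 / b / 2, div_pos (div_pos (pow_pos (by linarith) 2) (by linarith)) two_pos,
      by ring⟩
  have hF : Continuous (cutoff hδ f) :=
    contDiff_zero.1 (contDiff_cutoff hδ (by simp) (contDiffOn_zero.2 hf))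
  have key := contDiffOn_convolution_right_with_param (μ := (volume : Measure (En n))) (n := ⊤)
    (f := cutoff hδ f)
    (g := fun p y => kk a b p (-y)) ((ContinuousLinearMap.lsmul ℝ ℝ : ℝ →L[ℝ] ℂ →L[ℝ] ℂ).flip)
    (s := Metric.ball (0 : En n) r) (k := Kset n ((1 - r) ^ 2 / b)) Metric.isOpen_ball
    (isCompact_Kset _) (fun q x hq hx => kk_zero_off ha h (mem_ball_zero_iff.1 hq).le hr1
      (fun hc => hx (by
        have hc : (1 - r) ^ 2 / b ≤ 1 - ‖-x‖ ^ 2 := hc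
        rw [norm_neg] at hc
        exact hc))) hF.locallyIntegrable
    ((contDiffOn_kk ha h hr1).comp (f := fun q : En n × En n => (q.1, -q.2))
      (contDiff_fst.prodMk contDiff_snd.neg).contDiffOn fun q hq => ⟨hq.1, trivial⟩)
  have hpr : p ∈ Metric.ball (0 : En n) r := by
    rw [mem_ball_zero_iff]; linarith
  have h2 : ContDiffOn ℝ ∞ (fun p : En n => ∫ z, kk a b p z • f z) (Metric.ball 0 r) := by
    refine (key.comp (f := fun q : En n => (q, (0 : En n)))
      (contDiff_id.prodMk contDiff_const).contDiffOn fun q hq => ⟨hq, trivial⟩).congr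
      fun q hq => ?_
    change _ = ∫ z, kk a b q (-(0 - z)) • cutoff hδ f z
    refine integral_congr_ae (Filter.Eventually.of_forall fun z => ?_)
    change kk a b q z • f z = kk a b q (-(0 - z)) • cutoff hδ f z
    rw [zero_sub, neg_neg]
    by_cases hz : z ∈ Kset n ((1 - r) ^ 2 / b)
    · rw [cutoff_eq hδ f (hδr.trans_le hz)]
    · rw [kk_zero_off ha h (mem_ball_zero_iff.1 hq).le hr1 hz, zero_smul, zero_smul]
  exact (h2.contDiffAt (Metric.isOpen_ball.mem_nhds hpr)).contDiffWithinAt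

theorem contDiffOn_integral_kk_one (ha : 1 < a) (h : a < b) :
    ContDiffOn ℝ ∞ (fun p : En n => ∫ z, kk a b p z) (Metric.ball 0 1) := by
  have := Complex.reCLM.contDiff.comp_contDiffOn
    (contDiffOn_integral_kk (n := n) ha h (f := fun _ => 1) continuousOn_const)
  refine this.congr fun p hp => ?_
  change _ = (∫ z, kk a b p z • (1 : ℂ)).re
  rw [integral_smul_const, Complex.real_smul, mul_one, Complex.ofReal_re]

end Sm

theorem MHarm.contDiffOn_top {n : ℕ} (hn : 1 ≤ n) {f : En n → ℂ} (hf : MHarm n 2 f) :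
    ContDiffOn ℝ ∞ f (Metric.ball 0 1) := by
  have ha : (1 : ℝ) < 2 := by norm_num
  have h : (2 : ℝ) < 3 := by norm_num
  refine (((Sm.contDiffOn_integral_kk_one ha h).inv fun p hp =>
    (Sm.integral_kk_pos hn ha h (mem_ball_zero_iff.1 hp)).ne').smul
      (Sm.contDiffOn_integral_kk ha h hf.1.continuousOn)).congr fun p hp => ?_
  have hp := mem_ball_zero_iff.1 hp
  change f p = (∫ z, Sm.kk 2 3 p z)⁻¹ • ∫ z, Sm.kk 2 3 p z • f z
  rw [Sm.mean_value hn ha h hp hf, smul_smul, inv_mul_cancel₀ (Sm.integral_kk_pos hn ha h hp).ne',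
    one_smul]

namespace Sm
variable {n : ℕ}

/-- A compact annulus in the ball. -/
def Ann (n : ℕ) (d : ℝ) : Set (En n) := {z | 1 / 9 ≤ ‖z‖ ^ 2 ∧ d ≤ 1 - ‖z‖ ^ 2}

theorem isCompact_Ann (d : ℝ) : IsCompact (Ann n d) :=
  (isCompact_Kset d).inter_left (isClosed_le continuous_const (by fun_prop) :
    IsClosed {z : En n | 1 / 9 ≤ ‖z‖ ^ 2})

theorem kk_zero_off_Ann {a b r : ℝ} (ha : 1 < a) (h : a < b) {p z : En n} (hp : ‖p‖ ≤ r)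
    (hr : r < 1) (har : 2 ≤ a * (1 - r ^ 2)) (hz : z ∉ Ann n ((1 - r) ^ 2 / b)) :
    kk a b p z = 0 := by
  by_cases hz1 : z ∈ Kset n ((1 - r) ^ 2 / b)
  · have hz2 : ‖z‖ ^ 2 < 1 / 9 := by
      by_contra hc
      exact hz ⟨not_lt.1 hc, hz1⟩
    have hz3 : ‖z‖ < 1 / 3 := by
      refine lt_of_pow_lt_pow_left₀ 2 (by norm_num) ?_
      linarith
    have hα := one_sub_sq_pos (hp.trans_lt hr)
    have hpr : ‖p‖ ^ 2 ≤ r ^ 2 := by gcongr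
    have hh1 := norm_hh_le (p := p) (z := z) (hp.trans hr.le)
    have hh2 : ‖hh p z‖ ^ 2 ≤ 16 / 9 := by
      have := pow_le_pow_left₀ (norm_nonneg _) (hh1.trans (by linarith : 1 + ‖z‖ ≤ 4 / 3)) 2
      linarith
    rw [kk, chi_zero h (Or.inl ?_), zero_mul]
    rw [vR, div_le_iff₀ (mul_pos hα (by linarith))]
    have h2 : 2 ≤ a * (1 - ‖p‖ ^ 2) := har.trans (mul_le_mul_of_nonneg_left (by linarith)
      (by linarith))
    nlinarith
  · exact kk_zero_off ha h hp hr hz1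

theorem exists_pointwise_bound (hn : 1 ≤ n) {r : ℝ} (hr0 : 0 ≤ r) (hr : r < 1) :
    ∃ C d : ℝ, 0 ≤ C ∧ 0 < d ∧ ∀ f : En n → ℂ, MHarm n 2 f → ∀ p, ‖p‖ ≤ r →
      ‖f p‖ ^ 2 ≤ C * ∫ z in Ann n d, ‖f z‖ ^ 2 := by
  have hr2 : 0 < 1 - r ^ 2 := by nlinarith
  obtain ⟨a, ha, har⟩ : ∃ a : ℝ, 1 < a ∧ 2 ≤ a * (1 - r ^ 2) :=
    ⟨2 / (1 - r ^ 2), by rw [lt_div_iff₀ hr2]; nlinarith, by rw [div_mul_cancel₀ _ hr2.ne']⟩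
  have h : a < a + 1 := by linarith
  have hball : ∀ p : En n, ‖p‖ ≤ r → ‖p‖ < 1 := fun p hp => hp.trans_lt hr
  have hd : 0 < (1 - r) ^ 2 / (a + 1) := div_pos (pow_pos (by linarith) 2) (by linarith)
  set d := (1 - r) ^ 2 / (a + 1) with hddef
  obtain ⟨c, hc, hcle⟩ : ∃ c : ℝ, 0 < c ∧ ∀ p : En n, ‖p‖ ≤ r → c ≤ ∫ z, kk a (a + 1) p z := by
    obtain ⟨q, hq, hqm⟩ := (isCompact_closedBall (0 : En n) r).exists_isMinOn
      ⟨0, by simpa using hr0⟩ ((contDiffOn_integral_kk_one ha h).continuousOn.mono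
        (Metric.closedBall_subset_ball hr))
    exact ⟨_, integral_kk_pos hn ha h (hball q (mem_closedBall_zero_iff.1 hq)),
      fun p hp => hqm (mem_closedBall_zero_iff.2 hp)⟩
  obtain ⟨M, hM⟩ := ((isCompact_closedBall (0 : En n) r).prod
    (isCompact_Kset d)).exists_bound_of_continuousOn
      ((contDiffOn_kk (n := n) ha h (r := (1 + r) / 2) (by linarith)).continuousOn.mono
        (Set.prod_mono (Metric.closedBall_subset_ball (by linarith)) (Set.subset_univ _)))
  have hM' : ∀ p z : En n, ‖p‖ ≤ r → z ∈ Ann n d → kk a (a + 1) p z ≤ max M 0 := fun p z hp hz =>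
    (le_abs_self _).trans ((hM (p, z) ⟨mem_closedBall_zero_iff.2 hp, hz.2⟩).trans (le_max_left _ _))
  refine ⟨max M 0 / c, d, div_nonneg (le_max_right _ _) hc.le, hd, fun f hf p hp => ?_⟩
  have hp1 := hball p hp
  have hfc := hf.1.continuousOn
  have hk0 : ∀ z, 0 ≤ kk a (a + 1) p z := fun z => kk_nonneg ha h hp1
  have i1 := integrable_kk_smul ha h hp1 hfc.norm
  have i2 : Integrable (fun z => kk a (a + 1) p z • ‖f z‖ ^ 2) (volume : Measure (En n)) :=
    integrable_kk_smul ha h hp1 (hfc.norm.pow 2)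
  have i0 := integrable_kk (n := n) ha h hp1
  have h1 : (∫ z, kk a (a + 1) p z) * ‖f p‖ ≤ ∫ z, kk a (a + 1) p z • ‖f z‖ := by
    rw [← Real.norm_of_nonneg (hc.le.trans (hcle p hp)), ← norm_smul, ← mean_value hn ha h hp1 hf]
    refine (norm_integral_le_integral_norm _).trans_eq ?_
    refine integral_congr_ae (Filter.Eventually.of_forall fun z => ?_)
    change ‖kk a (a + 1) p z • f z‖ = kk a (a + 1) p z • ‖f z‖
    rw [norm_smul, Real.norm_of_nonneg (hk0 z), smul_eq_mul]
  have h2 : 0 ≤ (∫ z, kk a (a + 1) p z • ‖f z‖ ^ 2) - 2 * ‖f p‖ * (∫ z, kk a (a + 1) p z • ‖f z‖) +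
      ‖f p‖ ^ 2 * ∫ z, kk a (a + 1) p z := by
    have i3 : Integrable (fun z => kk a (a + 1) p z • ‖f z‖ ^ 2 -
        2 * ‖f p‖ * (kk a (a + 1) p z • ‖f z‖)) (volume : Measure (En n)) :=
      i2.sub (i1.const_mul _)
    rw [← integral_const_mul, ← integral_const_mul, ← integral_sub i2 (i1.const_mul _),
      ← integral_add i3 (i0.const_mul _)]
    refine integral_nonneg fun z => ?_
    have := mul_nonneg (hk0 z) (sq_nonneg (‖f z‖ - ‖f p‖))
    simp only [smul_eq_mul, Pi.zero_apply]
    linarith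
  have h3 : ∫ z, kk a (a + 1) p z • ‖f z‖ ^ 2 ≤ max M 0 * ∫ z in Ann n d, ‖f z‖ ^ 2 := by
    have e : ∫ z, kk a (a + 1) p z • ‖f z‖ ^ 2 =
        ∫ z in Ann n d, kk a (a + 1) p z • ‖f z‖ ^ 2 :=
      (setIntegral_eq_integral_of_forall_compl_eq_zero fun z hz => by
        rw [kk_zero_off_Ann ha h hp hr har hz, zero_smul]).symm
    have hAb : Ann n d ⊆ Metric.ball 0 1 := fun z hz =>
      mem_ball_iff.2 (hd.trans_le hz.2)
    rw [e, ← integral_const_mul]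
    refine setIntegral_mono_on i2.integrableOn
      ((((hfc.norm.pow 2).mono hAb).integrableOn_compact (isCompact_Ann d)).const_mul _)
      (isCompact_Ann d).measurableSet fun z hz => ?_
    exact mul_le_mul_of_nonneg_right (hM' p z hp hz) (sq_nonneg _)
  have h4 : ‖f p‖ ^ 2 * c ≤ max M 0 * ∫ z in Ann n d, ‖f z‖ ^ 2 := by
    have := mul_le_mul_of_nonneg_left h1 (norm_nonneg (f p))
    have := mul_le_mul_of_nonneg_left (hcle p hp) (sq_nonneg ‖f p‖)
    linarith
  rw [div_mul_eq_mul_div, le_div_iff₀ hc]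
  exact h4

end Sm

namespace Sm

variable {n : ℕ} {δ : ℝ}

theorem exists_lift {f : En n → ℂ} (hf : ContDiffOn ℝ ∞ f (Metric.ball 0 1)) (hδ : 0 < δ) :
    ∃ g : Sm n, ∀ z, δ ≤ 1 - ‖z‖ ^ 2 → g z = f z :=
  ⟨⟨cutoff (half_pos hδ) f, mem_iff.2 (contDiff_cutoff _ le_rfl hf)⟩, fun z hz =>
    cutoff_eq _ f (by linarith)⟩

theorem Q_val (g : Sm n) (z : En n) : (WA n).Q g z = ∑ j : Fin n, ∑ k : Fin n,
    ((if j = k then 1 else 0) - z j * (starRingEnd ℂ) (z k)) * wd n j (wdb n k g.1) z := by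
  have h : (WA n).R ((WA n).Rb g) = ∑ j, ∑ k, (coord j * conj (coord k)) * dz j (dzb k g) := by
    rw [WirtAlg.R_apply]
    refine Finset.sum_congr rfl fun j _ => ?_
    rw [WirtAlg.Rb_apply, map_sum, Finset.mul_sum]
    refine Finset.sum_congr rfl fun k _ => ?_
    rw [Derivation.leibniz, (WA n).d_Zb, smul_zero, add_zero]
    change coord j * (conj (coord k) * dz j (dzb k g)) = _
    ring
  rw [WirtAlg.Q, h, sub_val, sum_val, sum_val, ← Finset.sum_sub_distrib]
  refine Finset.sum_congr rfl fun j _ => ?_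
  rw [sum_val]
  simp only [sub_mul, Finset.sum_sub_distrib, ite_mul, one_mul, zero_mul, Finset.sum_ite_eq,
    Finset.mem_univ, if_true]
  rfl

theorem Q_congr {f : En n → ℂ} {g : Sm n} {O : Set (En n)} (hO : IsOpen O)
    (h : ∀ z ∈ O, g z = f z) : ∀ z ∈ O, (WA n).Q g z = ∑ j : Fin n, ∑ k : Fin n,
    ((if j = k then 1 else 0) - z j * (starRingEnd ℂ) (z k)) * wd n j (wdb n k f) z := by
  intro z hz
  rw [Q_val]
  refine Finset.sum_congr rfl fun j _ => Finset.sum_congr rfl fun k _ => ?_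
  rw [(wd_congr j hO (fun w hw => (wd_congr k hO h w hw).2) z hz).1]

theorem MHarm.Q_eq_zero {m : ℕ∞} {f : En n → ℂ} (hf : MHarm n m f) {g : Sm n} {O : Set (En n)}
    (hO : IsOpen O) (hOb : O ⊆ Metric.ball 0 1) (h : ∀ z ∈ O, g z = f z) :
    ∀ z ∈ O, (WA n).Q g z = 0 := fun z hz => by
  rw [Q_congr hO h z hz]
  exact MHarm.sum_eq hf (mem_ball_iff.1 (hOb hz))

theorem mharm_of_local {f : En n → ℂ} (h : ∀ z ∈ Metric.ball (0 : En n) 1, ∃ g : Sm n,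
    ∃ O : Set (En n), IsOpen O ∧ z ∈ O ∧ (∀ w ∈ O, g w = f w) ∧ (WA n).Q g z = 0) :
    MHarm n 2 f := by
  refine ⟨fun z hz => ?_, fun z hz => ?_⟩
  · obtain ⟨g, O, hO, hzO, hg, -⟩ := h z hz
    have h1 : ContDiffAt ℝ ((2 : ℕ∞) : WithTop ℕ∞) g.1 z :=
      (smooth g).contDiffAt.of_le (by exact_mod_cast le_top)
    exact (h1.congr_of_eventuallyEq (Filter.eventually_of_mem (hO.mem_nhds hzO)
      fun w hw => (hg w hw).symm)).contDiffWithinAt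
  · obtain ⟨g, O, hO, hzO, hg, hQ⟩ := h z hz
    rw [← Q_congr hO hg z hzO, hQ, mul_zero]

theorem Oset_subset_ball (hδ : 0 ≤ δ) : Oset n δ ⊆ Metric.ball 0 1 := fun _ hz =>
  mem_ball_iff.2 (lt_of_le_of_lt hδ hz)

/-- The operator `∂_l - z̄_l R̄` on functions. -/
noncomputable def alF (l : Fin n) (f : En n → ℂ) (z : En n) : ℂ :=
  wd n l f z - starRingEnd ℂ (z l) * ∑ k, starRingEnd ℂ (z k) * wdb n k f z

/-- The operator `∂̄_l - z_l R` on functions. -/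
noncomputable def blF (l : Fin n) (f : En n → ℂ) (z : En n) : ℂ :=
  wdb n l f z - z l * ∑ k, z k * wd n k f z

theorem Al_val (l : Fin n) (g : Sm n) (z : En n) : (WA n).Al l g z = alF l g.1 z := by
  rw [WirtAlg.Al_apply, WirtAlg.Rb_apply, sub_val, mul_val, sum_val]
  rfl

theorem swap_Al_val (l : Fin n) (g : Sm n) (z : En n) :
    (WA n).swap.Al l g z = blF l g.1 z := by
  rw [WirtAlg.Al_apply, WirtAlg.Rb_apply, sub_val, mul_val, sum_val]
  rfl

theorem alF_congr {f : En n → ℂ} {g : Sm n} {O : Set (En n)} (hO : IsOpen O)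
    (h : ∀ z ∈ O, g z = f z) (l : Fin n) :
    ∀ z ∈ O, (WA n).Al l g z = alF l f z ∧ (WA n).swap.Al l g z = blF l f z := by
  intro z hz
  have := fun k => wd_congr k hO h z hz
  rw [Al_val, swap_Al_val]
  simp only [alF, blF, this, and_self]

theorem Al_zero_on {a : Sm n} {O : Set (En n)} (hO : IsOpen O) (h : ∀ z ∈ O, a z = 0)
    (l : Fin n) : ∀ z ∈ O, (WA n).Al l a z = 0 ∧ (WA n).swap.Al l a z = 0 := by
  intro z hz
  have h' := fun k => wd_congr k hO (g := fun _ => 0) h z hz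
  have h0 : ∀ k, wd n k (fun _ => 0) z = 0 ∧ wdb n k (fun _ => 0) z = 0 := by
    intro k; simp [wd, wdb]
  rw [Al_val, swap_Al_val]
  simp [alF, blF, h', h0]

theorem mharm_alF (hn : 1 ≤ n) {f : En n → ℂ} (hf : MHarm n 2 f) (l : Fin n) :
    MHarm n 2 (alF l f) ∧ MHarm n 2 (blF l f) := by
  have key : ∀ z ∈ Metric.ball (0 : En n) 1, ∃ g : Sm n, ∃ O : Set (En n), IsOpen O ∧ z ∈ O ∧
      (∀ w ∈ O, g w = f w) ∧ ∀ w ∈ O, (WA n).Q g w = 0 := by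
    intro z hz
    have hz := mem_ball_iff.1 hz
    obtain ⟨g, hg⟩ := exists_lift (MHarm.contDiffOn_top hn hf) (half_pos hz)
    have h1 : ∀ w ∈ Oset n ((1 - ‖z‖ ^ 2) / 2), g w = f w := fun w hw => hg w (le_of_lt hw)
    exact ⟨g, Oset n ((1 - ‖z‖ ^ 2) / 2), isOpen_Oset _, half_lt_self hz, h1,
      MHarm.Q_eq_zero hf (isOpen_Oset _) (Oset_subset_ball (by linarith)) h1⟩
  constructor <;> refine mharm_of_local fun z hz => ?_ <;>
    obtain ⟨g, O, hO, hzO, hg, hQ⟩ := key z hz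
  · refine ⟨(WA n).Al l g, O, hO, hzO, fun w hw => (alF_congr hO hg l w hw).1, ?_⟩
    rw [WirtAlg.Q_Al, sub_val, mul_val, hQ z hzO, (Al_zero_on hO hQ l z hzO).1]
    simp
  · refine ⟨(WA n).swap.Al l g, O, hO, hzO, fun w hw => (alF_congr hO hg l w hw).2, ?_⟩
    rw [← WirtAlg.swap_Q, WirtAlg.Q_Al, WirtAlg.swap_Q, sub_val, mul_val, hQ z hzO,
      (Al_zero_on hO hQ l z hzO).2]
    simp

theorem fderiv_apply_eq (g : Sm n) (z v : En n) : fderiv ℝ g.1 z v =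
    ∑ l, (v l * dz l g z + starRingEnd ℂ (v l) * dzb l g z) := by
  have hv : v = ∑ l, ((v l).re • EuclideanSpace.single l (1 : ℂ) +
      (v l).im • EuclideanSpace.single l Complex.I) := by
    ext k
    simp only [WithLp.ofLp_sum, Finset.sum_apply, PiLp.add_apply, PiLp.smul_apply,
      PiLp.single_apply, Finset.sum_add_distrib, smul_ite, smul_zero, Finset.sum_ite_eq,
      Finset.mem_univ, if_true]
    simp [Complex.re_add_im]
  conv_lhs => rw [hv]
  rw [map_sum]
  refine Finset.sum_congr rfl fun l _ => ?_
  rw [map_add, map_smul, map_smul, dz_val, dzb_val, wd, wdb, Complex.real_smul, Complex.real_smul]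
  have h1 := Complex.re_add_im (v l)
  have h2 : starRingEnd ℂ (v l) = (v l).re - (v l).im * Complex.I := by
    apply Complex.ext <;> simp
  have hI := Complex.I_mul_I
  rw [h2]
  generalize fderiv ℝ g.1 z (EuclideanSpace.single l 1) = p
  generalize fderiv ℝ g.1 z (EuclideanSpace.single l Complex.I) = q
  conv_rhs => rw [show v l = (v l).re + (v l).im * Complex.I from h1.symm]
  simp only [Complex.add_re, Complex.add_im, Complex.mul_re, Complex.mul_im, Complex.ofReal_re,
    Complex.ofReal_im, Complex.I_re, Complex.I_im, mul_zero, mul_one, sub_zero, add_zero, zero_add]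
  linear_combination ((v l).im * q) * hI

theorem norm_coord_le {z : En n} (hz : ‖z‖ ≤ 1) (l : Fin n) : ‖z l‖ ≤ 1 :=
  (PiLp.norm_apply_le z l).trans hz

theorem norm_dz_le {g : Sm n} {z : En n} {M ρ : ℝ} (hρ : 0 < ρ)
    (hz : ρ ≤ 1 - ‖z‖ ^ 2) (hM : ∀ l, ‖(WA n).Al l g z‖ ≤ M ∧ ‖(WA n).swap.Al l g z‖ ≤ M)
    (l : Fin n) : ‖dz l g z‖ ≤ (1 + 2 * n / ρ) * M ∧ ‖dzb l g z‖ ≤ (1 + 2 * n / ρ) * M := by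
  have hz1 : ‖z‖ ≤ 1 := (norm_lt_one_of (hρ.trans_le hz)).le
  have ht0 : 0 ≤ ‖z‖ ^ 2 := sq_nonneg _
  have aux : ∀ (c : Fin n → ℂ) (a : Fin n → ℂ), (∀ l, ‖c l‖ ≤ 1) → (∀ l, ‖a l‖ ≤ M) →
      ‖∑ l, c l * a l‖ ≤ n * M := by
    intro c a hc ha
    refine (norm_sum_le_of_le _ fun l _ => ?_ : _ ≤ ∑ _l : Fin n, M).trans_eq (by simp)
    rw [norm_mul]
    exact (mul_le_mul (hc l) (ha l) (norm_nonneg _) zero_le_one).trans_eq (one_mul M)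
  have hc := norm_coord_le hz1
  have hc' : ∀ l, ‖starRingEnd ℂ (z l)‖ ≤ 1 := fun l => by simpa using hc l
  have bnd : ∀ (S : WirtAlg n (Sm n)) (hZ : ∀ l, ‖S.Z l z‖ ≤ 1) (hZb : ∀ l, ‖S.Zb l z‖ ≤ 1)
      (ht : S.t z = ((‖z‖ ^ 2 : ℝ) : ℂ))
      (hM : ∀ l, ‖S.Al l g z‖ ≤ M ∧ ‖S.swap.Al l g z‖ ≤ M), 
      ‖S.d l g z‖ ≤ (1 + 2 * n / ρ) * M := by
    intro S hZ hZb ht hM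
    have e1 : (((1 - ‖z‖ ^ 2) * (1 + ‖z‖ ^ 2) : ℝ) : ℂ) * S.Rb g z =
        ∑ l, S.Zb l z * S.swap.Al l g z + ((‖z‖ ^ 2 : ℝ) : ℂ) * ∑ l, S.Z l z * S.Al l g z := by
      have h : ∑ l, S.Z l * S.Al l g = S.R g - S.t * S.Rb g := by
        simp only [WirtAlg.Al_apply, mul_sub, Finset.sum_sub_distrib, ← WirtAlg.R_apply,
          WirtAlg.t, Finset.sum_mul, mul_assoc]
      have h' := S.sum_Al g
      rw [h, S.E_apply] at h'
      have h2 := congrArg (ev z) h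
      have h3 := congrArg (ev z) h'
      simp only [map_add, map_sub, map_mul, map_one, map_sum, ev_val, ht] at h2 h3
      rw [h2]
      push_cast at h3 ⊢
      linear_combination -h3
    have e2 := congrArg norm e1
    rw [norm_mul, Complex.norm_real, Real.norm_of_nonneg (by nlinarith)] at e2
    have e3 : (1 - ‖z‖ ^ 2) * (1 + ‖z‖ ^ 2) * ‖S.Rb g z‖ ≤ n * M + ‖z‖ ^ 2 * (n * M) := by
      rw [e2]
      refine (norm_add_le _ _).trans (add_le_add (aux _ _ hZb fun l => (hM l).2) ?_)
      rw [norm_mul, Complex.norm_real, Real.norm_of_nonneg ht0]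
      exact mul_le_mul_of_nonneg_left (aux _ _ hZ fun l => (hM l).1) ht0
    have e4 : ρ * ‖S.Rb g z‖ ≤ n * M := by
      have : 0 < 1 + ‖z‖ ^ 2 := by linarith
      have h5 : (1 - ‖z‖ ^ 2) * ‖S.Rb g z‖ ≤ n * M := by
        refine le_of_mul_le_mul_left ?_ this
        linarith
      exact (mul_le_mul_of_nonneg_right hz (norm_nonneg _)).trans h5
    have e5 : ‖S.Rb g z‖ ≤ n * M / ρ := by rwa [le_div_iff₀ hρ, mul_comm]
    have e6 : S.d l g z = S.Al l g z + S.Zb l z * S.Rb g z := by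
      rw [WirtAlg.Al_apply, sub_val, mul_val]; ring
    rw [e6]
    have e7 : 0 ≤ n * M / ρ := (norm_nonneg _).trans e5
    calc ‖S.Al l g z + S.Zb l z * S.Rb g z‖ ≤ M + 1 * (n * M / ρ) := by
          refine (norm_add_le _ _).trans (add_le_add (hM l).1 ?_)
          rw [norm_mul]
          exact mul_le_mul (hZb l) e5 (norm_nonneg _) zero_le_one
      _ ≤ M + 2 * (n * M / ρ) := by linarith
      _ = _ := by ring
  refine ⟨bnd (WA n) hc hc' (t_val z) hM, bnd (WA n).swap hc' hc ?_ fun l => (hM l).symm⟩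
  have : (WA n).swap.t = (WA n).t := Finset.sum_congr rfl fun j _ => mul_comm _ _
  rw [this, t_val]

/-- The sum of the squares of the tangential, radial and circular derivatives. -/
noncomputable def Pz (g : Sm n) (z : En n) : ℝ :=
  ∑ i, ‖(WA n).X i g z‖ ^ 2 + ‖(WA n).E g z‖ ^ 2 + ‖(WA n).T g z‖ ^ 2

theorem sq_norm_Al_le {g : Sm n} {z : En n} (hz1 : ‖z‖ ≤ 1) (hz : 1 / 9 ≤ ‖z‖ ^ 2) (l : Fin n) :
    ‖(WA n).Al l g z‖ ^ 2 ≤ 81 * (n + 2) ^ 2 * Pz g z ∧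
    ‖(WA n).swap.Al l g z‖ ^ 2 ≤ 81 * (n + 2) ^ 2 * Pz g z := by
  have hsX : ∀ i, ‖(WA n).X i g z‖ ^ 2 ≤ ∑ i, ‖(WA n).X i g z‖ ^ 2 := fun i =>
    Finset.single_le_sum (f := fun i => ‖(WA n).X i g z‖ ^ 2) (fun _ _ => sq_nonneg _)
      (Finset.mem_univ i)
  have hs0 : 0 ≤ ∑ i, ‖(WA n).X i g z‖ ^ 2 := Finset.sum_nonneg fun _ _ => sq_nonneg _
  have hP0 : 0 ≤ Pz g z := by unfold Pz; positivity
  have hX : ∀ i, ‖(WA n).X i g z‖ ≤ √(Pz g z) := fun i => Real.le_sqrt_of_sq_le <| by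
    unfold Pz; nlinarith [hsX i, sq_nonneg ‖(WA n).E g z‖, sq_nonneg ‖(WA n).T g z‖]
  have hE : ‖(WA n).E g z‖ ≤ √(Pz g z) := Real.le_sqrt_of_sq_le <| by
    unfold Pz; nlinarith [sq_nonneg ‖(WA n).T g z‖]
  have hT : ‖(WA n).T g z‖ ≤ √(Pz g z) := Real.le_sqrt_of_sq_le <| by
    unfold Pz; nlinarith [sq_nonneg ‖(WA n).E g z‖]
  have hR : ‖(WA n).R g z‖ ≤ √(Pz g z) ∧ ‖(WA n).Rb g z‖ ≤ √(Pz g z) := by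
    have h1 : (WA n).R g z = (1 / 2) * ((WA n).E g z + (WA n).T g z) := by
      rw [WirtAlg.E_apply, WirtAlg.T_apply, add_val, sub_val]; ring
    have h2 : (WA n).Rb g z = (1 / 2) * ((WA n).E g z - (WA n).T g z) := by
      rw [WirtAlg.E_apply, WirtAlg.T_apply, add_val, sub_val]; ring
    rw [h1, h2, norm_mul, norm_mul]
    have h3 := norm_add_le ((WA n).E g z) ((WA n).T g z)
    have h4 := norm_sub_le ((WA n).E g z) ((WA n).T g z)
    norm_num
    constructor <;> linarith
  have hc := norm_coord_le hz1
  have hc' : ∀ l, ‖starRingEnd ℂ (z l)‖ ≤ 1 := fun l => by simpa using hc l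
  have bnd : ∀ (S : WirtAlg n (Sm n)) (hZ : ∀ l, ‖S.Z l z‖ ≤ 1) (hZb : ∀ l, ‖S.Zb l z‖ ≤ 1)
      (ht : S.t z = ((‖z‖ ^ 2 : ℝ) : ℂ)) (hL : ∀ k, ‖S.L k l g z‖ ≤ √(Pz g z))
      (hR : ‖S.R g z‖ ≤ √(Pz g z)) (hRb : ‖S.Rb g z‖ ≤ √(Pz g z)), 
      ‖S.Al l g z‖ ^ 2 ≤ 81 * (n + 2) ^ 2 * Pz g z := by
    intro S hZ hZb ht hL hR hRb
    have h := congrArg (ev z) (S.t_d l g)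
    have e6 : S.d l g z = S.Al l g z + S.Zb l z * S.Rb g z := by
      rw [WirtAlg.Al_apply, sub_val, mul_val]; ring
    simp only [map_add, map_mul, map_sum, ev_val, ht, e6] at h
    have h1 : ((‖z‖ ^ 2 : ℝ) : ℂ) * S.Al l g z = ∑ k, S.Z k z * S.L k l g z + S.Zb l z * S.R g z -
        ((‖z‖ ^ 2 : ℝ) : ℂ) * S.Zb l z * S.Rb g z := by
      linear_combination h
    have ht1 : ‖z‖ ^ 2 ≤ 1 := by nlinarith [norm_nonneg z]
    have one : ∀ a b : ℂ, ‖a‖ ≤ 1 → ‖b‖ ≤ √(Pz g z) → ‖a * b‖ ≤ √(Pz g z) := fun a b ha hb => by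
      rw [norm_mul]
      exact (mul_le_mul ha hb (norm_nonneg _) zero_le_one).trans_eq (one_mul _)
    have h2 : ‖z‖ ^ 2 * ‖S.Al l g z‖ ≤ (n + 2) * √(Pz g z) := by
      have e2 := congrArg norm h1
      rw [norm_mul, Complex.norm_real, Real.norm_of_nonneg (sq_nonneg _)] at e2
      rw [e2]
      have s1 : ‖∑ k, S.Z k z * S.L k l g z‖ ≤ n * √(Pz g z) :=
        (norm_sum_le_of_le _ fun k _ => one _ _ (hZ k) (hL k) :
          _ ≤ ∑ _k : Fin n, √(Pz g z)).trans_eq (by simp)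
      have s2 := one _ _ (hZb l) hR
      have s3 := one (((‖z‖ ^ 2 : ℝ) : ℂ) * S.Zb l z) _ (by
        rw [norm_mul, Complex.norm_real, Real.norm_of_nonneg (sq_nonneg _)]
        exact mul_le_one₀ ht1 (norm_nonneg _) (hZb l)) hRb
      have := norm_sub_le (∑ k, S.Z k z * S.L k l g z + S.Zb l z * S.R g z)
        (((‖z‖ ^ 2 : ℝ) : ℂ) * S.Zb l z * S.Rb g z)
      have := norm_add_le (∑ k, S.Z k z * S.L k l g z) (S.Zb l z * S.R g z)
      linarith
    have h3 : ‖S.Al l g z‖ ≤ 9 * ((n + 2) * √(Pz g z)) := by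
      nlinarith [norm_nonneg (S.Al l g z)]
    calc ‖S.Al l g z‖ ^ 2 ≤ (9 * ((n + 2) * √(Pz g z))) ^ 2 :=
          pow_le_pow_left₀ (norm_nonneg _) h3 2
      _ = 81 * (n + 2) ^ 2 * √(Pz g z) ^ 2 := by ring
      _ = _ := by rw [Real.sq_sqrt hP0]
  have hswap : (WA n).swap.t = (WA n).t := Finset.sum_congr rfl fun j _ => mul_comm _ _
  exact ⟨bnd (WA n) hc hc' (t_val z) (fun k => hX (Sum.inl (k, l))) hR.1 hR.2,
    bnd (WA n).swap hc' hc (by rw [hswap, t_val]) (fun k => hX (Sum.inr (k, l))) hR.2 hR.1⟩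

theorem integrableOn_sq (g : Sm n) {A : Set (En n)} (hA : IsCompact A) :
    IntegrableOn (fun z => ‖g z‖ ^ 2) A (volume : Measure (En n)) :=
  ((cont g).norm.pow 2).continuousOn.integrableOn_compact hA

theorem intK_re (a : Sm n) (δ : ℝ) :
    IntegrableOn (fun z => (a z).re) (Kset n δ) (volume : Measure (En n)) := (intK a δ).re

theorem mul_setIntegral_le_jn {A : Set (En n)} (hA : IsCompact A) (hAK : A ⊆ Kset n δ) {W : Sm n}
    {w : ℝ} (hW : ∀ z ∈ Kset n δ, 0 ≤ (W z).re) (hw : ∀ z ∈ A, w ≤ (W z).re) (g : Sm n) :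
    w * ∫ z in A, ‖g z‖ ^ 2 ≤ jn δ W g := by
  have h1 : jn δ W g = ∫ z in Kset n δ, ((W * (WI n δ).N2 g) z).re := J_val δ _
  have h2 : IntegrableOn (fun z => ((W * (WI n δ).N2 g) z).re) (Kset n δ) volume :=
    intK_re (W * (WI n δ).N2 g) δ
  rw [h1, ← integral_const_mul]
  refine (setIntegral_mono_on ((integrableOn_sq g hA).const_mul w) (h2.mono_set hAK)
    hA.measurableSet fun z hz => ?_).trans
    (setIntegral_mono_set h2 ?_ (Filter.Eventually.of_forall hAK))
  · rw [re_mul_N2]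
    exact mul_le_mul_of_nonneg_right (hw z hz) (sq_nonneg _)
  · refine (ae_restrict_iff' (isClosed_Kset δ).measurableSet).2
      (Filter.Eventually.of_forall fun z hz => ?_)
    change 0 ≤ ((W * (WI n δ).N2 g) z).re
    rw [re_mul_N2]
    exact mul_nonneg (hW z hz) (sq_nonneg _)

theorem continuous_Pz (g : Sm n) : Continuous (Pz g) := by
  unfold Pz
  exact ((continuous_finsetSum _ fun i _ => (cont _).norm.pow 2).add ((cont _).norm.pow 2)).add
    ((cont _).norm.pow 2)

theorem integral_Pz_le (hn : 2 ≤ n) {b d : ℝ} (hb : 0 < b) (hd : 0 < d) :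
    ∃ C, 0 ≤ C ∧ ∀ δ (hδ : 0 < δ) (g : Sm n), 2 * δ ≤ d → Eig δ 0 g →
      ∫ z in Ann n d, Pz g z ≤ C * ∑ i, Ai b hδ ((WA n).X i g) := by
  obtain ⟨C₁, hC₁, h₁⟩ := E_le hn (b := b + 1) (by linarith) 0
  obtain ⟨C₂, hC₂, h₂⟩ := T_le hn (b + 1) Cut.std std_nonneg' 0
  simp only [add_sub_cancel_right] at h₁ h₂
  have hw : 0 < d ^ b := Real.rpow_pos_of_pos hd _
  have hw1 : 0 < d ^ (b + 1) := Real.rpow_pos_of_pos hd _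
  refine ⟨1 / d ^ b + 9 / d ^ (b + 1) * C₁ + 1 / d ^ (b + 1) * C₂, by positivity,
    fun δ hδ g hδd hg => ?_⟩
  have hAK : Ann n d ⊆ Kset n δ := fun z hz => by
    have : d ≤ 1 - ‖z‖ ^ 2 := hz.2
    exact mem_K.2 (by linarith)
  have hstd : ∀ z ∈ Ann n d, Cut.std.f ((1 - ‖z‖ ^ 2) / δ) = 1 := fun z hz => by
    have : d ≤ 1 - ‖z‖ ^ 2 := hz.2
    exact Cut.std_eq_one (by rw [le_div_iff₀ hδ]; linarith)
  have hX : ∀ i, d ^ b * ∫ z in Ann n d, ‖(WA n).X i g z‖ ^ 2 ≤ Ai b hδ ((WA n).X i g) := fun i =>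
    mul_setIntegral_le_jn (isCompact_Ann d) hAK
      (fun z hz => by rw [wA_re b hδ hz]; exact Real.rpow_nonneg (hδ.le.trans hz) b)
      (fun z hz => by
        rw [wA_re b hδ (hAK hz)]; exact Real.rpow_le_rpow hd.le hz.2 hb.le) _
  have hT : d ^ (b + 1) * ∫ z in Ann n d, ‖(WA n).T g z‖ ^ 2 ≤
      jn δ (wt (b + 1) Cut.std hδ) ((WA n).T g) :=
    mul_setIntegral_le_jn (isCompact_Ann d) hAK
      (fun z hz => by rw [wt_re]; exact wt_nonneg _ std_nonneg' hδ hz)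
      (fun z hz => by
        rw [wt_re, hstd z hz, mul_one]
        exact Real.rpow_le_rpow hd.le hz.2 (by linarith)) _
  have htw : ∀ z : En n, (((WA n).t * wt (b + 1) Cut.std hδ : Sm n) z).re = ‖z‖ ^ 2 *
      ((1 - ‖z‖ ^ 2) ^ (b + 1) * Cut.std.f ((1 - ‖z‖ ^ 2) / δ)) := fun z => by
    rw [mul_val, t_val, Complex.re_ofReal_mul, wt_re]
  have hE : d ^ (b + 1) / 9 * ∫ z in Ann n d, ‖(WA n).E g z‖ ^ 2 ≤
      jn δ ((WA n).t * wt (b + 1) Cut.std hδ) ((WA n).E g) :=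
    mul_setIntegral_le_jn (isCompact_Ann d) hAK
      (fun z hz => by
        rw [htw]; exact mul_nonneg (sq_nonneg _) (wt_nonneg _ std_nonneg' hδ hz))
      (fun z hz => by
        rw [htw, hstd z hz, mul_one, div_eq_mul_one_div, mul_comm]
        exact mul_le_mul hz.1 (Real.rpow_le_rpow hd.le hz.2 (by linarith)) hw1.le (sq_nonneg _)) _
  have h3 := h₁ δ hδ 0 g (by simp) hg
  have h4 := h₂ δ hδ 0 g (by simp) hg
  have e : ∫ z in Ann n d, Pz g z = ∑ i, (∫ z in Ann n d, ‖(WA n).X i g z‖ ^ 2) +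
      (∫ z in Ann n d, ‖(WA n).E g z‖ ^ 2) + ∫ z in Ann n d, ‖(WA n).T g z‖ ^ 2 := by
    have iX := fun i => integrableOn_sq ((WA n).X i g) (isCompact_Ann (n := n) d)
    have iE := integrableOn_sq ((WA n).E g) (isCompact_Ann (n := n) d)
    have iT := integrableOn_sq ((WA n).T g) (isCompact_Ann (n := n) d)
    have iS : IntegrableOn (fun z => ∑ i, ‖(WA n).X i g z‖ ^ 2) (Ann n d)
      (volume : Measure (En n)) := integrable_finsetSum _ fun i _ => iX i
    have iSE : IntegrableOn (fun z => ∑ i, ‖(WA n).X i g z‖ ^ 2 + ‖(WA n).E g z‖ ^ 2) (Ann n d)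
      (volume : Measure (En n)) := iS.add iE
    rw [← integral_finsetSum _ fun i _ => iX i, ← integral_add iS iE, ← integral_add iSE iT]
    rfl
  have sX : ∑ i, ∫ z in Ann n d, ‖(WA n).X i g z‖ ^ 2 ≤
      1 / d ^ b * ∑ i, Ai b hδ ((WA n).X i g) := by
    rw [Finset.mul_sum]
    refine Finset.sum_le_sum fun i _ => ?_
    rw [one_div_mul_eq_div, le_div_iff₀ hw, mul_comm]
    exact hX i
  have sE : ∫ z in Ann n d, ‖(WA n).E g z‖ ^ 2 ≤
      9 / d ^ (b + 1) * (C₁ * ∑ i, Ai b hδ ((WA n).X i g)) := by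
    rw [div_mul_eq_mul_div, le_div_iff₀ hw1]
    simp only [Int.cast_zero] at h3
    linarith
  have sT : ∫ z in Ann n d, ‖(WA n).T g z‖ ^ 2 ≤
      1 / d ^ (b + 1) * (C₂ * ∑ i, Ai b hδ ((WA n).X i g)) := by
    rw [one_div_mul_eq_div, le_div_iff₀ hw1, mul_comm]
    exact hT.trans h4
  rw [e]
  linarith

theorem MHarm.eig {m : ℕ∞} {f : En n → ℂ} (hf : MHarm n m f) (hδ : 0 < δ) {g : Sm n}
    (hg : ∀ z, δ / 2 ≤ 1 - ‖z‖ ^ 2 → g z = f z) : Eig δ 0 g := fun z hz => by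
  rw [MHarm.Q_eq_zero hf (isOpen_Oset _) (Oset_subset_ball (half_pos hδ).le)
    (fun w hw => hg w (le_of_lt hw)) z hz]
  simp

/-- Interior estimate of the oscillation by the tangential derivatives. -/
theorem sq_sub_le (hn : 2 ≤ n) {b ρ : ℝ} (hb : 0 < b) (hρ : 0 < ρ) (hρ1 : ρ ≤ 1) :
    ∃ C δ₀ : ℝ, 0 ≤ C ∧ 0 < δ₀ ∧ ∀ f : En n → ℂ, MHarm n 2 f → ∀ δ (hδ : 0 < δ) (g : Sm n),
      δ ≤ δ₀ → (∀ z, δ / 2 ≤ 1 - ‖z‖ ^ 2 → g z = f z) → ∀ p, ρ ≤ 1 - ‖p‖ ^ 2 →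
      ‖g p - g 0‖ ^ 2 ≤ C * ∑ i, Ai b hδ ((WA n).X i g) := by
  set r := √(1 - ρ) with hr
  have hr0 : 0 ≤ r := Real.sqrt_nonneg _
  have hr2 : r ^ 2 = 1 - ρ := Real.sq_sqrt (by linarith)
  have hr1 : r < 1 := by nlinarith
  obtain ⟨C₁, d, hC₁, hd, h₁⟩ := exists_pointwise_bound (n := n) (by omega) hr0 hr1
  obtain ⟨C₂, hC₂, h₂⟩ := integral_Pz_le hn hb hd
  set K := C₁ * (81 * (n + 2) ^ 2 * C₂) with hK
  have hK0 : 0 ≤ K := by positivity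
  set L := n * (2 * (1 + 2 * n / ρ)) with hL
  have hL0 : 0 ≤ L := by positivity
  refine ⟨L ^ 2 * K, min d ρ / 2, by positivity, by positivity, fun f hf δ hδ g hδ₀ hg p hp => ?_⟩
  have hδd : 2 * δ ≤ d := by linarith [min_le_left d ρ]
  have hδρ : 2 * δ ≤ ρ := by linarith [min_le_right d ρ]
  have hgE := MHarm.eig hf hδ hg
  have hgO : ∀ z ∈ Oset n (δ / 2), g z = f z := fun z hz => hg z (le_of_lt hz)
  set I := ∑ i, Ai b hδ ((WA n).X i g)
  have hI : 0 ≤ I := Finset.sum_nonneg fun i _ => Ai_nonneg b hδ _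
  have hAO : Ann n d ⊆ Oset n (δ / 2) := fun z hz => by
    have h1 : d ≤ 1 - ‖z‖ ^ 2 := hz.2
    change δ / 2 < 1 - ‖z‖ ^ 2
    linarith
  have hq2 : ∀ q : En n, ‖q‖ ≤ r → ρ ≤ 1 - ‖q‖ ^ 2 := fun q hq => by
    have := pow_le_pow_left₀ (norm_nonneg q) hq 2
    linarith
  have hAl : ∀ (F : En n → ℂ) (a : Sm n), MHarm n 2 F → (∀ z ∈ Oset n (δ / 2), a z = F z) →
      (∀ z ∈ Ann n d, ‖a z‖ ^ 2 ≤ 81 * (n + 2) ^ 2 * Pz g z) → ∀ q : En n, ‖q‖ ≤ r →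
      ‖a q‖ ≤ √(K * I) := by
    intro F a hF ha hle q hq
    refine Real.le_sqrt_of_sq_le ?_
    have hqO : q ∈ Oset n (δ / 2) := by
      have := hq2 q hq
      change δ / 2 < 1 - ‖q‖ ^ 2
      linarith
    rw [ha q hqO]
    have e : ∫ z in Ann n d, ‖F z‖ ^ 2 = ∫ z in Ann n d, ‖a z‖ ^ 2 :=
      setIntegral_congr_fun (isCompact_Ann d).measurableSet fun z hz => by
        rw [ha z (hAO hz)]
    have h3 : ∫ z in Ann n d, ‖a z‖ ^ 2 ≤ 81 * (n + 2) ^ 2 * ∫ z in Ann n d, Pz g z := by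
      rw [← integral_const_mul]
      exact setIntegral_mono_on (integrableOn_sq a (isCompact_Ann d))
        (((continuous_Pz g).continuousOn.integrableOn_compact (isCompact_Ann d)).const_mul _)
        (isCompact_Ann d).measurableSet hle
    calc ‖F q‖ ^ 2 ≤ C₁ * ∫ z in Ann n d, ‖F z‖ ^ 2 := h₁ F hF q hq
      _ ≤ C₁ * (81 * (n + 2) ^ 2 * (C₂ * I)) := by
        rw [e]
        refine mul_le_mul_of_nonneg_left (h3.trans ?_) hC₁
        exact mul_le_mul_of_nonneg_left (h₂ δ hδ g hδd hgE) (by positivity)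
      _ = K * I := by rw [hK]; ring
  have hz1 : ∀ z ∈ Ann n d, ‖z‖ ≤ 1 := fun z hz => (norm_lt_one_of (hd.trans_le hz.2)).le
  have hM : ∀ q : En n, ‖q‖ ≤ r → ∀ l, ‖(WA n).Al l g q‖ ≤ √(K * I) ∧
      ‖(WA n).swap.Al l g q‖ ≤ √(K * I) := fun q hq l =>
    ⟨hAl _ _ (mharm_alF (by omega) hf l).1 (fun z hz => (alF_congr (isOpen_Oset _) hgO l z hz).1)
      (fun z hz => (sq_norm_Al_le (hz1 z hz) hz.1 l).1) q hq,
    hAl _ _ (mharm_alF (by omega) hf l).2 (fun z hz => (alF_congr (isOpen_Oset _) hgO l z hz).2)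
      (fun z hz => (sq_norm_Al_le (hz1 z hz) hz.1 l).2) q hq⟩
  have hD : ∀ q ∈ Metric.closedBall (0 : En n) r, ‖fderiv ℝ g.1 q‖ ≤ L * √(K * I) := by
    intro q hq
    have hq := mem_closedBall_zero_iff.1 hq
    refine ContinuousLinearMap.opNorm_le_bound _ (by positivity) fun v => ?_
    rw [fderiv_apply_eq]
    have h4 := norm_dz_le hρ (hq2 q hq) (hM q hq)
    refine (norm_sum_le_of_le _ fun l _ => ?_ :
      _ ≤ ∑ _l : Fin n, ‖v‖ * (2 * ((1 + 2 * n / ρ) * √(K * I)))).trans_eq ?_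
    · have hv := PiLp.norm_apply_le v l
      have hv' : ‖starRingEnd ℂ (v l)‖ ≤ ‖v‖ := by simpa using hv
      refine (norm_add_le _ _).trans ?_
      rw [norm_mul, norm_mul]
      have h5 := mul_le_mul hv (h4 l).1 (norm_nonneg _) (norm_nonneg v)
      have h6 := mul_le_mul hv' (h4 l).2 (norm_nonneg _) (norm_nonneg v)
      linarith
    · rw [Finset.sum_const, Finset.card_univ, Fintype.card_fin, nsmul_eq_mul, hL]
      ring
  have hpr : ‖p‖ ≤ r := Real.le_sqrt_of_sq_le (by linarith)
  have h7 : ‖g p - g 0‖ ≤ L * √(K * I) * ‖p - 0‖ :=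
    (convex_closedBall (0 : En n) r).norm_image_sub_le_of_norm_fderiv_le
      (fun q _ => diff g q) hD (Metric.mem_closedBall_self hr0) (mem_closedBall_zero_iff.2 hpr)
  have h8 : ‖g p - g 0‖ ≤ L * √(K * I) := by
    refine h7.trans (mul_le_of_le_one_right (by positivity) ?_)
    rw [sub_zero]; linarith
  calc ‖g p - g 0‖ ^ 2 ≤ (L * √(K * I)) ^ 2 := pow_le_pow_left₀ (norm_nonneg _) h8 2
    _ = L ^ 2 * K * I := by rw [mul_pow, Real.sq_sqrt (by positivity)]; ring

theorem lower_of_zero (hn : 2 ≤ n) {b : ℝ} (hb : 0 < b) :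
    ∃ C δ₀ : ℝ, 0 ≤ C ∧ 0 < δ₀ ∧ ∀ f : En n → ℂ, MHarm n 2 f → f 0 = 0 →
      ∀ δ (hδ : 0 < δ) (g : Sm n), δ ≤ δ₀ → (∀ z, δ / 2 ≤ 1 - ‖z‖ ^ 2 → g z = f z) →
      jn δ (wt (b - 1) Cut.std hδ) g ≤ C * ∑ i, Ai b hδ ((WA n).X i g) := by
  obtain ⟨C₀, hC₀, h₀⟩ := lower_zero hn hb
  set ρ := 1 / (2 * (C₀ + 1)) with hρ
  have hρ0 : 0 < ρ := by positivity
  have hρC : C₀ * ρ ≤ 1 / 2 := by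
    rw [hρ, mul_one_div, div_le_div_iff₀ (by positivity) (by norm_num)]; linarith
  have hρ1 : ρ ≤ 1 := by
    rw [hρ, div_le_one (by positivity)]; linarith
  obtain ⟨C₁, δ₀, hC₁, hδ₀, h₁⟩ := sq_sub_le hn hb hρ0 hρ1
  set V := (volume : Measure (En n)).real (Kset n 0) with hV
  refine ⟨2 * C₀ * (V * C₁ + 1), min δ₀ 1, by positivity, by positivity,
    fun f hf hf0 δ hδ g hδδ hg => ?_⟩
  have hg0 : g 0 = 0 := by
    rw [hg 0 (by simp; linarith [min_le_right δ₀ 1]), hf0]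
  set I := ∑ i, Ai b hδ ((WA n).X i g)
  have hI : 0 ≤ I := Finset.sum_nonneg fun i _ => Ai_nonneg b hδ _
  have h2 := h₀ δ hδ g (MHarm.eig hf hδ hg)
  have h3 := fun p => h₁ f hf δ hδ g (hδδ.trans (min_le_left _ _)) hg p
  simp only [hg0, sub_zero] at h3
  have h4 : jn δ (wt b Cut.std hδ) g ≤ ρ * jn δ (wt (b - 1) Cut.std hδ) g + V * (C₁ * I) := by
    have e : ρ * jn δ (wt (b - 1) Cut.std hδ) g = (WI n δ).J ((ρ : ℂ) •
        (wt (b - 1) Cut.std hδ * (WI n δ).N2 g)) := (J_smul δ ρ _).symm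
    have i1 : IntegrableOn (fun z => (((ρ : ℂ) • (wt (b - 1) Cut.std hδ * (WI n δ).N2 g) : Sm n) z).re)
      (Kset n δ) (volume : Measure (En n)) :=
      intK_re ((ρ : ℂ) • (wt (b - 1) Cut.std hδ * (WI n δ).N2 g)) δ
    have i2 : IntegrableOn (fun _ : En n => C₁ * I) (Kset n δ) (volume : Measure (En n)) :=
      continuousOn_const.integrableOn_compact (isCompact_Kset δ)
    have e2 : jn δ (wt b Cut.std hδ) g = ∫ z in Kset n δ,
      ((wt b Cut.std hδ * (WI n δ).N2 g : Sm n) z).re := J_val δ _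
    have h5 : jn δ (wt b Cut.std hδ) g ≤ ρ * jn δ (wt (b - 1) Cut.std hδ) g +
        ∫ z in Kset n δ, C₁ * I := by
      rw [e, J_val, ← integral_add i1 i2, e2]
      refine setIntegral_mono_on (intK_re (wt b Cut.std hδ * (WI n δ).N2 g) δ) (i1.add i2)
        (isClosed_Kset δ).measurableSet fun z hz => ?_
      have hz0 : 0 < 1 - ‖z‖ ^ 2 := hδ.trans_le hz
      have hz1 : 1 - ‖z‖ ^ 2 ≤ 1 := by linarith [sq_nonneg ‖z‖]
      rw [re_mul_N2, wt_re, smul_val, Complex.re_ofReal_mul, re_mul_N2, wt_re]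
      have hs0 := std_nonneg' ((1 - ‖z‖ ^ 2) / δ) (by positivity)
      have hs1 := Cut.std_le_one ((1 - ‖z‖ ^ 2) / δ)
      have hp0 : 0 ≤ (1 - ‖z‖ ^ 2) ^ (b - 1) := Real.rpow_nonneg hz0.le _
      have hpb : (1 - ‖z‖ ^ 2) ^ b = (1 - ‖z‖ ^ 2) * (1 - ‖z‖ ^ 2) ^ (b - 1) := by
        rw [← Real.rpow_one_add' hz0.le (by linarith)]; congr 1; ring
      rcases lt_or_ge (1 - ‖z‖ ^ 2) ρ with h6 | h6
      · have : 0 ≤ (1 - ‖z‖ ^ 2) ^ (b - 1) * Cut.std.f ((1 - ‖z‖ ^ 2) / δ) * ‖g z‖ ^ 2 := by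
          positivity
        have h8 := mul_le_mul_of_nonneg_right h6.le this
        have h9 : 0 ≤ C₁ * I := by positivity
        rw [hpb]
        linarith
      · have h7 := h3 z h6
        have h8 : (1 - ‖z‖ ^ 2) ^ b * Cut.std.f ((1 - ‖z‖ ^ 2) / δ) ≤ 1 :=
          mul_le_one₀ (Real.rpow_le_one hz0.le hz1 hb.le) hs0 hs1
        have h9 := mul_le_mul_of_nonneg_right h8 (sq_nonneg ‖g z‖)
        have : 0 ≤ ρ * ((1 - ‖z‖ ^ 2) ^ (b - 1) * Cut.std.f ((1 - ‖z‖ ^ 2) / δ) * ‖g z‖ ^ 2) := by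
          positivity
        linarith
    refine h5.trans (add_le_add le_rfl ?_)
    rw [setIntegral_const, smul_eq_mul]
    refine mul_le_mul_of_nonneg_right ?_ (by positivity)
    exact measureReal_mono (fun z (hz : δ ≤ 1 - ‖z‖ ^ 2) => mem_K.2 (hδ.le.trans hz))
      (isCompact_Kset 0).measure_lt_top.ne
  have hj := jn_wt_nonneg (n := n) (b - 1) std_nonneg' hδ g
  have h10 := mul_le_mul_of_nonneg_left h4 hC₀
  have h11 := mul_le_mul_of_nonneg_right hρC hj
  linarith

/-- The weighted `L²` norm on the ball, without normalization. -/
noncomputable def JE (n : ℕ) (b : ℝ) (f : En n → ℂ) : ℝ≥0∞ :=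
  ∫⁻ z in Metric.ball (0 : En n) 1, ENNReal.ofReal ((1 - ‖z‖ ^ 2) ^ b * ‖f z‖ ^ 2)

theorem Kset_subset_Oset (hδ : 0 < δ) : Kset n δ ⊆ Oset n (δ / 2) := fun z hz => by
  change δ / 2 < 1 - ‖z‖ ^ 2
  linarith [mem_K.1 hz]

theorem ofReal_jn {W g : Sm n} (hW : ∀ z ∈ Kset n δ, 0 ≤ (W z).re) :
    ENNReal.ofReal (jn δ W g) = ∫⁻ z in Kset n δ, ENNReal.ofReal ((W z).re * ‖g z‖ ^ 2) := by
  have h1 : jn δ W g = ∫ z in Kset n δ, ((W * (WI n δ).N2 g) z).re := J_val δ _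
  rw [h1, ofReal_integral_eq_lintegral_ofReal (intK_re (W * (WI n δ).N2 g) δ)]
  · simp only [re_mul_N2]
  · refine (ae_restrict_iff' (isClosed_Kset δ).measurableSet).2
      (Filter.Eventually.of_forall fun z hz => ?_)
    change 0 ≤ ((W * (WI n δ).N2 g) z).re
    rw [re_mul_N2]
    exact mul_nonneg (hW z hz) (sq_nonneg _)

theorem ofReal_Ai_le (b : ℝ) (hδ : 0 < δ) {g : Sm n} {F : En n → ℂ}
    (hg : ∀ z ∈ Oset n (δ / 2), g z = F z) : ENNReal.ofReal (Ai b hδ g) ≤ JE n b F := by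
  rw [Ai_eq, ofReal_jn fun z hz => by
    rw [wA_re b hδ hz]; exact Real.rpow_nonneg (hδ.le.trans hz) b]
  refine (setLIntegral_mono' (isClosed_Kset δ).measurableSet fun z hz => ?_).trans
    (lintegral_mono_set fun z hz => mem_ball_iff.2 (hδ.trans_le (mem_K.1 hz)))
  rw [wA_re b hδ hz, hg z (Kset_subset_Oset hδ hz)]

theorem JE_le {b δ₀ : ℝ} {F : En n → ℂ} {B : ℝ≥0∞} (hδ₀ : 0 < δ₀)
    (h : ∀ δ (hδ : 0 < δ), δ ≤ δ₀ → ∃ g : Sm n, (∀ z ∈ Oset n (δ / 2), g z = F z) ∧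
      ENNReal.ofReal (jn δ (wt b Cut.std hδ) g) ≤ B) : JE n b F ≤ B := by
  have hball : Metric.ball (0 : En n) 1 = ⋃ k : ℕ, Kset n (1 / (k + 1)) := by
    ext z
    rw [mem_ball_iff, Set.mem_iUnion]
    constructor
    · intro hz
      obtain ⟨k, hk⟩ := exists_nat_one_div_lt hz
      exact ⟨k, hk.le⟩
    · rintro ⟨k, hk⟩
      exact lt_of_lt_of_le (by positivity) (mem_K.1 hk)
  rw [JE, hball, setLIntegral_iUnion_of_directed]
  · refine iSup_le fun k => ?_
    have hε : (0 : ℝ) < 1 / (k + 1) := by positivity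
    set ε : ℝ := 1 / (k + 1)
    have hδ : 0 < min δ₀ (ε / 2) := lt_min hδ₀ (by linarith)
    obtain ⟨g, hg, hB⟩ := h _ hδ (min_le_left _ _)
    refine le_trans ?_ hB
    have hδε : min δ₀ (ε / 2) ≤ ε / 2 := min_le_right _ _
    generalize min δ₀ (ε / 2) = δ at hδ hg hδε
    rw [ofReal_jn fun z hz => by rw [wt_re]; exact wt_nonneg _ std_nonneg' hδ hz]
    have hsub : Kset n ε ⊆ Kset n δ := fun z hz => mem_K.2 (by linarith [mem_K.1 hz])
    refine (setLIntegral_mono' (isClosed_Kset ε).measurableSet fun z hz => ?_).trans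
      (lintegral_mono_set hsub)
    have : Cut.std.f ((1 - ‖z‖ ^ 2) / δ) = 1 :=
      Cut.std_eq_one (by rw [le_div_iff₀ hδ]; linarith [mem_K.1 hz])
    rw [wt_re, this, mul_one, hg z (Kset_subset_Oset hδ (hsub hz))]
  · refine Monotone.directed_le fun k l hkl z hz => mem_K.2 (le_trans ?_ (mem_K.1 hz))
    have : (k : ℝ) ≤ l := by exact_mod_cast hkl
    gcongr

/-- Functions on the ball in the range of the eigenvalue equation of weight `k`. -/
def Good (n : ℕ) (k : ℤ) (F : En n → ℂ) : Prop :=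
  ∀ δ : ℝ, 0 < δ → ∃ g : Sm n, (∀ z ∈ Oset n (δ / 2), g z = F z) ∧ Eig δ k g

theorem X_congr {F : En n → ℂ} {g : Sm n} {O : Set (En n)} (hO : IsOpen O)
    (h : ∀ z ∈ O, g z = F z) (i : iotaX n) : ∀ z ∈ O, (WA n).X i g z = Xop n i F z := by
  intro z hz
  have := fun k => wd_congr k hO h z hz
  rcases i with ⟨j, k⟩ | ⟨j, k⟩
  · change starRingEnd ℂ (z j) * wd n k g.1 z - starRingEnd ℂ (z k) * wd n j g.1 z = _
    rw [(this j).1, (this k).1]; rfl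
  · change z j * wdb n k g.1 z - z k * wdb n j g.1 z = _
    rw [(this j).2, (this k).2]; rfl

theorem Good.X {k : ℤ} {F : En n → ℂ} (h : Good n k F) (i : iotaX n) :
    Good n (k + WirtAlg.sg i) (Xop n i F) := fun δ hδ => by
  obtain ⟨g, hg, hE⟩ := h δ hδ
  exact ⟨(WA n).X i g, X_congr (isOpen_Oset _) hg i, hE.X i⟩

theorem exists_lift_eig (hn : 1 ≤ n) {f : En n → ℂ} (hf : MHarm n 2 f) (hδ : 0 < δ) :
    ∃ g : Sm n, (∀ z, δ / 2 ≤ 1 - ‖z‖ ^ 2 → g z = f z) ∧ Eig δ 0 g := by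
  obtain ⟨g, hg⟩ := exists_lift (MHarm.contDiffOn_top hn hf) (half_pos hδ)
  exact ⟨g, hg, MHarm.eig hf hδ hg⟩

theorem MHarm.good (hn : 1 ≤ n) {f : En n → ℂ} (hf : MHarm n 2 f) : Good n 0 f := fun δ hδ => by
  obtain ⟨g, hg, hE⟩ := exists_lift_eig hn hf hδ
  exact ⟨g, fun z hz => hg z (le_of_lt hz), hE⟩

theorem JE_X_le (b : ℝ) (M : ℕ) : ∃ C : ℝ≥0, ∀ k F, |k| ≤ (M : ℤ) → Good n k F → ∀ i,
    JE n (b + 1) (Xop n i F) ≤ C * JE n b F := by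
  obtain ⟨C, hC, h⟩ := energy_le (n := n) (b + 1) Cut.std std_nonneg' M
  rw [add_sub_cancel_right] at h
  refine ⟨C.toNNReal, fun k F hk hF i => JE_le one_pos fun δ hδ _ => ?_⟩
  obtain ⟨g, hg, hE⟩ := hF δ hδ
  refine ⟨(WA n).X i g, X_congr (isOpen_Oset _) hg i, ?_⟩
  have h1 := h δ hδ k g hk hE
  have h2 : jn δ (wt (b + 1) Cut.std hδ) ((WA n).X i g) ≤ C * Ai b hδ g := by
    have h3 := Finset.single_le_sum (f := fun i => jn δ (wt (b + 1) Cut.std hδ) ((WA n).X i g))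
      (fun i _ => jn_wt_nonneg (b + 1) std_nonneg' hδ _) (Finset.mem_univ i)
    have h4 := jn_wt_nonneg (b + 1 + 1) std_nonneg' hδ ((WA n).E g)
    have h5 := jn_wt_nonneg (b + 1 + 1) std_nonneg' hδ ((WA n).T g)
    linarith
  refine (ENNReal.ofReal_le_ofReal h2).trans ?_
  rw [ENNReal.ofReal_mul hC]
  exact mul_le_mul_right (ofReal_Ai_le b hδ hg) _

theorem JE_le_X (hn : 2 ≤ n) {b : ℝ} (hb : 0 < b) (M : ℕ) : ∃ C : ℝ≥0, ∀ k F, |k| ≤ (M : ℤ) →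
    Good n k F → ∀ i, JE n (b - 1) (Xop n i F) ≤
      C * ∑ j, ∑ l, JE n b (Xop n l (Xop n j F)) := by
  obtain ⟨C, hC, h⟩ := lower_X hn hb M
  refine ⟨C.toNNReal, fun k F hk hF i => JE_le one_pos fun δ hδ _ => ?_⟩
  obtain ⟨g, hg, hE⟩ := hF δ hδ
  have hX := fun i => X_congr (isOpen_Oset _) hg i
  refine ⟨(WA n).X i g, hX i, ?_⟩
  refine (ENNReal.ofReal_le_ofReal (h δ hδ k g hk hE i)).trans ?_
  rw [ENNReal.ofReal_mul hC, ENNReal.ofReal_sum_of_nonneg fun j _ =>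
    Finset.sum_nonneg fun l _ => Ai_nonneg b hδ _]
  refine mul_le_mul_right (Finset.sum_le_sum fun j _ => ?_) _
  rw [ENNReal.ofReal_sum_of_nonneg fun l _ => Ai_nonneg b hδ _]
  exact Finset.sum_le_sum fun l _ => ofReal_Ai_le b hδ (X_congr (isOpen_Oset _) (hX j) l)

theorem JE_le_of_zero (hn : 2 ≤ n) {b : ℝ} (hb : 0 < b) : ∃ C : ℝ≥0, ∀ f, MHarm n 2 f → f 0 = 0 →
    JE n (b - 1) f ≤ C * ∑ i, JE n b (Xop n i f) := by
  obtain ⟨C, δ₀, hC, hδ₀, h⟩ := lower_of_zero hn hb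
  refine ⟨C.toNNReal, fun f hf hf0 => JE_le hδ₀ fun δ hδ hδδ => ?_⟩
  obtain ⟨g, hg, -⟩ := exists_lift_eig (by omega) hf hδ
  have hg' : ∀ z ∈ Oset n (δ / 2), g z = f z := fun z hz => hg z (le_of_lt hz)
  refine ⟨g, hg', ?_⟩
  refine (ENNReal.ofReal_le_ofReal (h f hf hf0 δ hδ g hδδ hg)).trans ?_
  rw [ENNReal.ofReal_mul hC, ENNReal.ofReal_sum_of_nonneg fun i _ => Ai_nonneg b hδ _]
  exact mul_le_mul_right (Finset.sum_le_sum fun i _ =>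
    ofReal_Ai_le b hδ (X_congr (isOpen_Oset _) hg' i)) _

theorem JE_one_lt_top {s : ℝ} (hs : -1 < s) : JE n s (fun _ => 1) < ⊤ := by
  have hb : 0 < s + 1 := by linarith
  set V := (volume : Measure (En n)).real (Kset n 0) with hV
  refine lt_of_le_of_lt (JE_le (B := ENNReal.ofReal
    ((3 * (s + 1) + 4 + 2 * n) * V / (s + 1))) one_pos fun δ hδ _ => ⟨1, fun _ _ => rfl, ?_⟩)
    ENNReal.ofReal_lt_top
  refine ENNReal.ofReal_le_ofReal ?_
  have h := hardy hb hδ (1 : Sm n)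
  have hE : (WA n).E (1 : Sm n) = 0 := Derivation.map_one_eq_zero _
  have h0 : ∀ W : Sm n, jn δ W (0 : Sm n) = 0 := fun W => by
    have : W * (WI n δ).N2 (0 : Sm n) = 0 := by change W * (0 * _) = 0; rw [zero_mul, mul_zero]
    rw [jn, this, map_zero]
  rw [add_sub_cancel_right, hE, h0, mul_zero, add_zero] at h
  have h2 : jn δ (wt (s + 1) Cut.std hδ) (1 : Sm n) ≤ V := by
    have e : jn δ (wt (s + 1) Cut.std hδ) (1 : Sm n) = ∫ z in Kset n δ,
      ((wt (s + 1) Cut.std hδ * (WI n δ).N2 (1 : Sm n) : Sm n) z).re := J_val δ _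
    have i2 : IntegrableOn (fun _ : En n => (1 : ℝ)) (Kset n δ) (volume : Measure (En n)) :=
      continuousOn_const.integrableOn_compact (isCompact_Kset δ)
    have h5 : jn δ (wt (s + 1) Cut.std hδ) (1 : Sm n) ≤ ∫ z in Kset n δ, (1 : ℝ) := by
      rw [e]
      refine setIntegral_mono_on (intK_re (wt (s + 1) Cut.std hδ * (WI n δ).N2 (1 : Sm n)) δ) i2
        (isClosed_Kset δ).measurableSet fun z hz => ?_
      have hz0 : 0 < 1 - ‖z‖ ^ 2 := hδ.trans_le hz
      have hz1 : 1 - ‖z‖ ^ 2 ≤ 1 := by linarith [sq_nonneg ‖z‖]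
      have h1 : ‖(1 : Sm n) z‖ = 1 := norm_one
      rw [re_mul_N2, wt_re, h1, one_pow, mul_one]
      exact mul_le_one₀ (Real.rpow_le_one hz0.le hz1 hb.le)
        (std_nonneg' ((1 - ‖z‖ ^ 2) / δ) (by positivity)) (Cut.std_le_one _)
    refine h5.trans ?_
    rw [setIntegral_const, smul_eq_mul, mul_one]
    exact measureReal_mono (fun z (hz : δ ≤ 1 - ‖z‖ ^ 2) => mem_K.2 (hδ.le.trans hz))
      (isCompact_Kset 0).measure_lt_top.ne
  rw [le_div_iff₀ hb, mul_comm]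
  exact h.trans (mul_le_mul_of_nonneg_left h2 (by positivity))

theorem sq_norm_zero_le (hn : 1 ≤ n) (s : ℝ) : ∃ C : ℝ≥0, ∀ f, MHarm n 2 f →
    ENNReal.ofReal (‖f 0‖ ^ 2) ≤ C * JE n s f := by
  obtain ⟨C, d, hC, hd, h⟩ := exists_pointwise_bound hn le_rfl zero_lt_one
  have hw : 0 < min (d ^ s) 1 := lt_min (Real.rpow_pos_of_pos hd s) one_pos
  set w := min (d ^ s) 1
  have hAb : Ann n d ⊆ Metric.ball 0 1 := fun z hz => mem_ball_iff.2 (hd.trans_le hz.2)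
  refine ⟨(C / w).toNNReal, fun f hf => (ENNReal.ofReal_le_ofReal (h f hf 0 (by simp))).trans ?_⟩
  have hi : IntegrableOn (fun z => ‖f z‖ ^ 2) (Ann n d) (volume : Measure (En n)) :=
    ((hf.1.continuousOn.norm.pow 2).mono hAb).integrableOn_compact (isCompact_Ann d)
  have e : C * ∫ z in Ann n d, ‖f z‖ ^ 2 = C / w * ∫ z in Ann n d, w * ‖f z‖ ^ 2 := by
    rw [integral_const_mul]; field_simp
  rw [e, ENNReal.ofReal_mul (by positivity)]
  refine mul_le_mul_right ?_ _
  rw [ofReal_integral_eq_lintegral_ofReal (hi.const_mul w)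
    (Filter.Eventually.of_forall fun z => by positivity)]
  refine (setLIntegral_mono' (isCompact_Ann d).measurableSet fun z hz =>
    ENNReal.ofReal_le_ofReal ?_).trans (lintegral_mono_set hAb)
  refine mul_le_mul_of_nonneg_right ?_ (sq_nonneg _)
  have hz1 : 1 - ‖z‖ ^ 2 ≤ 1 := by linarith [sq_nonneg ‖z‖]
  rcases le_total 0 s with hs | hs
  · exact (min_le_left _ _).trans (Real.rpow_le_rpow hd.le hz.2 hs)
  · exact (min_le_right _ _).trans
      (Real.one_le_rpow_of_pos_of_le_one_of_nonpos (hd.trans_le hz.2) hz1 hs)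

end Sm

namespace Sm

variable {n : ℕ}

/-- The sum of the weighted norms of all `m`-fold tangential derivatives. -/
noncomputable def SE (n m : ℕ) (b : ℝ) (f : En n → ℂ) : ℝ≥0∞ :=
  ∑ js : Fin m → iotaX n, JE n b (iterX n js f)

theorem iterX_cons {m : ℕ} (i : iotaX n) (js : Fin m → iotaX n) (f : En n → ℂ) :
    iterX n (Fin.cons i js : Fin (m + 1) → iotaX n) f = Xop n i (iterX n js f) := by
  simp [iterX, List.ofFn_succ]

theorem SE_zero (b : ℝ) (f : En n → ℂ) : SE n 0 b f = JE n b f := by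
  simp [SE, iterX]

theorem SE_succ (m : ℕ) (b : ℝ) (f : En n → ℂ) : SE n (m + 1) b f =
    ∑ js : Fin m → iotaX n, ∑ i, JE n b (Xop n i (iterX n js f)) := by
  rw [SE, ← (Fin.consEquiv fun _ => iotaX n).sum_comp, Fintype.sum_prod_type, Finset.sum_comm]
  exact Finset.sum_congr rfl fun js _ => Finset.sum_congr rfl fun i _ => by
    rw [← iterX_cons]; rfl

theorem Good.iterX {f : En n → ℂ} (hf : Good n 0 f) (m : ℕ) : ∀ js : Fin m → iotaX n,
    ∃ k : ℤ, |k| ≤ m ∧ Good n k (_root_.iterX n js f) := by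
  induction m with
  | zero => exact fun js => ⟨0, by simp, by simpa [_root_.iterX] using hf⟩
  | succ m ih =>
    intro js
    obtain ⟨k, hk, h⟩ := ih (Fin.tail js)
    refine ⟨k + WirtAlg.sg (js 0), ?_, ?_⟩
    · refine (abs_add_le _ _).trans ?_
      rw [abs_sg]
      push_cast
      linarith
    · rw [← Fin.cons_self_tail js, iterX_cons]
      exact h.X (js 0)

theorem SE_le (s : ℝ) (m : ℕ) : ∃ C : ℝ≥0, ∀ f, Good n 0 f → SE n m (s + m) f ≤ C * JE n s f := by
  induction m with
  | zero => exact ⟨1, fun f _ => by simp [SE_zero]⟩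
  | succ m ih =>
    obtain ⟨C, hC⟩ := ih
    obtain ⟨D, hD⟩ := JE_X_le (n := n) (s + m) m
    refine ⟨Fintype.card (iotaX n) * D * C, fun f hf => ?_⟩
    have e : s + ((m + 1 : ℕ) : ℝ) = s + m + 1 := by push_cast; ring
    rw [SE_succ, e]
    calc ∑ js : Fin m → iotaX n, ∑ i, JE n (s + m + 1) (Xop n i (iterX n js f))
        ≤ ∑ js : Fin m → iotaX n, ∑ _i : iotaX n, D * JE n (s + m) (iterX n js f) :=
          Finset.sum_le_sum fun js _ => Finset.sum_le_sum fun i _ => by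
            obtain ⟨k, hk, h⟩ := hf.iterX m js
            exact hD k _ hk h i
      _ = Fintype.card (iotaX n) * D * SE n m (s + m) f := by
          simp only [Finset.sum_const, Finset.card_univ, nsmul_eq_mul, SE, Finset.mul_sum,
            mul_assoc]
      _ ≤ Fintype.card (iotaX n) * D * (C * JE n s f) := by gcongr; exact hC f hf
      _ = _ := by push_cast; ring

theorem SE_succ_le (hn : 2 ≤ n) {s : ℝ} (hs : -1 < s) (m : ℕ) : ∃ C : ℝ≥0, ∀ f, Good n 0 f →
    SE n (m + 1) (s + m + 1) f ≤ C * SE n (m + 2) (s + m + 2) f := by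
  have hb : 0 < s + m + 2 := by linarith [(Nat.cast_nonneg m : (0 : ℝ) ≤ m)]
  obtain ⟨D, hD⟩ := JE_le_X hn hb m
  refine ⟨Fintype.card (iotaX n) * D, fun f hf => ?_⟩
  have e : s + m + 1 = s + m + 2 - 1 := by ring
  rw [SE_succ, e]
  calc ∑ js : Fin m → iotaX n, ∑ i, JE n (s + m + 2 - 1) (Xop n i (iterX n js f))
      ≤ ∑ js : Fin m → iotaX n, ∑ _i : iotaX n,
          D * ∑ j, ∑ l, JE n (s + m + 2) (Xop n l (Xop n j (iterX n js f))) :=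
        Finset.sum_le_sum fun js _ => Finset.sum_le_sum fun i _ => by
          obtain ⟨k, hk, h⟩ := hf.iterX m js
          exact hD k _ hk h i
    _ = Fintype.card (iotaX n) * D * ∑ js : Fin m → iotaX n,
          ∑ j, ∑ l, JE n (s + m + 2) (Xop n l (Xop n j (iterX n js f))) := by
        simp only [Finset.sum_const, Finset.card_univ, nsmul_eq_mul]
        rw [← Finset.mul_sum, ← Finset.mul_sum, mul_assoc]
    _ = _ := by
        rw [SE_succ (m + 1), ← (Fin.consEquiv fun _ => iotaX n).sum_comp, Fintype.sum_prod_type,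
          Finset.sum_comm]
        push_cast
        congr 1
        exact Finset.sum_congr rfl fun j _ => Finset.sum_congr rfl fun js _ =>
          Finset.sum_congr rfl fun l _ => by rw [← iterX_cons j js]; rfl

theorem JE_le_SE_of_zero (hn : 2 ≤ n) {s : ℝ} (hs : -1 < s) (m : ℕ) : ∃ C : ℝ≥0, ∀ f,
    MHarm n 2 f → f 0 = 0 → JE n s f ≤ C * SE n (m + 1) (s + m + 1) f := by
  induction m with
  | zero =>
    obtain ⟨C, hC⟩ := JE_le_of_zero hn (show 0 < s + 1 by linarith)
    refine ⟨C, fun f hf h0 => ?_⟩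
    have := hC f hf h0
    rw [add_sub_cancel_right] at this
    simpa [SE_succ, iterX] using this
  | succ m ih =>
    obtain ⟨C, hC⟩ := ih
    obtain ⟨D, hD⟩ := SE_succ_le hn hs m
    refine ⟨C * D, fun f hf h0 => (hC f hf h0).trans ?_⟩
    have e : s + ((m + 1 : ℕ) : ℝ) + 1 = s + m + 2 := by push_cast; ring
    rw [e]
    push_cast
    rw [mul_assoc]
    gcongr
    exact hD f (MHarm.good (by omega) hf)

theorem wd_sub_const (f : En n → ℂ) (c : ℂ) (j : Fin n) :
    wd n j (fun z => f z - c) = wd n j f ∧ wdb n j (fun z => f z - c) = wdb n j f := by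
  constructor <;> funext z <;> simp only [wd, wdb, fderiv_sub_const]

theorem mharm_sub_const {f : En n → ℂ} (hf : MHarm n 2 f) (c : ℂ) :
    MHarm n 2 fun z => f z - c := by
  refine ⟨hf.1.sub contDiffOn_const, ?_⟩
  simpa only [wd_sub_const] using hf.2

theorem Xop_sub_const (f : En n → ℂ) (c : ℂ) (i : iotaX n) :
    Xop n i (fun z => f z - c) = Xop n i f := by
  rcases i with ⟨j, k⟩ | ⟨j, k⟩ <;> funext z <;>
  simp only [Xop, Sum.elim_inl, Sum.elim_inr, Lop, Lbarop, wd_sub_const]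

theorem iterX_sub_const (f : En n → ℂ) (c : ℂ) (m : ℕ) : ∀ js : Fin (m + 1) → iotaX n,
    iterX n js (fun z => f z - c) = iterX n js f := by
  induction m with
  | zero =>
    intro js
    rw [← Fin.cons_self_tail js, iterX_cons, iterX_cons]
    simpa [iterX] using Xop_sub_const f c _
  | succ m ih =>
    intro js
    rw [← Fin.cons_self_tail js, iterX_cons, iterX_cons, ih]

theorem JE_le_add_const (s : ℝ) (f : En n → ℂ) (c : ℂ) : JE n s f ≤
    2 * JE n s (fun z => f z - c) + 2 * ENNReal.ofReal (‖c‖ ^ 2) * JE n s fun _ => 1 := by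
  have hm : Measurable fun z : En n => ENNReal.ofReal ((1 - ‖z‖ ^ 2) ^ s * ‖(1 : ℂ)‖ ^ 2) := by
    have : Measurable fun z : En n => ‖z‖ := continuous_norm.measurable
    fun_prop
  rw [JE, JE, JE, ← lintegral_const_mul' _ _ (by finiteness), ← lintegral_const_mul _ hm,
    ← lintegral_add_right _ (hm.const_mul _)]
  refine setLIntegral_mono' Metric.isOpen_ball.measurableSet fun z hz => ?_
  have hz0 : 0 ≤ (1 - ‖z‖ ^ 2) ^ s := Real.rpow_nonneg (mem_ball_iff.1 hz).le s
  have h1 : ‖f z‖ ≤ ‖f z - c‖ + ‖c‖ := by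
    simpa using norm_add_le (f z - c) c
  have h2 : ‖f z‖ ^ 2 ≤ 2 * ‖f z - c‖ ^ 2 + 2 * ‖c‖ ^ 2 := by
    nlinarith [sq_nonneg (‖f z - c‖ - ‖c‖), norm_nonneg (f z), norm_nonneg (f z - c), norm_nonneg c]
  have e : ∀ x : ℝ, 2 * ENNReal.ofReal x = ENNReal.ofReal (2 * x) := fun x => by
    rw [ENNReal.ofReal_mul (by norm_num), ENNReal.ofReal_ofNat]
  rw [e, e,
    ← ENNReal.ofReal_mul (by positivity), ← ENNReal.ofReal_add (by positivity) (by positivity)]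
  refine ENNReal.ofReal_le_ofReal ?_
  rw [norm_one]
  linarith [mul_le_mul_of_nonneg_left h2 hz0]

theorem JE_le_SE (hn : 2 ≤ n) {s : ℝ} (hs : -1 < s) (m : ℕ) : ∃ C : ℝ≥0, ∀ f,
    MHarm n 2 f → JE n s f ≤ C * (SE n m (s + m) f + ENNReal.ofReal (‖f 0‖ ^ 2)) := by
  rcases m with _ | m
  · exact ⟨1, fun f _ => by simp [SE_zero]⟩
  obtain ⟨C, hC⟩ := JE_le_SE_of_zero hn hs m
  have hA := JE_one_lt_top (n := n) hs
  set A := (JE n s fun _ => 1).toNNReal with hA'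
  have hAe : (JE n s fun _ => 1) = A := (ENNReal.coe_toNNReal hA.ne).symm
  refine ⟨2 * C + 2 * A, fun f hf => (JE_le_add_const s f (f 0)).trans ?_⟩
  have h := hC _ (mharm_sub_const hf (f 0)) (sub_self _)
  have e : s + ((m + 1 : ℕ) : ℝ) = s + m + 1 := by push_cast; ring
  have e' : SE n (m + 1) (s + m + 1) (fun z => f z - f 0) = SE n (m + 1) (s + m + 1) f := by
    simp only [SE, iterX_sub_const]
  rw [e'] at h
  rw [hAe, e]
  push_cast
  set S := SE n (m + 1) (s + m + 1) f
  set F := ENNReal.ofReal (‖f 0‖ ^ 2)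
  calc 2 * JE n s (fun z => f z - f 0) + 2 * F * A ≤ 2 * (C * S) + 2 * F * A := by gcongr
    _ ≤ 2 * (C * S) + 2 * F * A + (2 * C * F + 2 * A * S) := le_self_add
    _ = _ := by ring

theorem poch_pos {s : ℝ} (hs : -1 < s) (k : ℕ) : 0 < poch (s + 1) k :=
  div_pos (Real.Gamma_pos_of_pos (by linarith [(Nat.cast_nonneg k : (0 : ℝ) ≤ k)]))
    (Real.Gamma_pos_of_pos (by linarith))

theorem nsqE_eq {s : ℝ} (hs : -1 < s) : ∃ P : ℝ≥0, P ≠ 0 ∧ ∀ f, nsqE n s f = P * JE n s f := by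
  have hp : 0 < poch (s + 1) n / Real.pi ^ n := div_pos (poch_pos hs n) (by positivity)
  refine ⟨(poch (s + 1) n / Real.pi ^ n).toNNReal, by simpa using hp, fun f => ?_⟩
  rw [nsqE, JE, ← lintegral_const_mul' _ _ (by finiteness)]
  refine lintegral_congr fun z => ?_
  rw [mul_assoc, ENNReal.ofReal_mul hp.le]
  rfl

/-- The norm equivalence, with constants in `ℝ≥0`. -/
theorem exists_norm_equiv (hn : 2 ≤ n) {s : ℝ} (hs : -1 < s) (m : ℕ) : ∃ C D : ℝ≥0,
    ∀ f : En n → ℂ, MHarm n 2 f →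
      nsqE n s f ≤ C * ((∑ js : Fin m → iotaX n, nsqE n (s + m) (iterX n js f)) +
        ENNReal.ofReal (‖f 0‖ ^ 2)) ∧
      (∑ js : Fin m → iotaX n, nsqE n (s + m) (iterX n js f)) + ENNReal.ofReal (‖f 0‖ ^ 2) ≤
        D * nsqE n s f := by
  have hm : (0 : ℝ) ≤ m := Nat.cast_nonneg m
  obtain ⟨P, hP, hPe⟩ := nsqE_eq (n := n) hs
  obtain ⟨R, hR, hRe⟩ := nsqE_eq (n := n) (s := s + m) (by linarith)
  obtain ⟨C, hC⟩ := JE_le_SE hn hs m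
  obtain ⟨D, hD⟩ := SE_le (n := n) s m
  obtain ⟨E, hE⟩ := sq_norm_zero_le (n := n) (by omega) s
  have hP' : ((P⁻¹ : ℝ≥0) : ℝ≥0∞) * P = 1 := by
    rw [← ENNReal.coe_mul, inv_mul_cancel₀ hP, ENNReal.coe_one]
  have hR' : ((R⁻¹ : ℝ≥0) : ℝ≥0∞) * R = 1 := by
    rw [← ENNReal.coe_mul, inv_mul_cancel₀ hR, ENNReal.coe_one]
  refine ⟨P * C * (R⁻¹ + 1), (R * D + E) * P⁻¹, fun f hf => ?_⟩
  have h1 := hC f hf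
  have h2 := hD f (MHarm.good (by omega) hf)
  have h3 := hE f hf
  simp only [hPe, hRe, ← Finset.mul_sum]
  change P * JE n s f ≤ _ * (R * SE n m (s + m) f + _) ∧ R * SE n m (s + m) f + _ ≤ _
  generalize SE n m (s + m) f = S at *
  generalize ENNReal.ofReal (‖f 0‖ ^ 2) = F at *
  generalize JE n s f = J at *
  push_cast
  constructor
  · calc (P : ℝ≥0∞) * J ≤ P * (C * (S + F)) := by gcongr
      _ = P * C * ((R⁻¹ : ℝ≥0) * R * S + F) := by rw [hR', one_mul, mul_assoc]
      _ ≤ P * C * ((R⁻¹ : ℝ≥0) * R * S + F) + P * C * ((R⁻¹ : ℝ≥0) * F + R * S) := le_self_add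
      _ = _ := by ring
  · calc (R : ℝ≥0∞) * S + F ≤ R * (D * J) + E * J := by gcongr
      _ = (R * D + E) * ((P⁻¹ : ℝ≥0) * P * J) := by rw [hP']; ring
      _ = _ := by ring

end Sm

/-- Theorem 4.1, parts (a) ⟺ (b), for `s > -1`:
`‖f‖²_s ≍ Σ_{j₁,…,j_m} ‖X_{j₁}⋯X_{j_m} f‖²_{s+m} + |f(0)|²` for `M`-harmonic `f`. -/
theorem statement4 (n : ℕ) (hn : 2 ≤ n) (s : ℝ) (hs : -1 < s) (m : ℕ) :
    ∃ c C : ℝ, 0 < c ∧ c < C ∧ ∀ f : En n → ℂ, MHarm n 2 f →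
      ENNReal.ofReal c * nsqE n s f ≤
          (∑ js : Fin m → iotaX n, nsqE n (s + m) (iterX n js f)) +
            ENNReal.ofReal (‖f 0‖ ^ 2) ∧
      (∑ js : Fin m → iotaX n, nsqE n (s + m) (iterX n js f)) + ENNReal.ofReal (‖f 0‖ ^ 2) ≤
        ENNReal.ofReal C * nsqE n s f := by
  obtain ⟨C, D, h⟩ := Sm.exists_norm_equiv hn hs m
  have hC : (0 : ℝ) < C + 1 := by positivity
  refine ⟨((C : ℝ) + 1)⁻¹, D + ((C : ℝ) + 1)⁻¹ + 1, inv_pos.2 hC, by linarith [D.coe_nonneg],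
    fun f hf => ?_⟩
  obtain ⟨h1, h2⟩ := h f hf
  have hc : ENNReal.ofReal ((C : ℝ) + 1)⁻¹ * C ≤ 1 := by
    rw [← ENNReal.ofReal_coe_nnreal, ← ENNReal.ofReal_mul (by positivity),
      ENNReal.ofReal_le_one, inv_mul_le_iff₀ hC]
    linarith
  refine ⟨?_, h2.trans ?_⟩
  · refine (mul_le_mul_right h1 _).trans ?_
    rw [← mul_assoc]
    exact mul_le_of_le_one_left' hc
  · refine mul_le_mul_left ?_ _
    rw [← ENNReal.ofReal_coe_nnreal]
    exact ENNReal.ofReal_le_ofReal (by linarith [inv_pos.2 hC])
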